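/- arXiv:2108.02630 — 4 statements merged into one kernel-verified Lean document; each statement's English description precedes it below -/
import Mathlib

section
/- The bipartite Ramsey number BR(C_8, C_8) equals 8. -/
open SimpleGraph Sum

/-- The complete bipartite graph `K_{t,t}` with both parts a copy of `Fin t`. -/
abbrev Kbb (t : ℕ) : SimpleGraph (Fin t ⊕ Fin t) := completeBipartiteGraph (Fin t) (Fin t)

/-- `G` contains a cycle of length `m`. -/
def HasCycleLen {V : Type*} (G : SimpleGraph V) (m : ℕ) : Prop :=
  ∃ (v : V) (w : G.Walk v v), w.IsCycle ∧ w.length = m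

/-- Every subgraph `G` of `K_{b,b}` contains a cycle of length `m`, or its bipartite
complement in `K_{b,b}` contains a cycle of length `n`. -/
def BRprop (m n b : ℕ) : Prop :=
  ∀ G : SimpleGraph (Fin b ⊕ Fin b), G ≤ Kbb b →
    HasCycleLen G m ∨ HasCycleLen (Kbb b \ G) n

/-- The bitwise union of the values of `g` over a list. -/
def orAll {α : Type*} (l : List α) (g : α → ℕ) : ℕ := l.foldr (fun x acc => g x ||| acc) 0

/-- The pairs of columns `(x, y)`, coded as bit `8 * x + y`, joined by a path
`x - a - u - b - v - c - y` through the rows `a`, `b`, `c` (bit masks of columns). -/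
def triplePaths (a b c : ℕ) : ℕ :=
  orAll (List.range 8) fun u => bif (a &&& b).testBit u then
    orAll (List.range 8) fun v => bif (b &&& c).testBit v && !(v == u) then
      orAll (List.range 8) fun x => bif a.testBit x && (!(x == u) && !(x == v)) then
        (c &&& (255 ^^^ (1 <<< u ||| (1 <<< v ||| 1 <<< x)))) <<< (8 * x)
      else 0
    else 0
  else 0

/-- The pairs of columns joined by a path through `r` and two of the rows `rs`. -/
def newPaths (r : ℕ) : List ℕ → ℕ
  | [] => 0
  | a :: rs =>
    orAll rs (fun b => triplePaths r a b ||| (triplePaths r b a ||| triplePaths a r b)) |||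
      newPaths r rs

/-- The pairs of columns joined by a path through three of the rows. -/
def allPaths : List ℕ → ℕ
  | [] => 0
  | r :: rs => newPaths r rs ||| allPaths rs

/-- Does the row `r` contain one of the pairs of columns in `F`? -/
def closes (F r : ℕ) : Bool :=
  (List.range 8).any fun x => r.testBit x && !(((F >>> (8 * x)) &&& r) == 0)

/-- Does the matrix with the given rows contain an eight-cycle? -/
def findsOctagon : List ℕ → Bool
  | [] => false
  | r :: rs => closes (allPaths rs) r || findsOctagon rs

/-- `force n f` is `f n`, written so that the kernel evaluates `n` before substituting it. -/
def force (n : ℕ) (f : ℕ → Bool) : Bool := Nat.rec (f 0) (fun m _ => f m.succ) n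

/-- The numbers below `256`, grouped by their number of binary ones. -/
def masksByWeight : List (ℕ × List ℕ) :=
  [(8, [255]),
   (7, [127, 191, 223, 239, 247, 251, 253, 254]),
   (6, [63, 95, 111, 119, 123, 125, 126, 159, 175, 183, 187, 189, 190, 207, 215, 219, 221,
     222, 231, 235, 237, 238, 243, 245, 246, 249, 250, 252]),
   (5, [31, 47, 55, 59, 61, 62, 79, 87, 91, 93, 94, 103, 107, 109, 110, 115, 117, 118, 121,
     122, 124, 143, 151, 155, 157, 158, 167, 171, 173, 174, 179, 181, 182, 185, 186, 188, 199,
     203, 205, 206, 211, 213, 214, 217, 218, 220, 227, 229, 230, 233, 234, 236, 241, 242, 244,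
     248]),
   (4, [15, 23, 27, 29, 30, 39, 43, 45, 46, 51, 53, 54, 57, 58, 60, 71, 75, 77, 78, 83, 85,
     86, 89, 90, 92, 99, 101, 102, 105, 106, 108, 113, 114, 116, 120, 135, 139, 141, 142, 147,
     149, 150, 153, 154, 156, 163, 165, 166, 169, 170, 172, 177, 178, 180, 184, 195, 197, 198,
     201, 202, 204, 209, 210, 212, 216, 225, 226, 228, 232, 240]),
   (3, [7, 11, 13, 14, 19, 21, 22, 25, 26, 28, 35, 37, 38, 41, 42, 44, 49, 50, 52, 56, 67, 69,
     70, 73, 74, 76, 81, 82, 84, 88, 97, 98, 100, 104, 112, 131, 133, 134, 137, 138, 140, 145,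
     146, 148, 152, 161, 162, 164, 168, 176, 193, 194, 196, 200, 208, 224]),
   (2, [3, 5, 6, 9, 10, 12, 17, 18, 20, 24, 33, 34, 36, 40, 48, 65, 66, 68, 72, 80, 96, 129,
     130, 132, 136, 144, 160, 192]),
   (1, [1, 2, 4, 8, 16, 32, 64, 128]),
   (0, [0])]

/-- `E` codes the pairs of adjacent columns that agree so far; such a pair must not become
increasing in the row `r`. -/
def keepsOrder (E r : ℕ) : Bool := (E &&& (r >>> 1)) &&& (255 ^^^ r) == 0

/-- The pairs of adjacent columns in `E` that agree in `r` as well. -/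
def agreeing (E r : ℕ) : ℕ := E &&& (255 ^^^ (r ^^^ (r >>> 1)))

/-- Exhaustive search: `search n rs s d E F` checks that any extension of the rows `rs` (of total
weight `s`) by `n` rows of nonincreasing weight at most `d`, with ordered columns and total weight
at least `32`, contains an eight-cycle or has one in its complement. -/
def search : ℕ → List ℕ → ℕ → ℕ → ℕ → ℕ → Bool
  | 0, rs, _, _, _, _ => findsOctagon (rs.map (255 ^^^ ·))
  | n + 1, rs, s, d, E, F =>
    force s fun s => force E fun E => force F fun F =>
      masksByWeight.all fun p => Nat.blt d p.1 || (Nat.blt (s + (n + 1) * p.1) 32 ||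
        p.2.all fun r => !keepsOrder E r || (closes F r ||
          search n (r :: rs) (s + p.1) p.1 (agreeing E r) (newPaths r rs ||| F)))

/-- The number of binary ones of `r` among the lowest eight digits. -/
def weight (r : ℕ) : ℕ := (List.range 8).countP r.testBit

/-- The columns `x` and `y` are joined by a path through three of the rows. -/
def PathThrough (rs : List ℕ) (x y : ℕ) : Prop :=
  ∃ a b c u v, [a, b, c].Subperm rs ∧ [x, u, v, y].Nodup ∧
    a.testBit x ∧ a.testBit u ∧ b.testBit u ∧ b.testBit v ∧ c.testBit v ∧ c.testBit y

/-- The matrix with the given rows contains an eight-cycle. -/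
def Octagon (rs : List ℕ) : Prop :=
  ∃ a b c d x u v y, [d, a, b, c].Subperm rs ∧ [x, u, v, y].Nodup ∧
    a.testBit x ∧ a.testBit u ∧ b.testBit u ∧ b.testBit v ∧ c.testBit v ∧ c.testBit y ∧
    d.testBit y ∧ d.testBit x

theorem PathThrough.cons {rs : List ℕ} {x y : ℕ} (r : ℕ) (h : PathThrough rs x y) :
    PathThrough (r :: rs) x y := by
  obtain ⟨a, b, c, u, v, hs, h⟩ := h
  exact ⟨a, b, c, u, v, hs.trans (List.sublist_cons_self r rs).subperm, h⟩

theorem Octagon.of_perm {rs rs' : List ℕ} (hp : rs.Perm rs') (h : Octagon rs) : Octagon rs' := by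
  obtain ⟨a, b, c, d, x, u, v, y, hs, h⟩ := h
  exact ⟨a, b, c, d, x, u, v, y, hs.trans hp.subperm, h⟩

theorem Octagon.append_right {rs : List ℕ} (l : List ℕ) (h : Octagon rs) : Octagon (l ++ rs) := by
  obtain ⟨a, b, c, d, x, u, v, y, hs, h⟩ := h
  exact ⟨a, b, c, d, x, u, v, y, hs.trans (List.sublist_append_right l rs).subperm, h⟩

theorem force_eq (n : ℕ) (f : ℕ → Bool) : force n f = f n := by
  cases n <;> rfl

theorem exists_of_testBit_orAll {α : Type*} {l : List α} {g : α → ℕ} {i : ℕ}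
    (h : (orAll l g).testBit i) : ∃ x ∈ l, (g x).testBit i := by
  induction l with
  | nil => simp [orAll] at h
  | cons a l ih =>
    have h' : (g a ||| orAll l g).testBit i = true := h
    rw [Nat.testBit_or, Bool.or_eq_true] at h'
    rcases h' with h' | h'
    · exact ⟨a, by simp, h'⟩
    · obtain ⟨x, hx, hx'⟩ := ih h'
      exact ⟨x, by simp [hx], hx'⟩

/-- Every pair of columns coded by `F` is joined by a path through the rows `rs`. -/
def SoundFor (rs : List ℕ) (F : ℕ) : Prop :=
  ∀ i, F.testBit i → ∃ x y, x < 8 ∧ y < 8 ∧ i = 8 * x + y ∧ PathThrough rs x y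

theorem SoundFor.zero (rs : List ℕ) : SoundFor rs 0 := by
  intro i hi
  simp at hi

theorem SoundFor.or {rs : List ℕ} {F G : ℕ} (hF : SoundFor rs F) (hG : SoundFor rs G) :
    SoundFor rs (F ||| G) := by
  intro i hi
  rw [Nat.testBit_or, Bool.or_eq_true] at hi
  exact hi.elim (hF i) (hG i)

theorem SoundFor.cons {rs : List ℕ} {F : ℕ} (r : ℕ) (hF : SoundFor rs F) :
    SoundFor (r :: rs) F := by
  intro i hi
  obtain ⟨x, y, hx, hy, hi, hp⟩ := hF i hi
  exact ⟨x, y, hx, hy, hi, hp.cons r⟩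

theorem SoundFor.orAll {α : Type*} {rs : List ℕ} {l : List α} {g : α → ℕ}
    (h : ∀ x ∈ l, SoundFor rs (g x)) : SoundFor rs (orAll l g) := by
  intro i hi
  obtain ⟨x, hx, hx'⟩ := exists_of_testBit_orAll hi
  exact h x hx i hx'

theorem lt_eight_of_testBit {r i : ℕ} (hr : r < 256) (h : r.testBit i) : i < 8 := by
  by_contra! hi
  have h2 : r < 2 ^ i := hr.trans_le (by simpa using Nat.pow_le_pow_right (n := 2) (by norm_num) hi)
  simp [Nat.testBit_lt_two_pow h2] at h

theorem soundFor_triplePaths {rs : List ℕ} {a b c : ℕ} (hs : [a, b, c].Subperm rs)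
    (hc : c < 256) : SoundFor rs (triplePaths a b c) := by
  refine SoundFor.orAll fun u _ => ?_
  cases hu : (a &&& b).testBit u
  · exact SoundFor.zero rs
  refine SoundFor.orAll fun v _ => ?_
  cases hv : (b &&& c).testBit v && !(v == u)
  · exact SoundFor.zero rs
  refine SoundFor.orAll fun x hx8 => ?_
  cases hx : a.testBit x && (!(x == u) && !(x == v))
  · exact SoundFor.zero rs
  intro i hi
  simp only [cond_true, Nat.testBit_shiftLeft, Nat.testBit_and, Nat.testBit_xor, Nat.testBit_or,
    Nat.one_shiftLeft, Nat.testBit_two_pow, Bool.and_eq_true, decide_eq_true_eq] at hi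
  simp only [Nat.testBit_and, Bool.and_eq_true, Bool.not_eq_true', beq_eq_false_iff_ne] at hu hv hx
  obtain ⟨hi, hy, hne⟩ := hi
  have hy8 := lt_eight_of_testBit hc hy
  have h255 : Nat.testBit 255 (i - 8 * x) = true := by
    generalize i - 8 * x = j at hy8
    interval_cases j <;> decide
  rw [h255] at hne
  simp at hne
  refine ⟨x, i - 8 * x, by simpa using hx8, hy8, by omega, a, b, c, u, v, hs, ?_, hx.1, hu.1, hu.2,
    hv.1.1, hv.1.2, hy⟩
  simp only [List.nodup_cons, List.mem_cons, List.not_mem_nil, or_false, not_or]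
  grind

theorem soundFor_newPaths {rs : List ℕ} {r : ℕ} (h : ∀ a ∈ r :: rs, a < 256) :
    SoundFor (r :: rs) (newPaths r rs) := by
  induction rs with
  | nil => exact SoundFor.zero _
  | cons a rs ih =>
    refine SoundFor.or (SoundFor.orAll fun b hb => ?_) ?_
    · have hs : [r, a, b].Subperm (r :: a :: rs) :=
        (((List.singleton_sublist.2 hb).cons_cons a).cons_cons r).subperm
      have hr := h r (by simp)
      have hb := h b (by simp [hb])
      refine .or (soundFor_triplePaths hs hb) (.or (soundFor_triplePaths ?_ (h a (by simp)))
        (soundFor_triplePaths ?_ hb))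
      · exact (List.Perm.cons r (List.Perm.swap a b [])).subperm.trans hs
      · exact (List.Perm.swap r a [b]).subperm.trans hs
    · intro i hi
      obtain ⟨x, y, hx, hy, hi, a', b, c, u, v, hs, hp⟩ := ih (fun b hb => h b (by grind)) i hi
      refine ⟨x, y, hx, hy, hi, a', b, c, u, v, hs.trans ?_, hp⟩
      exact ((List.sublist_cons_self a rs).cons_cons r).subperm

theorem soundFor_allPaths {rs : List ℕ} (h : ∀ a ∈ rs, a < 256) :
    SoundFor rs (allPaths rs) := by
  induction rs with
  | nil => exact SoundFor.zero _
  | cons a rs ih =>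
    exact (soundFor_newPaths h).or ((ih fun b hb => h b (by simp [hb])).cons a)

theorem octagon_of_closes {rs : List ℕ} {F r : ℕ} (hr : r < 256) (hF : SoundFor rs F)
    (h : closes F r) : Octagon (r :: rs) := by
  simp only [closes, List.any_eq_true, Bool.and_eq_true, Bool.not_eq_true',
    beq_eq_false_iff_ne] at h
  obtain ⟨x, hx, hrx, hne⟩ := h
  obtain ⟨y, hy⟩ := Nat.exists_testBit_of_ne_zero hne
  simp only [Nat.testBit_and, Nat.testBit_shiftRight, Bool.and_eq_true] at hy
  obtain ⟨x', y', hx', hy', hi, a, b, c, u, v, hs, hp⟩ := hF _ hy.1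
  have hy8 := lt_eight_of_testBit hr hy.2
  obtain ⟨rfl, rfl⟩ : x' = x ∧ y' = y := by omega
  exact ⟨a, b, c, r, x', u, v, y', (List.subperm_cons r).2 hs, hp.1, hp.2.1, hp.2.2.1, hp.2.2.2.1,
    hp.2.2.2.2.1, hp.2.2.2.2.2.1, hp.2.2.2.2.2.2, hy.2, hrx⟩

theorem octagon_of_findsOctagon {rs : List ℕ} (h : ∀ a ∈ rs, a < 256) (hf : findsOctagon rs) :
    Octagon rs := by
  induction rs with
  | nil => simp [findsOctagon] at hf
  | cons a rs ih =>
    simp only [findsOctagon, Bool.or_eq_true] at hf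
    have h' : ∀ b ∈ rs, b < 256 := fun b hb => h b (by simp [hb])
    rcases hf with hf | hf
    · exact octagon_of_closes (h a (by simp)) (soundFor_allPaths h') hf
    · exact (ih h' hf).append_right [a]

theorem exists_mem_masksByWeight {r : ℕ} (hr : r < 256) :
    ∃ p ∈ masksByWeight, p.1 = weight r ∧ r ∈ p.2 := by
  have : ∀ r < 256, masksByWeight.any fun p => p.1 == weight r && p.2.contains r := by
    decide +kernel
  simpa using this r hr

/-- The list of rows is admissible for the search: the weights are nonincreasing and at most `d`,
and the pairs of columns coded by `E` are ordered. -/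
def Admissible : ℕ → ℕ → List ℕ → Prop
  | _, _, [] => True
  | d, E, r :: ls =>
    r < 256 ∧ weight r ≤ d ∧ keepsOrder E r ∧ Admissible (weight r) (agreeing E r) ls

theorem Admissible.sum_weight_le {d E : ℕ} {ls : List ℕ} (h : Admissible d E ls) :
    (ls.map weight).sum ≤ ls.length * d := by
  induction ls generalizing d E with
  | nil => simp
  | cons r ls ih =>
    obtain ⟨-, hd, -, h⟩ := h
    have := ih h
    simp only [List.map_cons, List.sum_cons, List.length_cons]
    nlinarith

theorem octagon_of_search {ls rs : List ℕ} {s d E F : ℕ} (hrs : ∀ a ∈ rs, a < 256)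
    (hF : SoundFor rs F) (hls : Admissible d E ls) (hs : 32 ≤ s + (ls.map weight).sum)
    (h : search ls.length rs s d E F) :
    Octagon (ls.reverse ++ rs) ∨ Octagon ((ls.reverse ++ rs).map (255 ^^^ ·)) := by
  induction ls generalizing rs s d E F with
  | nil =>
    refine .inr (octagon_of_findsOctagon ?_ h)
    intro a ha
    obtain ⟨b, hb, rfl⟩ := List.mem_map.1 ha
    exact Nat.xor_lt_two_pow (n := 8) (by norm_num) (hrs b hb)
  | cons r ls ih =>
    have hsum := hls.sum_weight_le
    obtain ⟨hr, hd, hE, hls⟩ := hls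
    obtain ⟨p, hp, hpw, hrp⟩ := exists_mem_masksByWeight hr
    have hrs' : ∀ a ∈ r :: rs, a < 256 := by simpa [hr] using hrs
    have hsum' := hls.sum_weight_le
    simp only [List.map_cons, List.sum_cons] at hs
    simp only [List.length_cons, search, force_eq, List.all_eq_true] at h
    have h := h p hp
    rw [hpw] at h
    have h1 : Nat.blt d (weight r) = false := by
      rw [Bool.eq_false_iff, ne_eq, Nat.blt_eq]; omega
    have h2 : Nat.blt (s + (ls.length + 1) * weight r) 32 = false := by
      rw [Bool.eq_false_iff, ne_eq, Nat.blt_eq]; nlinarith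
    rw [h1, h2, Bool.false_or, Bool.false_or, List.all_eq_true] at h
    have h := h r hrp
    rw [hE, Bool.not_true, Bool.false_or, Bool.or_eq_true] at h
    rw [List.reverse_cons, List.append_assoc, List.singleton_append]
    rcases h with h | h
    · exact .inl ((octagon_of_closes hr hF h).append_right _)
    · exact ih hrs' ((soundFor_newPaths hrs').or (hF.cons r)) hls (by omega) h

theorem testBit_of_agreeing {E r j : ℕ} (h : (agreeing E r).testBit j) (hj : j < 7) :
    E.testBit j ∧ r.testBit j = r.testBit (j + 1) := by
  have h255 : Nat.testBit 255 j = true := by interval_cases j <;> decide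
  simp only [agreeing, Nat.testBit_and, Nat.testBit_xor, Nat.testBit_shiftRight, h255,
    Bool.and_eq_true] at h
  refine ⟨h.1, ?_⟩
  rw [add_comm j 1]
  simpa using h.2

theorem keepsOrder_of_forall {E r : ℕ}
    (h : ∀ j, E.testBit j → j < 7 ∧ (r.testBit (j + 1) → r.testBit j)) : keepsOrder E r := by
  rw [keepsOrder, beq_iff_eq]
  refine Nat.eq_of_testBit_eq fun j => ?_
  rw [Nat.zero_testBit, Bool.eq_false_iff]
  intro hj
  simp only [Nat.testBit_and, Nat.testBit_xor, Nat.testBit_shiftRight, Bool.and_eq_true] at hj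
  obtain ⟨hj7, hr⟩ := h j hj.1.1
  have h255 : Nat.testBit 255 j = true := by interval_cases j <;> decide
  have hr := hr (by simpa [add_comm] using hj.1.2)
  simp [h255, hr] at hj

/-- A matrix given by its rows `f 0, …, f 7`, with nonincreasing weights and lexicographically
ordered columns, is admissible for the search. -/
theorem admissible_map_range' {f : ℕ → ℕ} {n k d E : ℕ} (hk : k + n = 8)
    (hlt : ∀ i < 8, f i < 256) (hw : ∀ i j, i ≤ j → j < 8 → weight (f j) ≤ weight (f i))
    (hcol : ∀ j < 7, ∀ k < 8, (∀ i < k, (f i).testBit j = (f i).testBit (j + 1)) →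
      (f k).testBit (j + 1) → (f k).testBit j)
    (hd : ∀ i, k ≤ i → i < 8 → weight (f i) ≤ d)
    (hE : ∀ j, E.testBit j → j < 7 ∧ ∀ i < k, (f i).testBit j = (f i).testBit (j + 1)) :
    Admissible d E ((List.range' k n).map f) := by
  induction n generalizing k d E with
  | zero => trivial
  | succ n ih =>
    refine ⟨hlt k (by omega), hd k le_rfl (by omega), keepsOrder_of_forall fun j hj => ?_,
      ih (by omega) (fun i hi hi8 => hw k i (by omega) hi8) fun j hj => ?_⟩
    · exact ⟨(hE j hj).1, hcol j (hE j hj).1 k (by omega) (hE j hj).2⟩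
    · have hj' : E.testBit j := by
        simp only [agreeing, Nat.testBit_and, Bool.and_eq_true] at hj
        exact hj.1
      obtain ⟨hj7, hi⟩ := hE j hj'
      refine ⟨hj7, fun i hik => ?_⟩
      rcases Nat.lt_succ_iff_lt_or_eq.1 hik with h | rfl
      · exact hi i h
      · exact (testBit_of_agreeing hj hj7).2

/-- The zero-one matrix `M`, seen as a bipartite graph, contains an eight-cycle. -/
def HasOctagon {α β : Type*} (M : α → β → Bool) : Prop :=
  ∃ (a : Fin 4 → α) (b : Fin 4 → β), a.Injective ∧ b.Injective ∧
    ∀ i, M (a i) (b i) ∧ M (a i) (b (i + 1))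

theorem HasOctagon.of_comp {α β α' β' : Type*} {M : α → β → Bool} {σ : α' → α} {τ : β' → β}
    (hσ : σ.Injective) (hτ : τ.Injective) (h : HasOctagon fun i j => M (σ i) (τ j)) :
    HasOctagon M := by
  obtain ⟨a, b, ha, hb, h⟩ := h
  exact ⟨σ ∘ a, τ ∘ b, hσ.comp ha, hτ.comp hb, h⟩

theorem hasOctagon_of_octagon {M : Fin 8 → Fin 8 → Bool} {f : ℕ → ℕ}
    (hf : ∀ (i : Fin 8) j, (f i).testBit j → ∃ h : j < 8, M i ⟨j, h⟩)
    (h : Octagon ((List.range 8).map f)) : HasOctagon M := by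
  obtain ⟨a, b, c, d, x, u, v, y, ⟨l, hl, hs⟩, hn, h⟩ := h
  obtain ⟨l', hl', rfl⟩ := List.sublist_map_iff.1 hs
  obtain ⟨l'', he, hp⟩ :=
    (congrFun (congrFun (List.eq_map_comp_perm f) [d, a, b, c]) l').mpr hl.symm
  have hmem : ∀ i ∈ l'', i < 8 := fun i hi => by simpa using hl'.subset (hp.subset hi)
  have hnd : l''.Nodup := hp.nodup_iff.2 (hl'.nodup List.nodup_range)
  match l'', he with
  | [i₃, i₀, i₁, i₂], he =>
    simp only [List.map_cons, List.map_nil, List.cons.injEq, and_true] at he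
    obtain ⟨rfl, rfl, rfl, rfl⟩ := he
    simp only [List.mem_cons, List.not_mem_nil, or_false, forall_eq_or_imp, forall_eq] at hmem
    obtain ⟨h₃, h₀, h₁, h₂⟩ := hmem
    obtain ⟨h0x, h0u, h1u, h1v, h2v, h2y, h3y, h3x⟩ := h
    obtain ⟨hx, h0x⟩ := hf ⟨i₀, h₀⟩ _ h0x
    obtain ⟨hu, h0u⟩ := hf ⟨i₀, h₀⟩ _ h0u
    obtain ⟨hv, h1v⟩ := hf ⟨i₁, h₁⟩ _ h1v
    obtain ⟨hy, h2y⟩ := hf ⟨i₂, h₂⟩ _ h2y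
    obtain ⟨_, h1u⟩ := hf ⟨i₁, h₁⟩ _ h1u
    obtain ⟨_, h2v⟩ := hf ⟨i₂, h₂⟩ _ h2v
    obtain ⟨_, h3y⟩ := hf ⟨i₃, h₃⟩ _ h3y
    obtain ⟨_, h3x⟩ := hf ⟨i₃, h₃⟩ _ h3x
    refine ⟨![⟨i₀, h₀⟩, ⟨i₁, h₁⟩, ⟨i₂, h₂⟩, ⟨i₃, h₃⟩],
      ![⟨x, hx⟩, ⟨u, hu⟩, ⟨v, hv⟩, ⟨y, hy⟩], ?_, ?_, ?_⟩
    · rw [← List.nodup_ofFn]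
      simp at hnd ⊢
      grind
    · rw [← List.nodup_ofFn]
      simp at hn ⊢
      grind
    · intro i
      fin_cases i
      exacts [⟨h0x, h0u⟩, ⟨h1u, h1v⟩, ⟨h2v, h2y⟩, ⟨h3y, h3x⟩]

theorem weight_ofBits (g : Fin 8 → Bool) : weight (Nat.ofBits g) = ∑ j, (g j).toNat := by
  have h : ∀ j : Fin 8, (Nat.ofBits g).testBit j = g j := fun j =>
    Nat.testBit_ofBits_lt g j j.2
  simp only [← h, Fin.sum_univ_eight, weight, List.range_succ, List.countP_append,
    List.countP_singleton, List.range_zero, List.countP_nil, zero_add, Bool.toNat, Bool.cond_eq_ite]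
  rfl

theorem search_eq_true : search 8 [] 0 8 127 0 = true := by decide +kernel

theorem hasOctagon_of_ordered {M : Fin 8 → Fin 8 → Bool}
    (hw : Antitone fun i => ∑ j, (M i j).toNat)
    (hcol : Monotone fun j => toLex fun i => !M i j) (h32 : 32 ≤ ∑ i, ∑ j, (M i j).toNat) :
    HasOctagon M ∨ HasOctagon fun i j => !M i j := by
  set f : ℕ → ℕ := fun i => if h : i < 8 then Nat.ofBits (M ⟨i, h⟩) else 0 with hf
  have hfi : ∀ i : Fin 8, f i = Nat.ofBits (M i) := fun i => by simp [hf]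
  have hfw : ∀ i : Fin 8, weight (f i) = ∑ j, (M i j).toNat := fun i => by
    rw [hfi, weight_ofBits]
  have hbit : ∀ i j : Fin 8, (f i).testBit j = M i j := fun i j => by
    rw [hfi]; exact Nat.testBit_ofBits_lt _ _ j.2
  have hlt : ∀ i < 8, f i < 256 := fun i hi => by
    rw [hfi ⟨i, hi⟩]; exact Nat.ofBits_lt_two_pow _
  have hweight : ∀ i < 8, weight (f i) ≤ 8 := fun i _ => List.countP_le_length
  have hadm : Admissible 8 127 ((List.range' 0 8).map f) := by
    refine admissible_map_range' (by norm_num) hlt (fun i j hij hj => ?_)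
      (fun j hj k hk heq hkj => ?_) (fun i _ => hweight i) (fun j hj => ⟨?_, by simp⟩)
    · rw [hfw ⟨j, hj⟩, hfw ⟨i, hij.trans_lt hj⟩]
      exact hw hij
    · by_contra hkj'
      have hle := hcol (show (⟨j, by omega⟩ : Fin 8) ≤ ⟨j + 1, by omega⟩ by simp)
      refine absurd hle (not_le_of_gt ⟨⟨k, hk⟩, fun i hi => ?_, ?_⟩)
      · have := heq i hi
        rw [hbit i ⟨j, by omega⟩, hbit i ⟨j + 1, by omega⟩] at this
        simp [this]
      · rw [hbit ⟨k, hk⟩ ⟨j + 1, by omega⟩] at hkj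
        rw [hbit ⟨k, hk⟩ ⟨j, by omega⟩] at hkj'
        simp [hkj, hkj']
    · by_contra! hj7
      have : 127 < 2 ^ j :=
        lt_of_lt_of_le (by norm_num) (Nat.pow_le_pow_right (n := 2) (by norm_num) hj7)
      simp [Nat.testBit_lt_two_pow this] at hj
  have hsum : 32 ≤ 0 + (((List.range' 0 8).map f).map weight).sum := by
    rw [Fin.sum_univ_eight] at h32
    simp only [← hfw] at h32
    simpa [List.range'_succ, add_assoc] using h32
  have hres := octagon_of_search (rs := []) (by simp) (SoundFor.zero _) hadm hsum
    (by simpa using search_eq_true)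
  rw [List.append_nil, ← List.range_eq_range'] at hres
  refine hres.imp (fun h => ?_) (fun h => ?_)
  · refine hasOctagon_of_octagon (f := f) (fun i j hj => ?_) (h.of_perm (List.reverse_perm _))
    have hj8 := lt_eight_of_testBit (hlt i i.2) hj
    exact ⟨hj8, by rwa [← hbit]⟩
  · have h := h.of_perm ((List.reverse_perm _).map _)
    rw [List.map_map] at h
    refine hasOctagon_of_octagon (fun i j hj => ?_) h
    have hlt' : 255 ^^^ f i < 256 := Nat.xor_lt_two_pow (n := 8) (by norm_num) (hlt i i.2)
    have hj8 := lt_eight_of_testBit hlt' hj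
    have h255 : Nat.testBit 255 j = true := by interval_cases j <;> decide
    refine ⟨hj8, ?_⟩
    rw [← hbit]
    simpa [h255] using hj

theorem hasOctagon_or_not_of_le {M : Fin 8 → Fin 8 → Bool}
    (h32 : 32 ≤ ∑ i, ∑ j, (M i j).toNat) : HasOctagon M ∨ HasOctagon fun i j => !M i j := by
  set σ := Tuple.sort fun i => OrderDual.toDual (∑ j, (M i j).toNat) with hσ
  set τ := Tuple.sort fun j => toLex fun i => !M (σ i) j with hτ
  have hsum : ∀ i, ∑ j, (M (σ i) (τ j)).toNat = ∑ j, (M (σ i) j).toNat := fun i =>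
    Equiv.sum_comp τ fun j => (M (σ i) j).toNat
  have key := hasOctagon_of_ordered (M := fun i j => M (σ i) (τ j)) ?_ ?_ ?_
  · exact key.imp (.of_comp σ.injective τ.injective)
      (.of_comp (M := fun i j => !M i j) σ.injective τ.injective)
  · simp only [hsum]
    exact Tuple.monotone_sort fun i => OrderDual.toDual (∑ j, (M i j).toNat)
  · exact Tuple.monotone_sort fun j => toLex fun i => !M (σ i) j
  · simp only [hsum]
    rwa [Equiv.sum_comp σ fun i => ∑ j, (M i j).toNat]

theorem hasOctagon_or_not (M : Fin 8 → Fin 8 → Bool) :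
    HasOctagon M ∨ HasOctagon fun i j => !M i j := by
  have htot : ∑ i, ∑ j, (M i j).toNat + ∑ i, ∑ j, (!M i j).toNat = 64 := by
    have h1 : ∀ b : Bool, b.toNat + (!b).toNat = 1 := by decide
    simp [← Finset.sum_add_distrib, h1]
  rcases le_total 32 (∑ i, ∑ j, (M i j).toNat) with h | h
  · exact hasOctagon_or_not_of_le h
  · simpa using (hasOctagon_or_not_of_le (M := fun i j => !M i j) (by omega)).symm

theorem hasCycleLen_eight {V : Type*} {G : SimpleGraph V} {a b : Fin 4 → V}
    (ha : a.Injective) (hb : b.Injective) (hab : ∀ i j, a i ≠ b j)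
    (h : ∀ i, G.Adj (a i) (b i)) (h' : ∀ i, G.Adj (a i) (b (i + 1))) : HasCycleLen G 8 := by
  refine ⟨a 0, .cons (h' 0) (.cons (h 1).symm (.cons (h' 1) (.cons (h 2).symm (.cons (h' 2)
    (.cons (h 3).symm (.cons (h' 3) (.cons (h 0).symm .nil))))))), ?_, rfl⟩
  rw [Walk.cons_isCycle_iff, Walk.isPath_def]
  have hba : ∀ i j, b i ≠ a j := fun i j => (hab j i).symm
  constructor
  · simp [ha.eq_iff, hb.eq_iff, hab, hba]
  · simp [ha.eq_iff, hb.eq_iff, hab, hba]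

/-- The pairs of vertices `i < 7 ≤ 7 + j` joined in a two-colouring of `K_{7,7}` without
monochromatic eight-cycles: the matrix `red` and its complement consist of copies of `K_{3,4}`
glued at a vertex. -/
def red (i j : ℕ) : Bool := j == 0 || (!(i == 0) && (Nat.ble i 3 == Nat.ble j 3))

/-- The symmetric relation on `{0, …, 13}` given by a matrix with row indices `0, …, 6` and column
indices `7, …, 13`. -/
def bipartiteRel (M : ℕ → ℕ → Bool) (u v : ℕ) : Bool :=
  Nat.blt u 7 && (Nat.ble 7 v && M u (v - 7)) || Nat.blt v 7 && (Nat.ble 7 u && M v (u - 7))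

/-- The relation `A` on `{0, …, 13}` has no closed walk of length eight in which any two vertices
at even distance differ. -/
def octagonFree (A : ℕ → ℕ → Bool) : Bool :=
  let all := (List.range 14).all
  all fun v₀ => all fun v₁ => !A v₀ v₁ || all fun v₂ => !(A v₁ v₂ && v₂ != v₀) ||
    all fun v₃ => !(A v₂ v₃ && v₃ != v₁) || all fun v₄ => !(A v₃ v₄ && (v₄ != v₀ && v₄ != v₂)) ||
    all fun v₅ => !(A v₄ v₅ && (v₅ != v₁ && v₅ != v₃)) ||
    all fun v₆ => !(A v₅ v₆ && (v₆ != v₀ && (v₆ != v₂ && v₆ != v₄))) ||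
    all fun v₇ => !(A v₆ v₇ && (v₇ != v₁ && (v₇ != v₃ && (v₇ != v₅ && A v₇ v₀))))

theorem octagonFree_red : octagonFree (bipartiteRel red) := by
  decide +kernel

theorem octagonFree_not_red : octagonFree (bipartiteRel fun i j => !red i j) := by
  decide +kernel

theorem not_hasCycleLen_of_octagonFree {A : ℕ → ℕ → Bool} (hA : octagonFree A) {V : Type*}
    {G : SimpleGraph V} {c : V → ℕ} (hc : c.Injective) (hlt : ∀ v, c v < 14)
    (hadj : ∀ u v, G.Adj u v → A (c u) (c v)) : ¬ HasCycleLen G 8 := by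
  rintro ⟨v, w, hw, hl⟩
  have hne : ∀ i j, i < 8 → j < 8 → i ≠ j → c (w.getVert i) ≠ c (w.getVert j) := by
    intro i j hi hj hij h
    exact hij (hw.getVert_injOn' (by simp; omega) (by simp; omega) (hc h))
  have hstep : ∀ i < 8, A (c (w.getVert i)) (c (w.getVert (i + 1))) := fun i hi =>
    hadj _ _ (w.adj_getVert_succ (by omega))
  simp only [octagonFree, List.all_eq_true, List.mem_range, Bool.or_eq_true, Bool.not_eq_true',
    Bool.eq_false_iff, ne_eq, Bool.and_eq_true, bne_iff_ne, ← imp_iff_not_or] at hA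
  have h80 : w.getVert 8 = w.getVert 0 := by
    rw [w.getVert_zero, w.getVert_of_length_le hl.le]
  have h70 := hstep 7 (by simp)
  rw [h80] at h70
  refine hA _ (hlt (w.getVert 0)) _ (hlt (w.getVert 1)) (hstep 0 (by simp))
    _ (hlt _) ⟨hstep 1 (by simp), hne 2 0 ?_ ?_ ?_⟩
    _ (hlt _) ⟨hstep 2 (by simp), hne 3 1 ?_ ?_ ?_⟩
    _ (hlt _) ⟨hstep 3 (by simp), hne 4 0 ?_ ?_ ?_, hne 4 2 ?_ ?_ ?_⟩
    _ (hlt _) ⟨hstep 4 (by simp), hne 5 1 ?_ ?_ ?_, hne 5 3 ?_ ?_ ?_⟩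
    _ (hlt _) ⟨hstep 5 (by simp), hne 6 0 ?_ ?_ ?_, hne 6 2 ?_ ?_ ?_, hne 6 4 ?_ ?_ ?_⟩
    _ (hlt _) ⟨hstep 6 (by simp), hne 7 1 ?_ ?_ ?_, hne 7 3 ?_ ?_ ?_, hne 7 5 ?_ ?_ ?_, h70⟩
  all_goals simp

theorem bRprop_eight : BRprop 8 8 8 := by
  classical
  intro G hG
  refine (hasOctagon_or_not fun i j => decide (G.Adj (.inl i) (.inr j))).imp ?_ ?_
  all_goals
    rintro ⟨a, b, ha, hb, h⟩
    refine hasCycleLen_eight (a := Sum.inl ∘ a) (b := Sum.inr ∘ b)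
      (Sum.inl_injective.comp ha) (Sum.inr_injective.comp hb) (by simp) (fun i => ?_) (fun i => ?_)
  · simpa using (h i).1
  · simpa using (h i).2
  · simpa [Kbb] using (h i).1
  · simpa [Kbb] using (h i).2

theorem not_bRprop_of_lt {b : ℕ} (hb : b < 8) : ¬ BRprop 8 8 b := by
  intro h
  let c : Fin b ⊕ Fin b → ℕ := Sum.elim (fun i => i) (fun j => 7 + j)
  have hc : c.Injective := by
    rintro (i | i) (j | j) hij <;> simp [c] at hij ⊢ <;> omega
  have hlt : ∀ v, c v < 14 := by
    rintro (i | i) <;> simp [c] <;> omega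
  have hirr : ∀ (M : ℕ → ℕ → Bool) u v, bipartiteRel M u v = bipartiteRel M v u := by
    intro M u v
    simp only [bipartiteRel]
    exact Bool.or_comm _ _
  let G : SimpleGraph (Fin b ⊕ Fin b) :=
    { Adj u v := bipartiteRel red (c u) (c v)
      symm := ⟨fun u v h => by rwa [hirr]⟩
      loopless := ⟨fun v h => by simp [bipartiteRel] at h; omega⟩ }
  have hG : G ≤ Kbb b := by
    rintro (i | i) (j | j) hij
    · simp [G, bipartiteRel, c] at hij; omega
    · simp [Kbb]
    · simp [Kbb]
    · simp [G, bipartiteRel, c] at hij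
  rcases h G hG with h | h
  · exact not_hasCycleLen_of_octagonFree octagonFree_red hc hlt (fun u v huv => huv) h
  · refine not_hasCycleLen_of_octagonFree octagonFree_not_red hc hlt (fun u v huv => ?_) h
    obtain ⟨hK, hn⟩ := huv
    rcases u with i | i <;> rcases v with j | j <;>
      simp [Kbb, G, bipartiteRel, c] at hK hn ⊢ <;> have := i.2 <;> have := j.2 <;> grind

/-- Theorem 5: `BR(C_8, C_8) = 8`. -/
theorem stmt10 : IsLeast {b : ℕ | 0 < b ∧ BRprop 8 8 b} 8 := by
  refine ⟨⟨by norm_num, bRprop_eight⟩, fun b hb => ?_⟩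
  by_contra! hlt
  exact not_bRprop_of_lt hlt hb.2
end

section
/- There exists a subgraph G of the complete bipartite graph K_{7,7} such that neither G nor the bipartite complement of G in K_{7,7} contains a cycle of length 8. (Explicitly, with parts {x_1,…,x_7} and {y_1,…,y_7}, one may take G to consist of all edges between {x_1,x_2,x_3,x_4} and {y_1,y_2,y_3}, all edges between {x_4,x_5,x_6,x_7} and {y_5,y_6,y_7}, and the edge x_4y_4.) -/
open SimpleGraph Sum

/-- The relation joining `x` to `y` when both lie strictly on the same side of `3`, and joining
`x = 3` to every `y`. -/
def GluedAtThree (x y : Fin 7) : Prop :=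
  x = 3 ∨ (x < 3 ∧ y < 3) ∨ (3 < x ∧ 3 < y)

/-- The bipartite graph whose edges join `inl x` to `inr y` for related `x`, `y`. -/
def bipartiteOfRel {α β : Type*} (r : α → β → Prop) : SimpleGraph (α ⊕ β) where
  Adj
    | inl x, inr y => r x y
    | inr y, inl x => r x y
    | _, _ => False
  symm := ⟨by rintro (x | y) (x' | y') h <;> exact h⟩
  loopless := ⟨by rintro (x | y) h <;> exact h⟩

/-- A closed 8-cycle of distinct vertices starting in the left part alternates between four
vertices of each part. -/
theorem exists_alternating_of_isLeft {α β : Type*} {G : SimpleGraph (α ⊕ β)}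
    (hG : G ≤ completeBipartiteGraph α β) {v : Fin 8 → α ⊕ β} (hv : v.Injective)
    (hadj : ∀ i, G.Adj (v i) (v (i + 1))) (h0 : (v 0).isLeft) :
    ∃ (a : Fin 4 → α) (b : Fin 4 → β), a.Injective ∧ b.Injective ∧
      (∀ i, G.Adj (inl (a i)) (inr (b i))) ∧ ∀ i, G.Adj (inl (a (i + 1))) (inr (b i)) := by
  have hr (i : Fin 8) (h : (v i).isLeft) : (v (i + 1)).isRight := by
    have := hG (hadj i)
    revert this h
    cases v i <;> cases v (i + 1) <;> simp
  have hl (i : Fin 8) (h : (v i).isRight) : (v (i + 1)).isLeft := by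
    have := hG (hadj i)
    revert this h
    cases v i <;> cases v (i + 1) <;> simp
  have h1 := hr 0 h0
  have h2 := hl 1 h1
  have h3 := hr 2 h2
  have h4 := hl 3 h3
  have h5 := hr 4 h4
  have h6 := hl 5 h5
  have h7 := hr 6 h6
  have ha (i : Fin 4) : ∃ x, v (![0, 2, 4, 6] i) = inl x :=
    isLeft_iff.1 (by fin_cases i <;> assumption)
  have hb (i : Fin 4) : ∃ y, v (![1, 3, 5, 7] i) = inr y :=
    isRight_iff.1 (by fin_cases i <;> assumption)
  choose a ha using ha
  choose b hb using hb
  refine ⟨a, b, fun i j hij => ?_, fun i j hij => ?_, fun i => ?_, fun i => ?_⟩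
  · have hs : Function.Injective (![0, 2, 4, 6] : Fin 4 → Fin 8) := by decide
    exact hs (hv ((ha i).trans ((congrArg inl hij).trans (ha j).symm)))
  · have hs : Function.Injective (![1, 3, 5, 7] : Fin 4 → Fin 8) := by decide
    exact hs (hv ((hb i).trans ((congrArg inr hij).trans (hb j).symm)))
  · rw [← ha, ← hb]
    fin_cases i <;> exact hadj _
  · rw [← ha, ← hb]
    have hs : ![0, 2, 4, 6] (i + 1) = (![1, 3, 5, 7] : Fin 4 → Fin 8) i + 1 := by
      decide +revert
    exact hs ▸ (hadj _).symm

/-- An 8-cycle in a bipartite graph alternates between four vertices of each part. -/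
theorem HasCycleLen.exists_alternating {α β : Type*} {G : SimpleGraph (α ⊕ β)}
    (hG : G ≤ completeBipartiteGraph α β) (h : HasCycleLen G 8) :
    ∃ (a : Fin 4 → α) (b : Fin 4 → β), a.Injective ∧ b.Injective ∧
      (∀ i, G.Adj (inl (a i)) (inr (b i))) ∧ ∀ i, G.Adj (inl (a (i + 1))) (inr (b i)) := by
  obtain ⟨u, w, hw, hl⟩ := h
  have hend : w.getVert 8 = w.getVert 0 := by rw [← hl, w.getVert_length, w.getVert_zero]
  have hadj (i : Fin 8) : G.Adj (w.getVert i) (w.getVert (i + 1 : Fin 8)) := by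
    have := w.adj_getVert_succ (i := i) (by omega)
    fin_cases i
    all_goals first | exact this | exact hend ▸ this
  have hinj : Function.Injective fun i : Fin 8 => w.getVert i := fun i j hij =>
    Fin.ext (hw.getVert_injOn' (by simp only [Set.mem_ofPred_eq]; omega)
      (by simp only [Set.mem_ofPred_eq]; omega) hij)
  cases h0 : w.getVert 0 with
  | inl x => exact exists_alternating_of_isLeft hG hinj hadj (by simp [h0])
  | inr y =>
    refine exists_alternating_of_isLeft hG (hinj.comp (add_left_injective 1))
      (fun i => hadj (i + 1)) ?_
    have := hG (hadj 0)
    revert this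
    simp only [Fin.val_zero, h0, Function.comp]
    cases w.getVert ((0 + 1 : Fin 8) : ℕ) <;> simp

/-- No four plus four vertices form an alternating 8-cycle in the relation `GluedAtThree`. -/
theorem GluedAtThree.not_alternating {a b : Fin 4 → Fin 7} (ha : a.Injective)
    (hb : b.Injective) (h : ∀ i, GluedAtThree (a i) (b i))
    (h' : ∀ i, GluedAtThree (a (i + 1)) (b i)) : False := by
  have hcut : ∃ k, ∀ i, i ≠ k → a i ≠ 3 := by
    by_cases hk : ∃ k, a k = 3
    · obtain ⟨k, hk⟩ := hk
      exact ⟨k, fun i hi hi3 => hi (ha (hi3.trans hk.symm))⟩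
    · exact ⟨0, fun i _ hi3 => hk ⟨i, hi3⟩⟩
  obtain ⟨k, hk⟩ := hcut
  have hside (i : Fin 4) (hi : i + 1 ≠ k) : b i < 3 ↔ b (i + 1) < 3 := by
    have h1 := h (i + 1)
    have h2 := h' i
    have h3 := hk _ hi
    unfold GluedAtThree at h1 h2
    omega
  have hne (i : Fin 4) : b i ≠ 3 := by
    have h1 := h i
    have h2 := h' i
    have h3 : a i ≠ 3 ∨ a (i + 1) ≠ 3 := by
      by_contra! hc
      have := ha (hc.1.trans hc.2.symm)
      omega
    unfold GluedAtThree at h1 h2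
    omega
  have hall (i : Fin 4) : b i < 3 ↔ b 0 < 3 := by
    have h0 : 1 ≠ k → (b 0 < 3 ↔ b 1 < 3) := hside 0
    have h1 : 2 ≠ k → (b 1 < 3 ↔ b 2 < 3) := hside 1
    have h2 : 3 ≠ k → (b 2 < 3 ↔ b 3 < 3) := hside 2
    have h3 : 0 ≠ k → (b 3 < 3 ↔ b 0 < 3) := hside 3
    have hi : i = 0 ∨ i = 1 ∨ i = 2 ∨ i = 3 := by omega
    rcases hi with rfl | rfl | rfl | rfl <;> omega
  have hcard (s : Finset (Fin 7)) (hs : s.card = 3) (hbs : ∀ i, b i ∈ s) : False := by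
    have := Finset.card_le_card_of_injOn b (s := Finset.univ) (t := s) (fun i _ => hbs i)
      hb.injOn
    simp [hs] at this
  by_cases h0 : b 0 < 3
  · exact hcard (Finset.Iio 3) (by decide) fun i => Finset.mem_Iio.2 ((hall i).2 h0)
  · refine hcard (Finset.Ioi 3) (by decide) fun i => Finset.mem_Ioi.2 ?_
    have h1 := hall i
    have h2 := hne i
    omega

/-- Lower bound for Theorem 5: there is a subgraph `G` of `K_{7,7}` such that neither
`G` nor its bipartite complement in `K_{7,7}` contains a cycle of length 8. -/
theorem stmt11 :
    ∃ G : SimpleGraph (Fin 7 ⊕ Fin 7), G ≤ Kbb 7 ∧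
      ¬ HasCycleLen G 8 ∧ ¬ HasCycleLen (Kbb 7 \ G) 8 := by
  have hle : bipartiteOfRel GluedAtThree ≤ Kbb 7 := by
    rintro (x | y) (x' | y') h <;> simp_all [bipartiteOfRel]
  refine ⟨bipartiteOfRel GluedAtThree, hle, fun h => ?_, fun h => ?_⟩
  · obtain ⟨a, b, ha, hb, h, h'⟩ := h.exists_alternating hle
    exact GluedAtThree.not_alternating ha hb h h'
  · obtain ⟨a, b, ha, hb, h, h'⟩ := h.exists_alternating sdiff_le
    have hrev (x y : Fin 7) (hxy : (Kbb 7 \ bipartiteOfRel GluedAtThree).Adj (inl x) (inr y)) :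
        GluedAtThree y.rev x := by
      replace hxy : ¬ GluedAtThree x y := hxy.2
      revert x y
      unfold GluedAtThree
      decide
    refine GluedAtThree.not_alternating (a := fun i => (b (-i)).rev) (b := fun i => a (-i))
      (Fin.rev_injective.comp (hb.comp neg_injective)) (ha.comp neg_injective)
      (fun i => hrev _ _ (h _)) (fun i => hrev _ _ ?_)
    simpa using h' (-(i + 1))
end

section
/- Every subgraph G of the complete bipartite graph K_{8,8} satisfies: G contains a cycle of length 8, or the bipartite complement of G in K_{8,8} contains a cycle of length 8. (This is the upper bound BR(C_8, C_8) ≤ 8.) -/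
open SimpleGraph Sum

/-- A partial two-colouring of the cells of the `8 × 8` grid: cell `(i, j)` is red if bit `8 * i + j`
of `red` is set and blue if that bit of `blue` is set. -/
structure Pattern where
  red : ℕ
  blue : ℕ

namespace Pattern

/-- The cells which the pattern colours red (`true`) or blue (`false`). -/
def mask (p : Pattern) (c : Bool) : ℕ := bif c then p.red else p.blue

/-- Whether the pattern gives the cell `(i, j)` the colour `c`. -/
def colours (p : Pattern) (c : Bool) (i j : Fin 8) : Bool := (p.mask c).testBit (8 * i + j)

/-- Give the cell `(i, j)` the colour `c`, in addition to the colours already assigned. -/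
def insert (p : Pattern) (c : Bool) (i j : Fin 8) : Pattern :=
  bif c then ⟨p.red ||| 1 <<< (8 * i + j : ℕ), p.blue⟩
  else ⟨p.red, p.blue ||| 1 <<< (8 * i + j : ℕ)⟩

/-- The colouring `f` extends the pattern `p`. -/
def Extends (f : Fin 8 → Fin 8 → Bool) (p : Pattern) : Prop :=
  ∀ c i j, p.colours c i j → f i j = c

theorem Extends.insert {f : Fin 8 → Fin 8 → Bool} {p : Pattern} (h : Extends f p) (i j : Fin 8) :
    Extends f (p.insert (f i j) i j) := by
  intro c k l hc
  by_cases hkl : k = i ∧ l = j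
  · obtain ⟨rfl, rfl⟩ := hkl
    by_contra hne
    refine hne (h c k l ?_)
    revert hc hne
    cases c <;> cases f k l <;> simp [colours, mask, Pattern.insert]
  · refine h c k l ?_
    have hne : (8 * i + j : ℕ) ≠ 8 * k + l := by omega
    revert hc
    cases c <;> cases f i j <;>
      simp [colours, mask, Pattern.insert, Nat.one_shiftLeft, Nat.testBit_two_pow_of_ne hne]

end Pattern

/-- No colour class of `f`, read as a bipartite graph on rows and columns, contains a cycle of
length `8`. -/
def AvoidsOctagon (f : Fin 8 → Fin 8 → Bool) : Prop :=
  ∀ (c : Bool) (r s : Fin 4 → Fin 8), Function.Injective r → Function.Injective s →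
    ¬ ∀ k, f (r k) (s k) = c ∧ f (r (k + 1)) (s k) = c

theorem AvoidsOctagon.comp {f : Fin 8 → Fin 8 → Bool} (hf : AvoidsOctagon f) {ρ κ : Fin 8 → Fin 8}
    (hρ : Function.Injective ρ) (hκ : Function.Injective κ) :
    AvoidsOctagon fun i j => f (ρ i) (κ j) :=
  fun c r s hr hs => hf c (ρ ∘ r) (κ ∘ s) (hρ.comp hr) (hκ.comp hs)

theorem AvoidsOctagon.xor {f : Fin 8 → Fin 8 → Bool} (hf : AvoidsOctagon f) (b : Bool) :
    AvoidsOctagon fun i j => f i j ^^ b := by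
  intro c r s hr hs h
  refine hf (c ^^ b) r s hr hs fun k => ?_
  rw [← (h k).1]
  simpa using (h k).2.trans (h k).1.symm

theorem AvoidsOctagon.transpose {f : Fin 8 → Fin 8 → Bool} (hf : AvoidsOctagon f) :
    AvoidsOctagon fun i j => f j i := by
  intro c r s hr hs h
  refine hf c s (fun k => r (k + 1)) hs (hr.comp (add_left_injective 1)) fun k => ?_
  exact ⟨(h k).2, (h (k + 1)).1⟩

/-- No colouring without monochromatic `C₈` extends `p`. -/
def Pattern.Refuted (p : Pattern) : Prop := ∀ f, AvoidsOctagon f → ¬ p.Extends f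

/-- The `i`-th decimal digit of `n`, counted from the right, as a row or column of the grid. -/
def gridDigit (n i : ℕ) : Fin 8 := Fin.ofNat 8 (n / 10 ^ i % 10)

/-- A proof that a pattern is refuted, relative to a list of patterns already known to be. -/
inductive CaseTree where
  /-- The pattern contains a `C₈` of the given colour; its rows and columns are listed as digits. -/
  | cycle (c : Bool) (rows cols : ℕ)
  /-- Distinguish whether the cell `(i, j)` is red or blue. -/
  | split (i j : Fin 8) (red blue : CaseTree)
  /-- The pattern contains the image of the `k`-th known one under the row and column permutations
  with digits `rows` and `cols`, after which colours are exchanged if `swap` is set and the grid is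
  transposed if `flip` is set. -/
  | embed (k : ℕ) (swap flip : Bool) (rows cols : ℕ)

/-- Whether `d` is a valid derivation of the refutation of a pattern from those of `known`. -/
def CaseTree.check (known : List Pattern) : CaseTree → Pattern → Bool
  | cycle c rows cols, p =>
    decide (∀ i j : Fin 4, gridDigit rows i = gridDigit rows j → i = j) &&
    decide (∀ i j : Fin 4, gridDigit cols i = gridDigit cols j → i = j) &&
    decide (∀ k : Fin 4, p.colours c (gridDigit rows k) (gridDigit cols k) ∧
      p.colours c (gridDigit rows (k + 1 : Fin 4)) (gridDigit cols k))
  | split i j red blue, p =>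
    red.check known (p.insert true i j) && blue.check known (p.insert false i j)
  | embed k swap flip rows cols, p =>
    match known[k]? with
    | none => false
    | some q =>
      decide (∀ i j : Fin 8, gridDigit rows i = gridDigit rows j → i = j) &&
      decide (∀ i j : Fin 8, gridDigit cols i = gridDigit cols j → i = j) &&
      decide (∀ c i j, q.colours c i j → (bif flip
        then p.colours (c ^^ swap) (gridDigit cols j) (gridDigit rows i)
        else p.colours (c ^^ swap) (gridDigit rows i) (gridDigit cols j)) = true)

theorem CaseTree.refuted_of_check {known : List Pattern} (hknown : ∀ q ∈ known, q.Refuted)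
    (d : CaseTree) {p : Pattern} (h : d.check known p) : p.Refuted := by
  induction d generalizing p with
  | cycle c rows cols =>
    simp only [check, Bool.and_eq_true, decide_eq_true_eq] at h
    obtain ⟨⟨hr, hs⟩, hc⟩ := h
    exact fun f hf hp => hf c (fun k => gridDigit rows k) (fun k => gridDigit cols k)
      (fun i j => hr i j) (fun i j => hs i j) fun k => ⟨hp _ _ _ (hc k).1, hp _ _ _ (hc k).2⟩
  | split i j red blue hred hblue =>
    simp only [check, Bool.and_eq_true] at h
    intro f hf hp
    have hins := hp.insert i j
    cases hij : f i j <;> rw [hij] at hins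
    · exact hblue h.2 f hf hins
    · exact hred h.1 f hf hins
  | embed k swap flip rows cols =>
    simp only [check] at h
    split at h
    · simp at h
    · rename_i q hq
      simp only [Bool.and_eq_true, decide_eq_true_eq] at h
      obtain ⟨⟨hr, hs⟩, hc⟩ := h
      intro f hf hp
      have hqr := hknown q (List.mem_of_getElem? hq)
      cases flip
      · refine hqr _ ((hf.comp (fun i j => hr i j) (fun i j => hs i j)).xor swap) fun c i j hq => ?_
        simp [hp _ _ _ (hc c i j hq)]
      · refine hqr _ ((hf.transpose.comp (fun i j => hr i j) (fun i j => hs i j)).xor swap)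
          fun c i j hq => ?_
        simp [hp _ _ _ (hc c i j hq)]

/-- Check derivations one after the other, each of which may use the patterns of the earlier ones,
and look for the empty pattern among those refuted. -/
def checkDerivations : List Pattern → List (Pattern × CaseTree) → Bool
  | known, [] => known.any fun p => p.red == 0 && p.blue == 0
  | known, (p, d) :: rest => d.check known p && checkDerivations (p :: known) rest

theorem refuted_empty_of_checkDerivations {known : List Pattern}
    (hknown : ∀ q ∈ known, q.Refuted) {l : List (Pattern × CaseTree)}
    (h : checkDerivations known l) : Pattern.Refuted ⟨0, 0⟩ := by
  induction l generalizing known with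
  | nil =>
    simp only [checkDerivations, List.any_eq_true, Bool.and_eq_true, beq_iff_eq] at h
    obtain ⟨p, hp, hr, hb⟩ := h
    have hp0 := hknown p hp
    rwa [show p = ⟨0, 0⟩ from congrArg₂ Pattern.mk hr hb] at hp0
  | cons a rest ih =>
    obtain ⟨p, d⟩ := a
    simp only [checkDerivations, Bool.and_eq_true] at h
    exact ih (List.forall_mem_cons.2 ⟨d.refuted_of_check hknown h.1, hknown⟩) h.2

/-- Derivations that lead from nothing to the refutation of the empty pattern. -/
def octagonDerivations : List (Pattern × CaseTree) :=
  [(⟨4503621187408128, 146601550336⟩,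
    .split 4 7 (.split 6 7 (.cycle true 6431 4720) (.split 3 7 (.cycle true 2431 4270)
    (.split 2 7 (.cycle true 2431 4720) (.split 1 7 (.cycle true 4321 7024) (.split 6 3
    (.split 4 3 (.cycle true 6431 4320) (.split 2 3 (.cycle true 6241 4320) (.cycle false 2431
    7315))) (.split 3 3 (.split 1 3 (.cycle true 2431 4203) (.cycle false 6341 3751))
    (.cycle false 6342 7351))))))) (.split 3 6 (.split 4 6 (.cycle true 2431 4260) (.split 2 6
    (.cycle true 2341 4620) (.split 3 7 (.split 1 7 (.cycle true 3421 7024) (.cycle false 4231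
    7651)) (.cycle false 3421 5761)))) (.split 1 6 (.split 6 6 (.cycle true 6241 6420)
    (.split 4 6 (.cycle true 4321 6024) (.split 6 7 (.split 1 7 (.cycle true 6231 7420)
    (.cycle false 4321 7651)) (.cycle false 4632 5761)))) (.split 3 7 (.split 1 7
    (.cycle true 3421 7024) (.cycle false 4231 7516)) (.cycle false 3421 6751))))),
   (⟨21492928772, 172506090018⟩,
    .split 3 7 (.split 1 7 (.cycle true 3421 7024) (.split 0 7 (.cycle true 3120 7042)
    (.cycle false 1320 7315))) (.split 2 7 (.split 0 7 (.cycle true 2140 7402)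
    (.cycle false 3420 7531)) (.cycle false 4321 3571))),
   (⟨14073770328494336, 36028799806218756⟩,
    .split 2 7 (.split 6 2 (.cycle true 2641 7420) (.split 6 0 (.cycle true 2461 7204)
    (.split 4 5 (.cycle true 2461 7254) (.split 4 1 (.cycle true 2461 7214) (.split 3 4
    (.cycle true 2431 7204) (.split 4 7 (.split 2 0 (.split 1 2 (.split 0 5 (.split 0 1
    (.split 0 0 (.cycle true 6240 5470) (.split 6 6 (.split 4 6 (.cycle true 6421 4672)
    (.split 3 6 (.cycle true 4362 7064) (.split 2 6 (.cycle true 6241 4672) (.split 1 6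
    (.cycle true 6241 6472) (.split 4 4 (.split 0 6 (.split 5 0 (.split 5 2 (.cycle true 4251
    4720) (.split 5 1 (.cycle true 6450 6401) (.cycle false 2531 6125))) (.split 5 6 (.split 5 4
    (.split 5 1 (.split 5 7 (.cycle true 6542 4672) (.split 7 0 (.split 7 2 (.cycle true 4271
    4720) (.split 7 1 (.cycle true 6574 4610) (.cycle false 2731 6125))) (.split 7 4 (.split 7 1
    (.cycle true 5760 6415) (.cycle false 6573 2701)) (.cycle false 7563 4072))))
    (.cycle false 6350 2710)) (.cycle false 6350 2740)) (.cycle false 6350 2760)))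
    (.cycle false 4360 6572)) (.cycle false 3421 5461)))))) (.split 4 6 (.split 2 6 (.split 1 6
    (.embed 0 true true 53176204 57104326) (.cycle false 6341 6751)) (.cycle false 6342 6751))
    (.cycle false 4632 5671)))) (.cycle false 6340 2751)) (.cycle false 4360 5172))
    (.cycle false 6341 2751)) (.cycle false 4362 1570)) (.cycle false 4632 5721)))))))
    (.split 6 2 (.split 0 7 (.split 0 1 (.cycle true 1260 7421) (.cycle false 3210 2751))
    (.cycle false 2130 7152)) (.cycle false 3621 5271))),
   (⟨14073770328461568, 572662272⟩,
    .split 3 2 (.split 4 5 (.cycle true 6431 4520) (.split 4 1 (.cycle true 6431 4120) (.embed 2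
    false false 76543210 76543210))) (.split 0 2 (.split 0 5 (.cycle true 6140 5402) (.split 0 1
    (.cycle true 4160 2041) (.split 6 2 (.split 4 5 (.cycle true 2641 4250) (.split 4 1
    (.cycle true 2641 4210) (.split 2 3 (.split 4 3 (.cycle true 6241 4230) (.split 3 3
    (.cycle true 6432 4203) (.split 1 3 (.cycle true 2641 3420) (.split 3 6 (.split 1 6
    (.cycle true 3461 6024) (.split 0 6 (.cycle true 3160 6042) (.cycle false 1320 6315)))
    (.split 2 6 (.split 0 6 (.cycle true 2140 6402) (.cycle false 3410 6531)) (.cycle false 4321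
    3561)))))) (.split 3 3 (.split 4 3 (.cycle true 6431 4230) (.split 1 3 (.cycle true 6431
    4203) (.split 3 6 (.split 1 6 (.cycle true 3461 6024) (.split 0 6 (.cycle true 3160 6042)
    (.cycle false 1230 6315))) (.split 2 6 (.split 0 6 (.cycle true 2140 6402)
    (.cycle false 3420 6531)) (.cycle false 4321 3561))))) (.split 3 6 (.split 1 6
    (.cycle true 3461 6024) (.split 0 6 (.cycle true 3160 6042) (.cycle false 1320 6135)))
    (.split 4 6 (.split 0 6 (.cycle true 4120 6042) (.cycle false 3240 6351)) (.cycle false 4321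
    5631))))))) (.split 6 3 (.split 3 3 (.cycle true 6342 4302) (.split 2 3 (.cycle true 6241
    4320) (.split 1 3 (.cycle true 6241 3420) (.split 0 3 (.cycle true 6140 3402) (.split 1 2
    (.split 4 5 (.cycle true 2641 2450) (.split 4 3 (.cycle true 2641 2430) (.embed 1 false
    false 76543210 76543210))) (.cycle false 2310 3521)))))) (.split 2 3 (.split 0 3
    (.cycle true 2140 3402) (.cycle false 6320 3251)) (.cycle false 3621 5231)))))) (.split 1 7
    (.split 6 7 (.cycle true 6241 7420) (.split 3 7 (.cycle true 3421 7024) (.embed 0 false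
    false 76543210 76543210))) (.split 0 7 (.split 0 1 (.split 4 7 (.cycle true 4260 7241)
    (.split 3 7 (.cycle true 3160 7041) (.split 0 0 (.cycle true 6240 1420) (.split 2 0
    (.split 0 5 (.split 4 5 (.cycle true 6421 4520) (.split 2 7 (.cycle true 2160 7045)
    (.split 1 2 (.split 4 6 (.split 6 6 (.cycle true 4621 2640) (.split 3 6 (.cycle true 2431
    4260) (.split 0 6 (.cycle true 4260 6245) (.split 6 7 (.split 2 6 (.split 6 2
    (.cycle true 6421 4260) (.embed 0 false false 76543210 23541670)) (.cycle false 4321 5761))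
    (.cycle false 4632 5761))))) (.split 3 6 (.split 1 6 (.cycle true 3421 6024)
    (.cycle false 4321 6751)) (.cycle false 3421 5671))) (.cycle false 3421 2751))))
    (.cycle false 2130 5172)) (.cycle false 3120 2750))))) (.split 3 7 (.split 2 7 (.split 3 4
    (.cycle true 3241 4720) (.split 1 2 (.cycle true 2341 4702) (.split 0 4 (.cycle true 3420
    7024) (.cycle false 3210 4152)))) (.cycle false 3210 2571)) (.cycle false 3120 2751)))
    (.cycle false 1230 7152))))),
   (⟨3472839110932480256, 13961440534888190497⟩,
    .split 5 7 (.split 5 5 (.cycle true 7542 4572) (.split 5 4 (.cycle true 7542 5472)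
    (.split 5 2 (.cycle true 4531 6270) (.split 5 6 (.split 5 0 (.split 3 2 (.cycle true 3451
    7206) (.cycle false 4531 4521)) (.cycle false 4350 5140)) (.cycle false 5760 5670)))))
    (.split 5 4 (.split 5 1 (.split 7 2 (.cycle true 7652 2541) (.split 5 2 (.cycle true 5762
    2451) (.cycle false 5762 7206))) (.cycle false 4570 5170)) (.cycle false 4570 5470))),
   (⟨3616954296858575104, 13961440466693009920⟩,
    .split 0 5 (.split 0 7 (.cycle true 4270 7245) (.split 0 6 (.cycle true 4270 6245)
    (.split 0 2 (.cycle true 7620 5142) (.split 0 0 (.cycle true 7240 5420) (.split 0 1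
    (.split 7 2 (.cycle true 7260 5241) (.split 6 2 (.cycle true 7260 5421) (.split 5 2
    (.split 5 5 (.cycle true 6752 4152) (.split 5 1 (.cycle true 7652 4512) (.split 5 0
    (.split 1 7 (.split 5 4 (.cycle true 4251 7240) (.split 2 6 (.cycle true 4251 7620)
    (.split 2 7 (.split 3 6 (.cycle true 4352 7602) (.split 1 6 (.cycle true 4251 6720)
    (.cycle false 3541 6415))) (.cycle false 7260 2760)))) (.split 5 7 (.split 3 6 (.split 1 6
    (.split 1 2 (.cycle true 3541 6072) (.cycle false 1760 2760)) (.cycle false 7160 2760))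
    (.cycle false 7351 7651)) (.cycle false 5431 7514))) (.split 5 6 (.split 3 7 (.split 1 7
    (.split 1 6 (.cycle true 3451 7026) (.cycle false 7651 6705)) (.cycle false 7651 7605))
    (.cycle false 7653 7605)) (.cycle false 6750 2760))))) (.split 5 7 (.split 5 6 (.split 5 0
    (.split 5 5 (.cycle true 7542 4572) (.split 3 7 (.split 3 2 (.split 1 7 (.split 1 6
    (.cycle true 3451 7206) (.cycle false 7651 6725)) (.cycle false 7651 7625))
    (.cycle false 3541 4251)) (.cycle false 7653 7625))) (.cycle false 7650 6720))
    (.cycle false 5760 2670)) (.cycle false 5760 2760))))) (.split 3 7 (.split 3 6 (.split 3 2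
    (.split 1 7 (.split 1 6 (.split 1 2 (.split 2 7 (.cycle true 2431 2760) (.split 2 6
    (.cycle true 2431 2670) (.split 2 0 (.cycle true 4321 6720) (.split 6 2 (.split 2 5 (.embed
    1 false false 51470623 1623475) (.cycle false 7240 6751)) (.cycle false 6720 2760)))))
    (.cycle false 1340 2451)) (.cycle false 1760 1670)) (.cycle false 1760 1760))
    (.cycle false 3140 2451)) (.cycle false 3760 1670)) (.cycle false 3760 1760)))))))
    (.split 0 0 (.split 0 1 (.cycle true 7240 1420) (.split 3 6 (.split 0 4 (.cycle true 2430
    4260) (.split 4 3 (.split 7 3 (.cycle true 6742 4532) (.split 6 3 (.cycle true 7642 4532)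
    (.split 1 7 (.split 2 7 (.cycle true 2431 7260) (.split 2 6 (.cycle true 4231 7260)
    (.split 0 3 (.split 3 3 (.cycle true 3410 3670) (.split 2 3 (.cycle true 2410 3270)
    (.split 0 6 (.cycle true 3140 6073) (.cycle false 2310 6314)))) (.split 1 3 (.split 0 7
    (.split 0 6 (.cycle true 1430 7306) (.cycle false 2760 6703)) (.cycle false 2760 7603))
    (.cycle false 1340 3451))))) (.split 3 7 (.split 3 3 (.split 0 6 (.split 0 3 (.split 2 7
    (.cycle true 4230 6273) (.split 2 3 (.cycle true 3420 6723) (.split 1 6 (.cycle true 3410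
    3760) (.cycle false 2761 7306)))) (.cycle false 1760 5763)) (.cycle false 7140 6751))
    (.cycle false 7631 7635)) (.cycle false 1340 4751))))) (.split 3 3 (.split 1 3 (.split 0 3
    (.split 1 2 (.cycle true 3410 3620) (.split 0 2 (.cycle true 4310 2630) (.cycle false 4310
    5142))) (.cycle false 4310 3541)) (.cycle false 3410 4531)) (.cycle false 3410 4351))))
    (.split 1 7 (.split 0 7 (.split 0 6 (.split 3 2 (.cycle true 1340 7026) (.split 2 7
    (.cycle true 4210 6270) (.split 2 6 (.cycle true 2410 6270) (.split 2 0 (.cycle true 1240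
    7026) (.split 0 4 (.cycle true 2410 4270) (.split 6 2 (.split 2 5 (.split 2 1 (.split 1 6
    (.split 1 2 (.split 0 2 (.split 4 4 (.cycle true 4761 7452) (.split 3 7 (.cycle true 1430
    2670) (.embed 0 false false 76504213 6143257))) (.cycle false 1430 4152)) (.cycle false 1340
    4251)) (.cycle false 1340 4651)) (.cycle false 3762 1670)) (.cycle false 3762 5670))
    (.cycle false 7362 7620))))))) (.cycle false 3140 6451)) (.cycle false 7340 7651))
    (.cycle false 7341 7651)))) (.split 3 7 (.split 1 7 (.split 1 6 (.split 2 7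
    (.cycle true 4231 6270) (.split 2 6 (.cycle true 2431 6270) (.split 2 5 (.split 2 1
    (.split 4 4 (.cycle true 4762 2451) (.embed 0 false false 76543210 76543210))
    (.cycle false 4270 5170)) (.cycle false 2760 5670)))) (.cycle false 1760 5670))
    (.cycle false 1760 5760)) (.cycle false 3760 5760)))),
   (⟨3616954024128184576, 13871368749023506944⟩,
    .split 0 7 (.split 0 5 (.cycle true 4270 7245) (.split 0 4 (.cycle true 3420 7024)
    (.split 0 1 (.cycle true 4270 7241) (.split 3 6 (.split 0 6 (.split 0 0 (.split 3 2
    (.cycle true 3410 6270) (.split 1 2 (.cycle true 3410 6720) (.cycle false 4310 5124)))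
    (.cycle false 4760 5670)) (.cycle false 4310 6541)) (.cycle false 3410 4651))))) (.split 0 5
    (.split 0 4 (.split 0 1 (.split 7 2 (.cycle true 2760 4251) (.split 6 2 (.cycle true 7260
    5421) (.split 0 2 (.cycle true 2760 2451) (.split 0 0 (.cycle true 7240 5420) (.split 3 2
    (.split 1 2 (.split 4 4 (.cycle true 2431 2470) (.embed 0 true false 60543712 14023675))
    (.cycle false 4761 5672)) (.cycle false 4763 5672)))))) (.cycle false 7430 7651))
    (.cycle false 7430 7654)) (.cycle false 7430 7615))),
   (⟨3616954021980668160, 9331740049756140032⟩,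
    .split 4 6 (.split 7 6 (.cycle true 6742 4562) (.split 6 6 (.cycle true 7642 4562) (.embed 1
    false false 76543210 76543210))) (.split 7 6 (.split 3 6 (.cycle true 7342 4602) (.split 1 6
    (.cycle true 7241 6420) (.split 0 5 (.split 0 7 (.cycle true 4270 7245) (.split 0 2
    (.cycle true 7620 5142) (.split 0 0 (.cycle true 7240 5420) (.split 0 1 (.split 7 2
    (.cycle true 7260 5241) (.split 6 2 (.cycle true 7260 5421) (.split 2 6 (.cycle true 7260
    5641) (.split 2 1 (.split 6 6 (.cycle true 7620 5641) (.split 4 4 (.cycle true 4762 2451)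
    (.split 0 6 (.cycle true 7620 6541) (.split 3 7 (.split 3 2 (.split 1 7 (.split 1 2
    (.split 0 4 (.embed 0 false false 31507264 16023475) (.cycle false 4670 4672))
    (.cycle false 4671 5672)) (.cycle false 7641 7265)) (.cycle false 4673 5672))
    (.cycle false 7643 7265))))) (.cycle false 3421 4561))))) (.split 3 7 (.split 1 2
    (.split 0 6 (.split 0 4 (.split 4 4 (.cycle true 2431 2470) (.split 2 6 (.cycle true 6720
    5164) (.split 2 5 (.cycle true 7620 6154) (.cycle false 2341 6514)))) (.cycle false 3410
    4651)) (.cycle false 4310 6541)) (.cycle false 1430 2561)) (.cycle false 4370 1670))))))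
    (.split 0 6 (.split 0 4 (.split 0 1 (.split 2 6 (.cycle true 2760 4651) (.split 2 5
    (.cycle true 7260 6541) (.cycle false 2431 6514))) (.cycle false 4310 5641))
    (.cycle false 4310 5614)) (.cycle false 4130 6145))))) (.split 3 7 (.split 1 7 (.embed 0
    false false 76543210 76543210) (.cycle false 7431 7654)) (.cycle false 4731 5674)))),
   (⟨3616953472224854272, 72339215882400256⟩,
    .split 4 7 (.split 7 7 (.cycle true 6742 4572) (.split 6 7 (.cycle true 7642 4572) (.embed 0
    false false 76543210 76543210))) (.split 5 5 (.split 5 2 (.cycle true 6752 4152) (.split 5 0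
    (.cycle true 7542 4502) (.split 5 4 (.split 7 2 (.cycle true 5672 4512) (.split 6 2
    (.cycle true 5762 4512) (.split 5 7 (.split 2 7 (.cycle true 5762 7514) (.split 2 1
    (.split 7 7 (.cycle true 5762 4751) (.split 6 7 (.cycle true 7562 4571) (.split 4 4
    (.cycle true 4762 2451) (.split 5 1 (.split 3 2 (.split 1 2 (.embed 0 true false 31267450
    3146752) (.cycle false 3471 4572)) (.cycle false 4731 5724)) (.cycle false 7654 7201)))))
    (.cycle false 3421 4571))) (.split 5 1 (.split 3 2 (.split 1 2 (.embed 0 true false 31257460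
    3156742) (.cycle false 4571 5702)) (.cycle false 4573 5702)) (.cycle false 3451 4571)))))
    (.split 7 7 (.split 5 7 (.split 1 2 (.split 2 7 (.cycle true 5762 7514) (.split 2 5
    (.cycle true 5762 5714) (.split 1 7 (.cycle true 7621 7542) (.cycle false 2431 7514))))
    (.cycle false 5341 2451)) (.cycle false 5431 4751)) (.cycle false 4753 5704))))) (.split 5 7
    (.split 5 1 (.split 5 0 (.cycle true 7542 4102) (.split 2 7 (.cycle true 5672 7154)
    (.split 6 7 (.split 2 5 (.cycle true 6572 5714) (.cycle false 3241 4571)) (.cycle false 5643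
    5071)))) (.split 3 7 (.split 7 7 (.cycle true 7342 4702) (.split 5 4 (.cycle true 5342 4702)
    (.split 6 6 (.split 3 6 (.cycle true 6342 4602) (.split 1 6 (.cycle true 6241 6420)
    (.cycle false 3541 6415))) (.split 5 6 (.split 3 6 (.split 1 6 (.split 5 2 (.cycle true 3541
    6720) (.split 3 2 (.cycle true 5341 6720) (.cycle false 4531 5124))) (.cycle false 6741
    6075)) (.cycle false 6743 6075)) (.cycle false 7654 7065))))) (.cycle false 3451 4751)))
    (.cycle false 3541 4571)))),
   (⟨1311130254220460288, 2378183316017787392⟩,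
    .split 6 7 (.split 4 7 (.cycle true 7642 4172) (.split 3 7 (.cycle true 6342 4702)
    (.split 1 7 (.cycle true 6241 7420) (.split 5 7 (.split 4 1 (.cycle true 6542 4712) (.embed
    0 false false 65743210 35146270)) (.cycle false 7531 5074))))) (.split 3 7 (.split 1 7
    (.split 7 7 (.cycle true 7342 4702) (.split 5 7 (.cycle true 5342 4702) (.split 4 1
    (.split 5 5 (.cycle true 6542 4512) (.split 3 2 (.cycle true 7432 4102) (.split 1 2
    (.cycle true 2741 2410) (.split 7 2 (.split 6 2 (.split 5 2 (.embed 0 true true 70642513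
    2574163) (.cycle false 7653 5702)) (.cycle false 3761 4572)) (.cycle false 5673 5072)))))
    (.split 4 7 (.embed 0 false true 70645213 5147236) (.cycle false 3741 4571)))))
    (.cycle false 6731 7054)) (.cycle false 7631 5074))),
   (⟨1311110463011160320, 72339207292465664⟩,
    .split 7 5 (.split 4 1 (.cycle true 7642 4512) (.embed 1 false false 76543210 76543210))
    (.split 5 0 (.split 5 5 (.cycle true 6542 4502) (.split 5 1 (.cycle true 7542 4102)
    (.split 6 6 (.split 4 6 (.cycle true 7642 4162) (.split 1 6 (.cycle true 6241 6420)
    (.cycle false 4531 6514))) (.split 5 6 (.split 3 6 (.split 1 6 (.split 7 6 (.cycle true 7542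
    4602) (.split 5 4 (.cycle true 5342 4602) (.split 4 1 (.split 3 2 (.cycle true 7432 4102)
    (.split 2 6 (.cycle true 5472 6014) (.split 2 5 (.cycle true 6742 5412) (.split 1 2
    (.cycle true 2741 2410) (.split 7 2 (.split 6 2 (.embed 0 false false 26753410 13527046)
    (.cycle false 5763 4562)) (.cycle false 7352 6245)))))) (.split 4 6 (.embed 1 false true
    60745213 1347256) (.cycle false 5743 4561))))) (.cycle false 6751 6051)) (.cycle false 6753
    6051)) (.cycle false 7653 5061))))) (.split 5 4 (.split 5 1 (.embed 0 false false 76543210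
    76543210) (.cycle false 3751 4501)) (.cycle false 5731 4051)))),
   (⟨158188958404313344, 72057732315755008⟩,
    .split 7 4 (.split 6 0 (.cycle true 7642 4102) (.embed 0 false false 76543210 76543210))
    (.split 5 0 (.split 5 5 (.cycle true 6542 4502) (.split 5 1 (.cycle true 6542 4102)
    (.split 7 3 (.split 4 3 (.cycle true 6742 4132) (.split 5 3 (.split 1 3 (.split 5 2
    (.cycle true 6752 4132) (.split 4 4 (.cycle true 6754 4130) (.split 1 2 (.cycle true 7621
    3142) (.cycle false 4351 5412)))) (.cycle false 3541 4153)) (.cycle false 3451 4531)))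
    (.split 4 3 (.split 3 3 (.split 1 3 (.embed 7 true false 67254310 26047135)
    (.cycle false 7351 3451)) (.cycle false 7351 4351)) (.cycle false 7453 4351))))) (.split 5 5
    (.split 5 1 (.split 7 2 (.cycle true 6572 4512) (.split 4 1 (.cycle true 6542 4512)
    (.split 3 2 (.split 1 2 (.split 5 6 (.split 4 6 (.cycle true 6542 4562) (.split 3 6
    (.cycle true 6532 4562) (.split 1 6 (.cycle true 5621 6542) (.split 7 6 (.split 7 5
    (.split 2 6 (.cycle true 7562 6514) (.split 2 5 (.cycle true 7562 5614) (.cycle false 2431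
    6514))) (.cycle false 7431 4561)) (.cycle false 7431 4651))))) (.split 4 6 (.split 3 6
    (.split 7 6 (.cycle true 6742 4162) (.split 6 6 (.cycle true 6432 4602) (.split 6 0
    (.cycle true 6342 4062) (.embed 0 false true 51726403 1763254)))) (.cycle false 3571 5604))
    (.cycle false 4573 5604))) (.cycle false 7341 2451)) (.cycle false 7341 4251))))
    (.cycle false 3751 5401)) (.cycle false 7531 4051)))),
   (⟨14073770328457472, 570434048⟩,
    .split 1 4 (.split 2 5 (.cycle true 6241 4520) (.split 2 1 (.cycle true 6241 4120) (.embed 8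
    false false 76543210 76543210))) (.split 4 5 (.split 3 2 (.cycle true 6432 4502) (.split 1 2
    (.cycle true 2641 2450) (.embed 8 false true 70641253 5147236))) (.split 3 4 (.split 2 5
    (.cycle true 6342 5402) (.split 2 1 (.cycle true 4362 2041) (.embed 8 false false 76541230
    36147250))) (.split 7 1 (.split 7 0 (.cycle true 6742 4102) (.embed 0 false false 76543210
    76543210)) (.split 4 1 (.split 3 2 (.cycle true 6432 4102) (.split 1 2 (.cycle true 2641
    2410) (.embed 8 false true 70645213 5147236))) (.split 1 3 (.split 6 3 (.cycle true 6241
    3420) (.embed 0 false true 30745216 5347216)) (.split 7 3 (.split 4 3 (.split 7 5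
    (.cycle true 6742 4532) (.split 3 3 (.split 6 3 (.cycle true 6342 4302) (.split 6 0
    (.cycle true 6342 4032) (.split 7 0 (.embed 0 false true 30745216 1345276)
    (.cycle false 6741 3051)))) (.split 7 4 (.split 4 4 (.split 3 2 (.cycle true 7432 4302)
    (.split 2 1 (.cycle true 4762 2341) (.split 1 2 (.cycle true 2741 2430) (.split 2 3
    (.split 6 0 (.cycle true 7642 3402) (.split 5 2 (.split 5 5 (.cycle true 7654 3452)
    (.split 5 0 (.cycle true 7452 3402) (.split 6 3 (.split 6 2 (.split 5 4 (.split 2 0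
    (.cycle true 5642 4230) (.cycle false 3521 4501)) (.cycle false 3571 3451))
    (.cycle false 6573 2051)) (.cycle false 6573 3051)))) (.split 5 3 (.split 5 1
    (.cycle true 6542 4132) (.cycle false 3751 4512)) (.cycle false 5371 2351))))
    (.cycle false 3721 4513))))) (.cycle false 3471 3451)) (.cycle false 3741 3451))))
    (.split 7 5 (.split 7 4 (.split 7 0 (.cycle true 6742 4502) (.split 6 0 (.cycle true 7642
    4502) (.split 3 3 (.cycle true 7342 4302) (.split 6 3 (.embed 0 false false 76543210
    16347250) (.cycle false 4673 5301))))) (.cycle false 4371 3541)) (.cycle false 3741 4153)))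
    (.cycle false 3471 4513)))))))),
   (⟨6931039844056694784, 360288392744927488⟩,
    .split 1 6 (.split 1 2 (.cycle true 7631 6542) (.split 2 0 (.split 7 1 (.embed 0 false false
    57134620 3157462) (.split 1 5 (.split 1 7 (.split 4 7 (.cycle true 4361 7245) (.split 2 7
    (.cycle true 2671 7456) (.embed 0 false false 71534620 1653472))) (.split 4 7 (.split 3 7
    (.split 2 7 (.split 7 7 (.cycle true 7361 6745) (.split 6 7 (.cycle true 4632 2740)
    (.split 6 6 (.embed 0 false false 52467310 13025476) (.cycle false 4673 5671))))
    (.cycle false 2471 7612)) (.cycle false 3471 7612)) (.cycle false 4371 7612)))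
    (.cycle false 4371 5612))) (.split 1 5 (.split 1 1 (.embed 0 false false 71534620 3157462)
    (.cycle false 7241 2061)) (.cycle false 4271 5602)))) (.split 7 1 (.embed 0 false false
    57134620 3157462) (.cycle false 4371 6510))),
   (⟨2319916779877695488, 360288116791181568⟩,
    .split 7 6 (.split 4 6 (.cycle true 6743 4562) (.split 3 6 (.cycle true 6732 4562)
    (.split 2 6 (.cycle true 7632 6542) (.embed 0 false false 76543210 76543210)))) (.split 1 5
    (.split 1 2 (.cycle true 6341 5402) (.split 4 6 (.split 1 6 (.cycle true 4361 6245) (.embed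
    1 false false 54367210 13027465)) (.split 2 0 (.split 1 1 (.split 1 7 (.split 4 7
    (.cycle true 4361 7245) (.split 3 7 (.cycle true 3261 7245) (.split 2 7 (.cycle true 2361
    7245) (.embed 0 false false 16542370 31546072)))) (.split 3 7 (.split 2 7 (.split 7 7
    (.cycle true 6732 4572) (.split 6 7 (.cycle true 6342 4720) (.split 6 0 (.cycle true 3642
    7402) (.embed 0 false true 14670253 1625374)))) (.cycle false 2471 7562)) (.cycle false 3471
    7562))) (.cycle false 7431 2651)) (.cycle false 7421 2650)))) (.split 4 6 (.split 3 6
    (.split 2 6 (.split 6 6 (.cycle true 6432 4602) (.split 6 2 (.cycle true 4362 6042)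
    (.split 6 0 (.cycle true 6342 4062) (.embed 1 true false 76543120 34207561))))
    (.cycle false 4271 5160)) (.cycle false 4371 5160)) (.cycle false 3471 5160)))),
   (⟨2319916779810586624, 360287970762293504⟩,
    .split 3 2 (.split 4 5 (.cycle true 6432 4502) (.split 4 1 (.cycle true 6432 4102) (.embed 0
    false false 76543210 76543210))) (.split 1 5 (.split 1 1 (.split 4 5 (.cycle true 4261 5241)
    (.split 4 1 (.cycle true 6241 5421) (.split 1 2 (.cycle true 6341 5402) (.split 2 0 (.embed
    0 false false 16542370 36147052) (.cycle false 4372 1520))))) (.cycle false 2371 1520))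
    (.cycle false 2371 5120))),
   (⟨14073907750633474, 72057594943897905⟩,
    .split 1 1 (.split 1 5 (.cycle true 4261 5241) (.split 1 4 (.cycle true 2461 4251)
    (.split 7 2 (.split 7 1 (.split 2 1 (.cycle true 6472 4521) (.split 2 0 (.cycle true 7642
    2150) (.cycle false 1230 5014))) (.cycle false 1370 4510)) (.cycle false 1370 4520))))
    (.split 7 5 (.split 7 4 (.split 7 1 (.cycle true 6742 4152) (.split 6 0 (.cycle true 7642
    4502) (.split 4 1 (.cycle true 7642 4512) (.split 2 1 (.cycle true 4762 2541) (.split 0 2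
    (.cycle true 2760 2451) (.split 6 2 (.split 4 4 (.split 2 5 (.split 1 5 (.split 1 2
    (.split 2 0 (.cycle true 6742 2540) (.embed 3 true false 60572314 36247150))
    (.cycle false 3170 5210)) (.cycle false 3170 4510)) (.cycle false 3270 4510))
    (.cycle false 3470 5410)) (.cycle false 3760 5102))))))) (.cycle false 3170 5104))
    (.cycle false 7130 5014))),
   (⟨14073907767410688, 72057594943897856⟩,
    .split 0 1 (.split 0 5 (.cycle true 4260 5241) (.split 0 4 (.cycle true 2460 4251)
    (.split 0 0 (.cycle true 6240 1420) (.embed 0 false false 76543210 76543210)))) (.split 1 1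
    (.split 1 5 (.cycle true 4261 5241) (.split 1 4 (.cycle true 2461 4251) (.split 7 1
    (.split 7 5 (.cycle true 6742 4152) (.split 7 4 (.cycle true 7642 4152) (.split 0 5
    (.split 0 0 (.cycle true 6240 5420) (.cycle false 3710 1540)) (.cycle false 7130 5041))))
    (.split 0 5 (.split 0 4 (.split 0 2 (.split 6 0 (.cycle true 6420 5024) (.split 2 0
    (.cycle true 6420 4502) (.split 1 2 (.cycle true 6120 5124) (.split 6 2 (.embed 0 false
    false 76543021 36247510) (.cycle false 3761 5102))))) (.cycle false 3170 2501))
    (.cycle false 3170 4501)) (.cycle false 3170 5401))))) (.split 0 2 (.split 0 0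
    (.cycle true 2640 2450) (.split 0 5 (.split 6 0 (.cycle true 4620 5042) (.split 4 1
    (.cycle true 4620 5142) (.split 2 0 (.cycle true 6240 5402) (.split 4 4 (.split 2 1
    (.cycle true 6240 5142) (.split 7 4 (.split 7 1 (.cycle true 7642 4152) (.split 0 4
    (.split 3 3 (.split 7 3 (.cycle true 7643 3450) (.split 6 3 (.cycle true 6340 5304)
    (.split 0 3 (.cycle true 6430 4503) (.split 7 5 (.split 1 5 (.split 1 4 (.split 1 3
    (.cycle true 7431 4503) (.embed 4 true false 73561204 26417053)) (.cycle false 3761 4130))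
    (.cycle false 3761 5130)) (.cycle false 3762 1530))))) (.split 2 3 (.split 7 3
    (.cycle true 7642 3452) (.split 6 3 (.cycle true 4620 4532) (.split 0 3 (.cycle true 2640
    3452) (.split 7 5 (.split 6 2 (.split 1 5 (.split 1 4 (.split 1 2 (.split 1 3
    (.cycle true 2761 3452) (.embed 4 true false 73561204 26417053)) (.cycle false 3761 2130))
    (.cycle false 3761 4130)) (.cycle false 3761 5130)) (.cycle false 7362 1320))
    (.cycle false 3762 1530))))) (.split 1 5 (.split 1 4 (.embed 4 true false 63571204 26437051)
    (.cycle false 3271 4310)) (.cycle false 3271 5310)))) (.split 2 5 (.split 1 5 (.split 1 2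
    (.embed 4 true false 63572014 36247051) (.cycle false 3170 4210)) (.cycle false 3170 4510))
    (.cycle false 3270 4510)))) (.split 1 5 (.split 1 2 (.embed 4 true false 63521704 36247051)
    (.cycle false 3721 2401)) (.cycle false 3721 5401)))) (.split 7 5 (.split 1 5 (.split 1 2
    (.split 7 1 (.cycle true 6742 4152) (.embed 4 true false 63571402 36247150))
    (.cycle false 4310 1420)) (.cycle false 4310 1450)) (.cycle false 4371 1450))))))
    (.split 7 4 (.split 7 2 (.split 7 1 (.cycle true 7642 4152) (.split 2 1 (.cycle true 7462
    4251) (.split 1 4 (.split 1 2 (.embed 4 true false 63572014 36257041) (.cycle false 3170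
    5210)) (.cycle false 3170 5410)))) (.cycle false 3710 5201)) (.cycle false 3710 5401))))
    (.split 7 5 (.split 7 4 (.split 7 1 (.cycle true 6742 4152) (.split 6 0 (.cycle true 7642
    4502) (.split 1 5 (.split 1 4 (.embed 4 true false 53476012 36427150) (.cycle false 3170
    2401)) (.cycle false 3170 2501)))) (.cycle false 3710 2401)) (.cycle false 3710 2501))))),
   (⟨1152939118285819920, 2377901849630998785⟩,
    .split 3 6 (.split 7 6 (.cycle true 7342 4602) (.split 5 6 (.cycle true 5342 4602)
    (.split 1 6 (.cycle true 3421 6024) (.split 0 6 (.cycle true 3420 6024) (.split 5 1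
    (.split 4 6 (.split 1 1 (.split 0 1 (.embed 5 false false 74651203 35027461)
    (.cycle false 4750 1560)) (.cycle false 4751 1560)) (.cycle false 7543 5061))
    (.cycle false 7451 6510)))))) (.split 1 6 (.split 0 6 (.embed 5 true false 63571402
    23417560) (.cycle false 3470 6150)) (.cycle false 3471 6150))),
   (⟨3472855876335046656, 72340315394015491⟩,
    .split 3 3 (.split 7 3 (.cycle true 7342 4302) (.split 5 3 (.cycle true 5342 4302)
    (.split 1 3 (.cycle true 2431 4203) (.split 5 5 (.split 4 3 (.split 1 5 (.embed 6 false
    false 74365210 16027435) (.cycle false 4170 1530)) (.cycle false 3470 1530))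
    (.cycle false 4570 1530))))) (.split 6 3 (.split 5 3 (.split 1 3 (.split 7 2
    (.cycle true 5672 4352) (.split 5 2 (.cycle true 7652 4532) (.split 5 1 (.cycle true 7651
    4513) (.split 0 4 (.embed 0 false false 7643251 36147250) (.cycle false 3570 4120)))))
    (.cycle false 4310 1530)) (.cycle false 4350 1530)) (.cycle false 4360 1530))),
   (⟨3472855876335046658, 72340315394015525⟩,
    .split 5 1 (.split 7 2 (.cycle true 5672 4152) (.split 1 1 (.embed 0 false false 16743250
    36147250) (.cycle false 4170 5102))) (.split 6 2 (.split 4 4 (.split 3 2 (.split 0 4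
    (.cycle true 4360 4021) (.cycle false 3450 4510)) (.cycle false 3450 2510))
    (.cycle false 4350 5410)) (.cycle false 4560 5102))),
   (⟨14073770328457216, 570425344⟩,
    .split 1 0 (.split 1 5 (.cycle true 6241 5420) (.split 1 1 (.cycle true 6241 1420) (.embed 8
    false false 76543210 76543210))) (.split 7 0 (.split 7 5 (.cycle true 6742 4502) (.split 7 1
    (.cycle true 6742 4102) (.embed 8 false false 56147230 36147250))) (.split 3 4 (.split 2 5
    (.cycle true 6342 5402) (.split 2 1 (.cycle true 4362 2041) (.split 7 5 (.split 7 2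
    (.cycle true 6743 4520) (.embed 5 false false 76543210 76543210)) (.split 1 2 (.split 1 5
    (.cycle true 6341 5402) (.split 1 1 (.cycle true 4361 2041) (.embed 8 false false 76542310
    36147052))) (.split 3 2 (.split 4 5 (.cycle true 6432 4502) (.split 4 1 (.cycle true 6432
    4102) (.split 0 1 (.split 0 2 (.cycle true 4360 2041) (.split 0 0 (.cycle true 6340 1420)
    (.embed 5 false false 6743215 36147250))) (.split 0 2 (.split 0 5 (.cycle true 6340 5402)
    (.embed 8 false false 76542301 36147052)) (.cycle false 1740 2051))))) (.cycle false 3271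
    2150)))))) (.split 4 5 (.split 3 2 (.cycle true 6432 4502) (.embed 3 false false 76543210
    76543210)) (.split 4 1 (.split 3 2 (.cycle true 6432 4102) (.embed 3 false false 76543210
    36147250)) (.split 0 0 (.split 0 5 (.cycle true 6240 5420) (.split 0 1 (.cycle true 6240
    1420) (.embed 8 false false 76543201 36147250))) (.split 5 0 (.split 5 5 (.cycle true 6542
    4502) (.split 5 1 (.cycle true 6542 4102) (.embed 8 false false 76145230 36147250)))
    (.split 7 4 (.split 7 5 (.split 6 0 (.cycle true 7642 4502) (.split 0 1 (.split 0 2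
    (.cycle true 2760 2451) (.split 0 5 (.split 7 2 (.cycle true 7260 5241) (.split 6 2
    (.cycle true 7260 5421) (.split 5 1 (.split 5 2 (.cycle true 7652 4512) (.split 1 1
    (.split 7 1 (.split 5 5 (.embed 20 false false 42350761 36047125) (.split 1 4 (.split 0 4
    (.embed 0 false false 60743215 36547210) (.cycle false 3570 4520)) (.cycle false 3571
    4520))) (.split 5 4 (.split 1 4 (.split 0 4 (.embed 0 false false 10643257 36147250)
    (.cycle false 3760 4120)) (.cycle false 3761 4120)) (.cycle false 5673 4021))) (.split 5 5
    (.split 5 4 (.split 0 4 (.embed 1 false false 50743261 36547210) (.cycle false 3170 4102))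
    (.cycle false 3571 1420)) (.cycle false 4571 1520)))) (.split 1 4 (.split 0 4 (.embed 1
    false false 60743215 36547210) (.cycle false 3570 4102)) (.cycle false 3451 4510)))))
    (.split 5 4 (.split 1 4 (.embed 0 false false 76543210 76543210) (.cycle false 4310 5140))
    (.cycle false 4350 5140)))) (.split 5 4 (.split 1 4 (.embed 1 false false 76543210 76543210)
    (.cycle false 4310 1540)) (.cycle false 4350 1540)))) (.split 5 4 (.split 1 4 (.split 0 4
    (.embed 2 false false 76543210 76543210) (.cycle false 3470 4150)) (.cycle false 3471 4150))
    (.cycle false 5743 4051))) (.split 5 5 (.split 5 1 (.split 1 5 (.split 1 1 (.split 0 5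
    (.split 0 1 (.split 5 2 (.cycle true 6251 5421) (.split 1 2 (.cycle true 2651 2451)
    (.split 0 2 (.cycle true 2650 2451) (.embed 8 true false 63451702 36147052))))
    (.cycle false 4370 1540)) (.cycle false 4370 5140)) (.cycle false 4371 1540))
    (.cycle false 4371 5140)) (.cycle false 4573 5104)) (.cycle false 7543 4051)))))))))),
   (⟨5066580737523712, 27021598137516032⟩,
    .split 1 6 (.split 1 4 (.cycle true 3461 6014) (.split 1 1 (.cycle true 3421 6021) (.embed 0
    false false 72631450 35127046))) (.split 0 4 (.split 0 6 (.cycle true 3460 6014) (.embed 0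
    false true 74506132 15067423)) (.split 1 2 (.split 1 0 (.cycle true 2641 2410) (.split 0 0
    (.split 0 1 (.cycle true 6240 1420) (.embed 0 false true 70641253 15047236)) (.split 6 2
    (.split 3 5 (.split 1 5 (.cycle true 3461 5012) (.embed 0 false false 73621450 34507162))
    (.cycle false 3610 4560)) (.cycle false 3610 4260)))) (.split 0 5 (.split 0 0 (.split 0 2
    (.cycle true 2640 2410) (.split 0 1 (.cycle true 6240 1420) (.split 3 5 (.embed 0 false
    false 72630451 36127045) (.cycle false 3610 4562)))) (.split 6 0 (.split 2 0 (.split 4 6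
    (.cycle true 6432 4160) (.embed 0 true true 76540231 25417360)) (.cycle false 3120 4260))
    (.cycle false 3160 4260))) (.cycle false 6130 5624))))),
   (⟨5066580737392640, 27021597869080576⟩,
    .split 2 1 (.split 3 4 (.cycle true 4362 2041) (.embed 0 false false 76543210 76543210))
    (.split 0 2 (.split 0 0 (.cycle true 2640 2410) (.split 1 2 (.split 1 0 (.cycle true 2641
    2410) (.embed 1 false true 72610453 35027614)) (.split 1 5 (.split 0 6 (.split 6 0
    (.cycle true 3620 6042) (.split 3 4 (.cycle true 3640 6412) (.split 0 4 (.cycle true 3460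
    6014) (.cycle false 3260 4160)))) (.split 1 0 (.split 2 5 (.cycle true 2641 5410)
    (.split 1 1 (.cycle true 6241 1420) (.split 3 5 (.split 1 6 (.split 3 4 (.cycle true 3641
    6410) (.split 1 4 (.cycle true 3461 6014) (.split 0 5 (.cycle true 3140 5602) (.split 6 2
    (.split 0 4 (.embed 0 false false 70541632 35647120) (.cycle false 6230 5614))
    (.cycle false 3621 4261))))) (.cycle false 6231 6512)) (.cycle false 3621 2561))))
    (.cycle false 2310 6120))) (.cycle false 6231 5612)))) (.split 0 5 (.split 2 5 (.split 3 5
    (.cycle true 3462 5014) (.split 0 0 (.cycle true 2640 5410) (.split 6 0 (.split 0 1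
    (.cycle true 2460 5201) (.cycle false 3620 2561)) (.cycle false 3260 2160)))) (.split 0 6
    (.split 0 4 (.cycle true 3460 6014) (.split 3 4 (.split 6 0 (.cycle true 3642 4012)
    (.split 0 0 (.cycle true 3640 6410) (.cycle false 3260 2150))) (.split 6 2 (.split 0 1
    (.cycle true 3460 6021) (.split 3 5 (.embed 0 false false 72543610 35647120)
    (.cycle false 3620 4561))) (.cycle false 3260 4162)))) (.cycle false 6230 6512)))
    (.cycle false 6230 5612)))),
   (⟨5066847025364992, 27303081364422656⟩,
    .split 1 6 (.split 1 1 (.cycle true 4261 6241) (.embed 2 false true 76541230 5147236))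
    (.split 3 4 (.split 2 1 (.cycle true 4362 2641) (.split 2 0 (.split 6 2 (.cycle true 6432
    4260) (.split 1 2 (.split 1 1 (.cycle true 4361 2641) (.embed 2 false true 72641053
    5147326)) (.split 2 6 (.split 3 2 (.split 5 1 (.split 5 2 (.cycle true 4563 6214)
    (.split 5 0 (.cycle true 4563 6014) (.embed 0 false true 72641053 5147236))) (.split 5 2
    (.split 5 6 (.cycle true 3542 4260) (.split 5 0 (.cycle true 3452 4620) (.split 4 5
    (.split 2 5 (.split 5 5 (.cycle true 3452 4652) (.embed 2 false false 72645310 13047652))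
    (.cycle false 5261 6152)) (.cycle false 5461 6152)))) (.split 4 5 (.split 3 5 (.embed 2
    false false 72536410 13027564) (.cycle false 6351 6512)) (.cycle false 6451 6512))))
    (.split 4 5 (.split 2 5 (.embed 0 false false 73526410 31207564) (.cycle false 6231 6512))
    (.cycle false 6431 6512))) (.split 4 5 (.split 3 5 (.embed 0 false false 72536410 31627504)
    (.cycle false 2361 6152)) (.cycle false 2461 6152))))) (.split 1 0 (.split 1 4
    (.cycle true 2431 4260) (.split 1 2 (.cycle true 2341 2460) (.split 3 2 (.embed 2 true false
    71523640 35267041) (.cycle false 6231 6012)))) (.split 4 5 (.split 3 5 (.embed 2 false false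
    73526410 13057264) (.cycle false 6321 6510)) (.cycle false 6421 6510))))) (.split 1 4
    (.split 1 0 (.cycle true 2431 4260) (.embed 2 false true 74560231 5127463)) (.split 4 5
    (.embed 2 true false 76534120 23067451) (.cycle false 6431 6514))))),
   (⟨5066572147458048, 27021597797777408⟩,
    .split 4 1 (.split 3 2 (.cycle true 6432 4102) (.split 2 6 (.cycle true 3462 6014) (.embed 1
    false false 76543210 76543210))) (.split 4 6 (.split 6 0 (.cycle true 6342 4062) (.embed 0
    false false 76543210 76543210)) (.split 3 4 (.split 2 1 (.cycle true 4362 2041) (.split 2 7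
    (.split 6 7 (.cycle true 6342 7402) (.split 3 7 (.split 6 0 (.cycle true 3642 7402) (.embed
    1 false false 74536210 31625704)) (.split 2 6 (.split 6 2 (.cycle true 3462 6024) (.embed 1
    false false 73526410 31705264)) (.split 4 5 (.split 2 5 (.split 6 2 (.cycle true 4362 5042)
    (.embed 0 false false 76542310 32746015)) (.cycle false 4362 6175)) (.cycle false 4632
    6571))))) (.split 3 7 (.split 6 7 (.cycle true 6342 4702) (.embed 3 false false 73526410
    13605274)) (.split 3 5 (.split 2 5 (.split 6 2 (.cycle true 3462 5024) (.split 6 0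
    (.cycle true 3642 5402) (.split 2 0 (.embed 0 false false 76524310 30647512)
    (.cycle false 3462 7160)))) (.cycle false 3462 7165)) (.cycle false 3642 7561)))))
    (.split 0 4 (.split 0 6 (.cycle true 3420 6024) (.embed 3 false true 74506231 15027463))
    (.split 0 5 (.split 0 1 (.split 4 5 (.cycle true 4260 5241) (.split 0 0 (.cycle true 6240
    1420) (.split 6 0 (.split 0 6 (.split 4 4 (.cycle true 3460 6041) (.split 3 2
    (.cycle true 3260 6241) (.split 2 1 (.cycle true 3620 6041) (.split 2 0 (.cycle true 3260
    6041) (.split 0 2 (.cycle true 3620 6042) (.cycle false 3420 2410)))))) (.cycle false 6430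
    6514)) (.cycle false 3460 4160)))) (.split 3 5 (.embed 3 false false 73526410 13507264)
    (.cycle false 3640 4561))) (.cycle false 6430 5614)))))),
   (⟨5066571073716736, 47287805784621312⟩,
    .split 4 5 (.split 1 5 (.cycle true 4261 5241) (.embed 4 false false 74561230 36027451))
    (.split 1 6 (.split 4 6 (.cycle true 4261 6241) (.embed 0 false false 74561230 36527401))
    (.split 6 0 (.split 1 7 (.split 1 3 (.split 4 7 (.cycle true 4261 7241) (.split 2 7
    (.cycle true 2461 7201) (.split 2 3 (.cycle true 2461 3201) (.split 3 3 (.split 2 0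
    (.cycle true 3261 3041) (.cycle false 3421 6170)) (.cycle false 6432 7513)))))
    (.cycle false 3461 6153)) (.cycle false 6431 7516)) (.cycle false 3461 6150)))),
   (⟨5066571073716224, 33554432⟩,
    .split 6 5 (.split 3 5 (.cycle true 6342 4502) (.embed 5 false false 76543210 76543210))
    (.split 3 6 (.split 6 6 (.cycle true 6342 4602) (.embed 1 false false 76543210 76543210))
    (.split 4 1 (.split 3 2 (.cycle true 6432 4102) (.split 3 4 (.split 6 2 (.cycle true 3462
    4012) (.split 6 0 (.cycle true 3642 4012) (.split 2 1 (.cycle true 4362 2041) (.split 2 0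
    (.cycle true 4632 2140) (.split 0 2 (.split 0 1 (.cycle true 4360 2041) (.split 0 0
    (.cycle true 4630 2140) (.split 2 5 (.split 0 5 (.cycle true 2340 5402) (.cycle false 6320
    5210)) (.cycle false 3620 1250)))) (.split 0 6 (.split 0 5 (.split 0 1 (.split 4 6
    (.cycle true 4260 6241) (.split 4 5 (.cycle true 4260 5241) (.split 3 5 (.cycle true 3240
    5421) (.split 2 6 (.cycle true 2340 6401) (.split 0 0 (.cycle true 6240 1420)
    (.cycle false 3420 2560)))))) (.split 3 5 (.split 2 6 (.cycle true 2430 6205)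
    (.cycle false 6230 2061)) (.cycle false 3620 2501))) (.cycle false 6230 5012))
    (.cycle false 3260 6102))))))) (.split 1 0 (.split 1 1 (.cycle true 6241 1420) (.embed 5
    false true 70641253 5147236)) (.split 7 0 (.split 7 1 (.cycle true 6742 4102) (.embed 5
    false true 70641253 1345276)) (.split 5 0 (.split 5 1 (.cycle true 6542 4102) (.embed 5
    false true 70641253 1347256)) (.split 0 1 (.split 0 0 (.cycle true 6240 1420) (.embed 1
    false true 70641253 10547236)) (.split 0 2 (.split 0 0 (.cycle true 2640 2410) (.embed 1
    false true 70642153 10547632)) (.split 7 4 (.split 7 6 (.split 6 6 (.cycle true 7642 4612)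
    (.split 2 6 (.cycle true 7642 6412) (.split 7 5 (.split 3 5 (.cycle true 7643 5410)
    (.split 2 5 (.cycle true 7642 5412) (.split 6 2 (.split 2 1 (.split 4 6 (.cycle true 6742
    2461) (.split 4 5 (.cycle true 6742 2451) (.embed 1 false false 54367210 35617204)))
    (.cycle false 3620 2651)) (.cycle false 6230 2651)))) (.split 7 2 (.split 5 2 (.split 5 1
    (.split 1 4 (.split 1 1 (.split 0 0 (.split 6 0 (.cycle true 5764 1240) (.split 0 6
    (.cycle true 7640 6410) (.split 0 4 (.cycle true 7540 4210) (.split 3 5 (.split 0 5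
    (.split 1 5 (.cycle true 3471 5024) (.embed 1 false false 70621453 31607254))
    (.cycle false 7630 5064)) (.cycle false 6730 6054))))) (.cycle false 3670 2650))
    (.cycle false 3671 1650)) (.cycle false 3671 4650)) (.cycle false 6753 6501))
    (.cycle false 6753 6502)) (.cycle false 7630 2561))))) (.split 5 2 (.split 5 1 (.split 6 0
    (.cycle true 6452 4012) (.split 0 5 (.embed 1 true false 56430721 31407652)
    (.cycle false 6730 5062))) (.cycle false 3750 2601)) (.cycle false 5730 2061))) (.split 5 1
    (.embed 1 false true 70641253 5741236) (.cycle false 3750 2401)))))))))) (.split 6 3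
    (.split 3 3 (.cycle true 6342 4302) (.embed 5 false false 76543210 56147230)) (.split 6 7
    (.split 3 7 (.cycle true 6342 4702) (.embed 5 false false 76543210 35146270)) (.split 1 1
    (.split 1 0 (.cycle true 6241 1420) (.embed 0 false false 76543210 76543210)) (.split 0 1
    (.split 0 0 (.cycle true 6240 1420) (.embed 0 false false 76543201 36547210)) (.split 3 4
    (.split 2 1 (.cycle true 4362 2041) (.split 2 6 (.split 6 6 (.cycle true 6342 6402) (.embed
    1 false false 76542310 36547012)) (.split 3 5 (.embed 1 false false 73526410 31607254)
    (.split 4 7 (.split 4 3 (.split 1 7 (.split 1 3 (.split 0 7 (.split 0 3 (.split 3 7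
    (.cycle true 3241 7423) (.split 2 7 (.cycle true 2341 7403) (.split 2 3 (.cycle true 4321
    7043) (.split 1 4 (.cycle true 4210 7243) (.split 1 2 (.cycle true 4321 7042) (.split 0 4
    (.cycle true 2410 4273) (.split 0 0 (.cycle true 4230 7240) (.split 6 2 (.split 4 6
    (.split 1 6 (.split 1 5 (.split 2 5 (.cycle true 4621 7245) (.embed 0 false false 72610435
    10325647)) (.cycle false 6321 5761)) (.cycle false 3621 6571)) (.cycle false 6342 7561))
    (.cycle false 6321 2761))))))))) (.cycle false 6320 3561)) (.cycle false 6320 7561))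
    (.cycle false 6321 3561)) (.cycle false 6321 7561)) (.cycle false 3642 6531))
    (.cycle false 3642 6571))))) (.split 3 7 (.embed 1 false false 73526410 31605274)
    (.split 5 1 (.split 5 0 (.cycle true 6542 4102) (.embed 0 false false 76143250 36547210))
    (.split 7 1 (.split 7 0 (.cycle true 6742 4102) (.embed 0 false false 56143270 36547210))
    (.split 1 4 (.split 1 5 (.split 3 5 (.cycle true 3421 5024) (.split 1 3 (.split 3 3
    (.cycle true 2431 4203) (.embed 5 false false 71643250 16347250)) (.split 4 6 (.split 0 6
    (.split 0 5 (.cycle true 4210 6245) (.cycle false 3610 5731)) (.cycle false 3610 6731))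
    (.cycle false 6341 3761)))) (.split 7 6 (.split 7 4 (.split 5 6 (.split 5 4 (.split 4 6
    (.split 0 6 (.split 0 4 (.split 7 0 (.cycle true 5742 4602) (.split 2 1 (.cycle true 4762
    2641) (.split 2 6 (.split 1 0 (.cycle true 2410 6204) (.cycle false 6371 5710))
    (.cycle false 6321 5761)))) (.cycle false 3610 4751)) (.cycle false 3610 6751))
    (.cycle false 6341 5761)) (.cycle false 6351 5741)) (.cycle false 6351 5761))
    (.cycle false 6371 5741)) (.cycle false 6371 5761))) (.split 4 5 (.split 0 5 (.split 0 3
    (.embed 1 false false 76540231 3746215) (.cycle false 6310 3741)) (.cycle false 6310 5741))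
    (.cycle false 3641 4751)))))))))))))),
   (⟨2310909575975665664, 72057594088268291⟩,
    .split 4 5 (.split 7 1 (.cycle true 6742 4152) (.embed 0 false false 56347210 3647215))
    (.split 4 6 (.split 7 6 (.split 7 1 (.cycle true 6742 4162) (.embed 0 false false 56347210
    3547216)) (.embed 0 true false 67514032 23407165)) (.split 0 6 (.embed 0 true false 74630152
    23457160) (.cycle false 4130 6510)))),
   (⟨5066571056939008, 0⟩,
    .split 3 0 (.split 3 1 (.cycle true 6342 4102) (.embed 1 false false 76543210 76543210))
    (.split 5 0 (.split 5 1 (.cycle true 6542 4102) (.embed 1 false false 76345210 35647210))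
    (.split 7 0 (.split 7 1 (.cycle true 6742 4102) (.embed 1 false false 56347210 35647210))
    (.split 0 0 (.split 0 1 (.cycle true 6240 1420) (.embed 1 false false 76540231 35647210))
    (.split 1 1 (.split 1 0 (.cycle true 6241 1420) (.embed 1 false false 74561230 35627401))
    (.split 0 1 (.embed 1 false false 74560231 35627401) (.split 3 1 (.embed 1 false false
    74563210 35627401) (.split 1 5 (.split 6 5 (.split 1 0 (.cycle true 6241 5420) (.embed 1
    false false 74561230 13627405)) (.split 5 5 (.split 1 2 (.split 5 1 (.cycle true 5621 5142)
    (.embed 1 false false 76415230 3647215)) (.split 6 2 (.split 5 4 (.split 1 0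
    (.cycle true 5641 5420) (.embed 1 false false 74651230 13627405)) (.split 1 4 (.embed 1
    false false 74615230 13627405) (.split 0 2 (.embed 1 true false 71630542 35647021)
    (.cycle false 1530 2401)))) (.split 0 5 (.embed 1 true false 76530142 34627150)
    (.cycle false 6130 5210)))) (.embed 0 false false 14763250 36527401))) (.split 7 5 (.embed 0
    false false 76543210 76543210) (.split 5 4 (.split 5 1 (.embed 1 false false 74365210
    35627401) (.split 5 3 (.split 1 3 (.split 1 0 (.cycle true 5241 3420) (.embed 1 false false
    74651230 15627403)) (.split 0 3 (.embed 1 false false 74650231 15627403) (.cycle false 1750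
    3501))) (.split 1 3 (.embed 1 true false 65471032 24617035) (.cycle false 7351 5013))))
    (.split 7 4 (.embed 1 true false 65417032 23607145) (.cycle false 7531 5401)))))))))))),
   (⟨5066575351906304, 141733920768⟩,
    .split 6 5 (.embed 0 false false 76543210 3647251) (.split 6 6 (.embed 0 false false
    76543210 3547261) (.split 2 7 (.embed 0 false false 76523410 3516247) (.split 2 0 (.embed 0
    false false 76523410 35617240) (.embed 0 true false 76523410 12354067))))),
   (⟨9228438586436878336, 144116012709593600⟩,
    .split 7 2 (.embed 1 false false 57463210 3526471) (.embed 1 true false 67543120 3415627)),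
   (⟨5066549582102528, 144116150148547072⟩,
    .split 7 7 (.embed 0 false false 76543210 76543210) (.embed 2 true false 67543120 2314675)),
   (⟨5066550655860736, 144115639080977920⟩,
    .split 1 3 (.split 3 5 (.split 7 5 (.split 7 3 (.embed 2 false false 67514320 4157632)
    (.embed 0 false false 16543270 3647215)) (.embed 0 false false 16543270 5643217)) (.embed 0
    false false 16745230 5643217)) (.embed 0 false false 36745210 3647215)),
   (⟨5066566761971712, 0⟩,
    .split 4 0 (.embed 4 false false 76543210 76543210) (.split 4 3 (.embed 4 false false
    76543210 5647213) (.split 4 5 (.embed 4 false false 76543210 3647215) (.split 4 7 (.embed 4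
    false false 76543210 3546217) (.split 4 6 (.embed 4 false false 76543210 3547216)
    (.split 4 1 (.embed 3 false false 76543210 76543210) (.split 7 1 (.embed 4 false true
    72615430 1325647) (.split 1 1 (.embed 4 false true 72615430 3527641) (.split 1 6 (.split 1 2
    (.embed 4 false false 76514230 3547216) (.split 3 2 (.split 6 6 (.embed 4 false true
    76523410 3567214) (.split 6 2 (.split 1 7 (.split 6 7 (.split 3 6 (.cycle true 6231 7426)
    (.embed 2 false true 27563410 34065217)) (.embed 1 false true 74513260 14725360)) (.embed 1
    false false 76543210 7326415)) (.embed 3 true true 76524130 5247163))) (.split 3 6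
    (.split 7 6 (.split 7 2 (.embed 4 false false 57463210 3527461) (.embed 0 false false
    72543610 6345127)) (.embed 1 false false 16543270 6347215)) (.embed 1 false false 12745630
    6347125)))) (.embed 1 false false 76543210 76543210)))))))))),
   (⟨4644356461199616, 54043745552699392⟩,
    .split 4 3 (.embed 0 false false 74563210 1526437) (.split 1 3 (.embed 0 false false
    71654320 12405736) (.split 3 6 (.embed 0 false false 73654120 12304765) (.cycle false 3641
    4673)))),
   (⟨4503616808550400, 0⟩,
    .split 6 1 (.embed 1 false false 76543210 76543210) (.split 6 6 (.embed 1 false false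
    76543210 1345267) (.split 6 7 (.embed 1 false false 76543210 1345276) (.split 6 0 (.embed 1
    false false 76543210 13546207) (.split 4 7 (.embed 1 false false 74563210 1325476)
    (.split 4 0 (.embed 1 false false 74563210 13526407) (.split 3 0 (.split 5 0 (.split 3 4
    (.embed 1 false false 73645210 13546207) (.split 5 4 (.embed 1 false false 75643210
    13546207) (.split 3 7 (.split 5 7 (.split 1 7 (.embed 0 false false 76145230 71345260)
    (.embed 1 true false 76513420 12304765)) (.embed 1 true false 75362410 12375046)) (.embed 1
    true false 74652310 12375406)))) (.embed 1 true false 76352410 12374065)) (.embed 1 true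
    false 76532410 12374065)))))))),
   (⟨36301063847936, 72057594037927936⟩,
    .split 4 5 (.embed 0 false false 75623410 1354267) (.split 2 5 (.embed 0 false false
    75643210 1354267) (.split 4 0 (.embed 0 false false 75623410 13405267) (.embed 0 true false
    67523410 12304567)))),
   (⟨1310720, 76578785851342864⟩,
    .split 5 0 (.split 6 0 (.embed 0 false false 7264531 13265074) (.embed 1 true false 57403621
    12305467)) (.embed 1 true false 67403521 12305467)),
   (⟨17181179904, 0⟩,
    .split 3 4 (.embed 2 false false 74635210 1326475) (.split 0 4 (.embed 2 false false
    74605231 1326475) (.split 1 4 (.embed 2 false false 74615230 1326475) (.split 7 7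
    (.split 4 7 (.embed 1 false false 6275431 1256734) (.embed 0 false false 43176250 1345267))
    (.embed 0 false false 73165240 1345267))))),
   (⟨17180131328, 0⟩,
    .split 2 4 (.embed 0 false false 76543210 76543210) (.split 2 5 (.embed 0 false false
    76543210 1354267) (.split 4 5 (.embed 0 false false 76523410 1354267) (.embed 0 true false
    76543210 1243567)))),
   (⟨262144, 0⟩,
    .split 4 2 (.embed 0 false false 76543210 76543210) (.split 1 2 (.embed 0 false false
    76524130 1345267) (.embed 0 true false 76543120 1345267))),
   (⟨0, 0⟩,
    .split 2 2 (.embed 0 false false 76543210 76543210) (.embed 0 true false 76543210 1345267))]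

theorem checkDerivations_octagonDerivations : checkDerivations [] octagonDerivations = true := by
  decide +kernel

theorem not_avoidsOctagon (f : Fin 8 → Fin 8 → Bool) : ¬ AvoidsOctagon f := fun hf =>
  refuted_empty_of_checkDerivations (by simp) checkDerivations_octagonDerivations f hf
    (by simp [Pattern.Extends, Pattern.colours, Pattern.mask])

theorem hasCycleLen_eight_s12 {α β : Type*} {G : SimpleGraph (α ⊕ β)} {r : Fin 4 → α} {s : Fin 4 → β}
    (hr : Function.Injective r) (hs : Function.Injective s)
    (h : ∀ k, G.Adj (inl (r k)) (inr (s k)) ∧ G.Adj (inl (r (k + 1))) (inr (s k))) :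
    HasCycleLen G 8 := by
  refine ⟨inl (r 0), .cons (h 0).1 <| .cons (h 0).2.symm <| .cons (h 1).1 <| .cons (h 1).2.symm <|
    .cons (h 2).1 <| .cons (h 2).2.symm <| .cons (h 3).1 <| .cons (h 3).2.symm .nil, ?_, rfl⟩
  simp [Walk.cons_isCycle_iff, Walk.cons_isPath_iff, hr.eq_iff, hs.eq_iff]

/-- Upper bound for Theorem 5 (`BR(C_8, C_8) ≤ 8`): every subgraph `G` of `K_{8,8}`
contains `C_8`, or its bipartite complement contains `C_8`. -/
theorem stmt12 (G : SimpleGraph (Fin 8 ⊕ Fin 8)) (hG : G ≤ Kbb 8) :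
    HasCycleLen G 8 ∨ HasCycleLen (Kbb 8 \ G) 8 := by
  classical
  by_contra! hcon
  refine not_avoidsOctagon (fun i j => decide (G.Adj (inl i) (inr j))) fun c r s hr hs h => ?_
  cases c
  · exact hcon.2 (hasCycleLen_eight_s12 hr hs fun k => by simpa using h k)
  · exact hcon.1 (hasCycleLen_eight_s12 hr hs fun k => by simpa using h k)
end

section
/- The bipartite Ramsey number BR(C_10, C_8) equals 8. In particular, every subgraph G of the complete bipartite graph K_{8,8} contains a cycle of length 10 or its bipartite complement in K_{8,8} contains a cycle of length 8. -/
open SimpleGraph Sum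

/-- Two-colourings of the edges of a complete bipartite graph; only the values on vertices below
`8` matter. `true` stands for an edge of the graph, `false` for an edge of its complement. -/
abbrev Colouring := ℕ → ℕ → Bool

/-- The vertices `a i`, `b i` form a cycle `a 0, b 0, a 1, b 1, …` of colour `c`. -/
structure IsMonoCycle (f : Colouring) (c : Bool) (k : ℕ) [NeZero k] (a b : Fin k → ℕ) : Prop where
  left_lt : ∀ i, a i < 8
  right_lt : ∀ i, b i < 8
  left_inj : Function.Injective a
  right_inj : Function.Injective b
  adj : ∀ i, f (a i) (b i) = c
  adj_succ : ∀ i, f (a (i + 1)) (b i) = c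

/-- A colouring without a `true` cycle of length `10` and without a `false` cycle of length `8`. -/
structure Avoiding (f : Colouring) : Prop where
  no_true : ∀ a b, ¬ IsMonoCycle f true 5 a b
  no_false : ∀ a b, ¬ IsMonoCycle f false 4 a b

theorem IsMonoCycle.swap {f : Colouring} {c : Bool} {k : ℕ} [NeZero k] {a b : Fin k → ℕ}
    (h : IsMonoCycle (fun i j => f j i) c k a b) :
    IsMonoCycle f c k b (fun i => a (i + 1)) where
  left_lt := h.right_lt
  right_lt _ := h.left_lt _
  left_inj := h.right_inj
  right_inj := h.left_inj.comp (add_left_injective 1)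
  adj := h.adj_succ
  adj_succ i := h.adj (i + 1)

theorem Avoiding.swap {f : Colouring} (h : Avoiding f) : Avoiding (fun i j => f j i) :=
  ⟨fun _ _ hc => h.no_true _ _ hc.swap, fun _ _ hc => h.no_false _ _ hc.swap⟩

theorem IsMonoCycle.of_reindex {f : Colouring} {c : Bool} {k : ℕ} [NeZero k] {a b : Fin k → ℕ}
    {s t : ℕ → ℕ} (hs : ∀ i < 8, s i < 8) (ht : ∀ i < 8, t i < 8)
    (hs' : Set.InjOn s (Set.Iio 8)) (ht' : Set.InjOn t (Set.Iio 8))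
    (h : IsMonoCycle (fun i j => f (s i) (t j)) c k a b) :
    IsMonoCycle f c k (s ∘ a) (t ∘ b) where
  left_lt i := hs _ (h.left_lt i)
  right_lt i := ht _ (h.right_lt i)
  left_inj _ _ hij := h.left_inj (hs' (h.left_lt _) (h.left_lt _) hij)
  right_inj _ _ hij := h.right_inj (ht' (h.right_lt _) (h.right_lt _) hij)
  adj := h.adj
  adj_succ := h.adj_succ

theorem Avoiding.reindex {f : Colouring} (h : Avoiding f) {s t : ℕ → ℕ}
    (hs : ∀ i < 8, s i < 8) (ht : ∀ i < 8, t i < 8)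
    (hs' : Set.InjOn s (Set.Iio 8)) (ht' : Set.InjOn t (Set.Iio 8)) :
    Avoiding (fun i j => f (s i) (t j)) :=
  ⟨fun _ _ hc => h.no_true _ _ (hc.of_reindex hs ht hs' ht'),
    fun _ _ hc => h.no_false _ _ (hc.of_reindex hs ht hs' ht')⟩

/-- The literal `64 * c + 8 * i + j` says that the edge between `i` on the left and `j` on the
right is `true` (for `c = 1`) or `false` (for `c = 0`). -/
def Holds (f : Colouring) (l : ℕ) : Prop := f (l / 8 % 8) (l % 8) = (l / 64 % 2 == 1)

/-- The negation of a literal. -/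
def negate (l : ℕ) : ℕ := (l + 64) % 128

theorem holds_negate_iff (f : Colouring) (l : ℕ) : Holds f (negate l) ↔ ¬ Holds f l := by
  have h1 : negate l / 8 % 8 = l / 8 % 8 := by unfold negate; omega
  have h2 : negate l % 8 = l % 8 := by unfold negate; omega
  have h3 : (negate l / 64 % 2 == 1) = !(l / 64 % 2 == 1) := by
    have : negate l / 64 % 2 = 1 - l / 64 % 2 := by unfold negate; omega
    rw [this]
    rcases Nat.mod_two_eq_zero_or_one (l / 64) with h | h <;> simp [h]
  unfold Holds
  rw [h1, h2, h3]
  cases f (l / 8 % 8) (l % 8) <;> cases (l / 64 % 2 == 1) <;> simp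

/-- A pattern is a list of literals. It is impossible if no avoiding colouring satisfies it. -/
def Impossible (p : List ℕ) : Prop := ∀ f, Avoiding f → ¬ ∀ l ∈ p, Holds f l

/-- The pattern of a `true` cycle of length `10`. -/
def trueCycle : List ℕ := [64, 73, 82, 91, 100, 72, 81, 90, 99, 68]

/-- The pattern of a `false` cycle of length `8`. -/
def falseCycle : List ℕ := [0, 9, 18, 27, 8, 17, 26, 3]

theorem impossible_trueCycle : Impossible trueCycle := by
  intro f hf h
  refine hf.no_true Fin.val Fin.val
    ⟨by omega, by omega, Fin.val_injective, Fin.val_injective, ?_, ?_⟩ <;>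
  · simp [trueCycle, Holds] at h
    simp [Fin.forall_fin_succ, h]

theorem impossible_falseCycle : Impossible falseCycle := by
  intro f hf h
  refine hf.no_false Fin.val Fin.val
    ⟨by omega, by omega, Fin.val_injective, Fin.val_injective, ?_, ?_⟩ <;>
  · simp [falseCycle, Holds] at h
    simp [Fin.forall_fin_succ, h]

/-- The decimal digit of `s` at place `i`. -/
def digit (s i : ℕ) : ℕ := s / 10 ^ i % 10

/-- Whether a list of numbers below `8` has no repetitions. -/
def distinctBelowEight : List ℕ → Bool
  | [] => true
  | a :: l => Nat.blt a 8 && !l.elem a && distinctBelowEight l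

theorem of_distinctBelowEight {l : List ℕ} (h : distinctBelowEight l = true) :
    l.Nodup ∧ ∀ a ∈ l, a < 8 := by
  induction l with
  | nil => simp
  | cons a l ih =>
    simp only [distinctBelowEight, Bool.and_eq_true, Nat.blt_eq, Bool.not_eq_true'] at h
    obtain ⟨⟨h1, h2⟩, h3⟩ := h
    have h2 : a ∉ l := by simpa using h2
    obtain ⟨h4, h5⟩ := ih h3
    exact ⟨List.nodup_cons.2 ⟨h2, h4⟩, List.forall_mem_cons.2 ⟨h1, h5⟩⟩

/-- Whether the last eight decimal digits of `s` are a permutation of `0, …, 7`. -/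
def isPerm (s : ℕ) : Bool :=
  distinctBelowEight [digit s 0, digit s 1, digit s 2, digit s 3, digit s 4, digit s 5,
    digit s 6, digit s 7]

theorem of_isPerm {s : ℕ} (h : isPerm s = true) :
    (∀ i < 8, digit s i < 8) ∧ Set.InjOn (digit s) (Set.Iio 8) := by
  obtain ⟨h1, h2⟩ := of_distinctBelowEight h
  change ((List.range 8).map (digit s)).Nodup at h1
  change ∀ a ∈ (List.range 8).map (digit s), a < 8 at h2
  refine ⟨fun i hi => h2 _ (List.mem_map_of_mem (List.mem_range.2 hi)), fun i hi j hj hij => ?_⟩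
  exact List.inj_on_of_nodup_map h1 (List.mem_range.2 hi) (List.mem_range.2 hj) hij

/-- The image of a literal when left vertices are mapped by the digits of `s` and right vertices
by the digits of `t`. A ninth digit `1` of `s` exchanges the two sides afterwards. -/
def image (s t l : ℕ) : ℕ :=
  bif Nat.ble 100000000 s then l / 64 * 64 + (8 * digit t (l % 8) + digit s (l / 8 % 8))
  else l / 64 * 64 + (8 * digit s (l / 8 % 8) + digit t (l % 8))

theorem Impossible.of_image {p : List ℕ} (hp : Impossible p) {s t : ℕ} (hs : isPerm s = true)
    (ht : isPerm t = true) {f : Colouring} (hf : Avoiding f) :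
    ¬ ∀ l ∈ p, Holds f (image s t l) := by
  obtain ⟨hs1, hs2⟩ := of_isPerm hs
  obtain ⟨ht1, ht2⟩ := of_isPerm ht
  intro h
  have key : ∀ l x y, x < 8 → y < 8 → Holds f (l / 64 * 64 + (8 * x + y)) →
      f x y = (l / 64 % 2 == 1) := by
    intro l x y hx hy h
    unfold Holds at h
    rwa [show (l / 64 * 64 + (8 * x + y)) / 8 % 8 = x by omega,
      show (l / 64 * 64 + (8 * x + y)) % 8 = y by omega,
      show (l / 64 * 64 + (8 * x + y)) / 64 % 2 = l / 64 % 2 by omega] at h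
  cases hc : Nat.ble 100000000 s with
  | true =>
    refine hp _ (hf.swap.reindex hs1 ht1 hs2 ht2) fun l hl => ?_
    have := h l hl
    rw [image, hc] at this
    exact key l _ _ (ht1 _ (Nat.mod_lt _ (by norm_num))) (hs1 _ (Nat.mod_lt _ (by norm_num))) this
  | false =>
    refine hp _ (hf.reindex hs1 ht1 hs2 ht2) fun l hl => ?_
    have := h l hl
    rw [image, hc] at this
    exact key l _ _ (hs1 _ (Nat.mod_lt _ (by norm_num))) (ht1 _ (Nat.mod_lt _ (by norm_num))) this

/-- A refutation of a pattern by a chain of forced literals. The step `(l, k, s, t)` derives `l`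
since its negation would complete the image under `(s, t)` of the impossible pattern at place `k`
of the list of known patterns. -/
abbrev Refutation := List ℕ × List (ℕ × ℕ × ℕ × ℕ)

/-- The set of literals of a pattern, as a bit mask. -/
def mask : List ℕ → ℕ
  | [] => 0
  | l :: p => mask p ||| 1 <<< l

theorem testBit_insert (m l k : ℕ) :
    (m ||| 1 <<< l).testBit k = true ↔ m.testBit k = true ∨ k = l := by
  rw [Nat.testBit_or, Nat.one_shiftLeft, Nat.testBit_two_pow, Bool.or_eq_true, decide_eq_true_iff,
    eq_comm (a := l)]

theorem mem_of_testBit_mask {p : List ℕ} {k : ℕ} (h : (mask p).testBit k = true) : k ∈ p := by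
  induction p with
  | nil => simp [mask] at h
  | cons l p ih =>
    rw [mask, testBit_insert] at h
    rcases h with h | rfl
    · exact List.mem_cons_of_mem _ (ih h)
    · exact List.mem_cons_self

/-- Whether the image of a pattern is contained in the set of literals `m`. -/
def containsImage (m s t : ℕ) : List ℕ → Bool
  | [] => true
  | l :: p => m.testBit (image s t l) && containsImage m s t p

theorem of_containsImage {m s t : ℕ} {p : List ℕ} (h : containsImage m s t p = true) :
    ∀ l ∈ p, m.testBit (image s t l) = true := by
  induction p with
  | nil => simp
  | cons l p ih =>
    rw [containsImage, Bool.and_eq_true] at h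
    exact List.forall_mem_cons.2 ⟨h.1, ih h.2⟩

/-- Whether the steps derive a contradiction from the set of literals `m`. -/
def checkSteps (known : List (List ℕ)) : ℕ → List (ℕ × ℕ × ℕ × ℕ) → Bool
  | _, [] => false
  | m, (l, k, s, t) :: steps =>
    isPerm s && isPerm t && containsImage (m ||| 1 <<< negate l) s t (known.getD k trueCycle) &&
      (m.testBit (negate l) || checkSteps known (m ||| 1 <<< l) steps)

theorem checkSteps_sound {known : List (List ℕ)} (hk : ∀ p ∈ known, Impossible p)
    {f : Colouring} (hf : Avoiding f) {steps : List (ℕ × ℕ × ℕ × ℕ)} {m : ℕ}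
    (h : checkSteps known m steps = true) : ¬ ∀ l, m.testBit l = true → Holds f l := by
  induction steps generalizing m with
  | nil => simp [checkSteps] at h
  | cons step steps ih =>
    obtain ⟨l, k, s, t⟩ := step
    intro hm
    simp only [checkSteps, Bool.and_eq_true, Bool.or_eq_true] at h
    obtain ⟨⟨⟨hs, ht⟩, hc⟩, h⟩ := h
    have hp : Impossible (known.getD k trueCycle) := by
      rw [List.getD_eq_getElem?_getD]
      cases hg : known[k]? with
      | none => exact impossible_trueCycle
      | some p => exact hk p (List.mem_of_getElem? hg)
    have hl : Holds f l := by
      by_contra hl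
      refine hp.of_image hs ht hf fun x hx => ?_
      rcases (testBit_insert _ _ _).1 (of_containsImage hc x hx) with h | h
      · exact hm _ h
      · rw [h, holds_negate_iff]
        exact hl
    rcases h with h | h
    · exact (holds_negate_iff f l).1 (hm _ h) hl
    · refine ih h fun x hx => ?_
      rcases (testBit_insert _ _ _).1 hx with hx | rfl
      · exact hm _ hx
      · exact hl

/-- Whether a list of refutations, each of which may use the patterns refuted before, is correct
and ends with a refutation of the empty pattern. -/
def checkRefutations : List (List ℕ) → List Refutation → Bool
  | known, [] => (known.headD trueCycle).isEmpty
  | known, (p, steps) :: rs => checkSteps known (mask p) steps && checkRefutations (p :: known) rs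

theorem checkRefutations_sound {rs : List Refutation} {known : List (List ℕ)}
    (hk : ∀ p ∈ known, Impossible p) (h : checkRefutations known rs = true) : Impossible [] := by
  induction rs generalizing known with
  | nil =>
    cases known with
    | nil => simp [checkRefutations, trueCycle] at h
    | cons p known =>
      simp only [checkRefutations, List.headD_cons, List.isEmpty_iff] at h
      exact h ▸ hk p List.mem_cons_self
  | cons r rs ih =>
    obtain ⟨p, steps⟩ := r
    rw [checkRefutations, Bool.and_eq_true] at h
    refine ih (List.forall_mem_cons.2 ⟨fun f hf hp => ?_, hk⟩) h.2
    exact checkSteps_sound hk hf h.1 fun l hl => hp l (mem_of_testBit_mask hl)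

set_option maxRecDepth 20000 in
/-- Refutations, found by a backtracking search, that lead to the empty pattern. -/
def certificate : List Refutation := [
  ([5, 26, 42, 52, 66, 70, 73, 78, 81, 83, 92, 93, 99, 100, 108, 114, 117],
    [(1, 1, 75163420, 76025431), (10, 1, 75063421, 76025431), (11, 1, 75214360, 71063452),
     (27, 1, 75412360, 74061352), (33, 1, 75214360, 73061452), (37, 1, 75312460, 74061352),
     (41, 1, 74215360, 73061452), (67, 0, 76324510, 76405123), (77, 0, 76421350, 76405321),
     (4, 1, 75342160, 76043152), (25, 1, 75243160, 76034152), (115, 0, 75426130, 76504321),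
     (2, 1, 75213460, 71065432)]),
  ([0, 7, 8, 12, 52, 53, 65, 70, 73, 74, 82, 92, 93, 95, 100, 102],
    [(21, 2, 76543210, 73064521), (87, 1, 75432610, 63217540), (1, 2, 76543210, 53064721)]),
  ([0, 5, 7, 8, 11, 13, 25, 26, 30, 33, 34, 41, 42, 47, 51, 52, 53, 57, 58, 62, 83, 88, 108, 124],
    [(91, 2, 76425310, 65427130), (96, 2, 76215340, 65437210), (103, 2, 62107543, 54306271),
     (109, 2, 74325610, 64217530), (125, 2, 64325710, 64327150), (127, 2, 62107543, 54306721),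
     (20, 3, 61057432, 62145703), (85, 2, 75432610, 76215430), (19, 3, 61057432, 62154703)]),
  ([0, 4, 5, 8, 12, 13, 25, 26, 30, 41, 42, 46, 48, 52, 53, 57, 58, 62, 65, 66, 70, 73, 74, 78,
    81, 82, 83, 88, 92, 93, 95, 99, 100, 108, 114, 124],
    [(7, 4, 76534210, 65074321), (15, 4, 76524310, 65023471), (55, 4, 75163420, 65027431),
     (38, 1, 76543210, 76543210), (3, 1, 76543210, 73546120), (11, 1, 76543201, 73546120),
     (33, 1, 76543210, 51047263), (34, 1, 76543210, 52047163), (51, 1, 71543206, 73546120),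
     (111, 0, 76543210, 76543210), (96, 0, 56473210, 6743215), (101, 0, 56473210, 56743210),
     (104, 0, 46573210, 6743215), (109, 0, 46573210, 56743210), (120, 0, 46753210, 6743215),
     (20, 4, 61075342, 62140753), (85, 3, 75432610, 76215430), (19, 4, 61053742, 62157403)]),
  ([0, 5, 8, 12, 25, 26, 41, 46, 52, 58, 65, 70, 71, 73, 74, 78, 82, 83, 92, 93, 99, 100, 114,
    118, 124],
    [(39, 5, 75342610, 54073261), (63, 5, 65374210, 65074321), (102, 4, 62107453, 54302761),
     (21, 5, 76543210, 73064521), (23, 5, 75324610, 54073621), (119, 4, 75432610, 63215740),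
     (1, 5, 75364210, 54076321)]),
  ([4, 5, 12, 13, 25, 26, 30, 41, 42, 46, 52, 53, 57, 58, 62, 65, 66, 70, 73, 74, 78, 81, 82, 83,
    88, 92, 93, 99, 100, 108, 113, 114, 118, 124],
    [(0, 6, 75162430, 76521340), (8, 6, 76524310, 76523401), (48, 6, 75163420, 76520431),
     (31, 1, 76543210, 76543210), (7, 0, 76543210, 76543210), (104, 5, 76423510, 65327104),
     (109, 5, 76423510, 64327150), (125, 5, 65423710, 64327150), (15, 0, 76543201, 76543120),
     (3, 3, 76543210, 53046127), (91, 5, 75426130, 65214073), (33, 6, 75162340, 75062341),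
     (34, 6, 76145320, 76524031), (96, 5, 76523410, 65327104), (101, 5, 76523410, 64327150),
     (103, 5, 62104573, 54307126), (111, 5, 62105743, 54307621), (127, 5, 62107543, 54307621),
     (20, 6, 61075432, 62147503), (21, 6, 61075432, 62157403), (119, 5, 75436210, 63217540),
     (1, 6, 75364210, 54067321)]),
  ([12, 24, 25, 26, 30, 41, 42, 46, 52, 53, 57, 58, 62, 65, 66, 70, 73, 74, 81, 82, 83, 92, 93,
    99, 100, 108, 114, 118, 119, 124],
    [(39, 7, 75364210, 54067321), (47, 7, 73165420, 65027431), (63, 7, 53167420, 65027431),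
     (96, 6, 62107543, 65432170), (98, 6, 62107453, 54306721), (102, 6, 62107453, 54302761),
     (0, 7, 75361240, 75462130), (7, 7, 75364210, 54076321), (8, 7, 75362410, 75462301),
     (21, 7, 76543210, 73064521), (87, 6, 75432610, 63217540), (1, 7, 75362410, 54067321)]),
  ([4, 5, 12, 13, 25, 26, 30, 41, 42, 46, 52, 53, 57, 58, 62, 65, 66, 70, 73, 74, 78, 81, 82, 83,
    92, 93, 99, 100, 108, 113, 114, 118, 124],
    [(24, 1, 76543210, 76543210), (31, 1, 76543210, 6543217), (55, 0, 76543210, 76543210),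
     (64, 7, 75421630, 63214570), (72, 7, 75426310, 63215704), (32, 8, 75361240, 75462130),
     (97, 7, 62107543, 75436210), (0, 8, 75362410, 75462310)]),
  ([4, 5, 12, 25, 30, 41, 42, 46, 52, 53, 54, 57, 62, 65, 66, 70, 73, 74, 78, 81, 82, 83, 92, 93,
    99, 100, 104, 108, 109, 113, 114, 124, 125],
    [(0, 9, 73162450, 76521340), (8, 9, 76324510, 76523401), (88, 8, 74216530, 75324610),
     (7, 3, 76543210, 72543160), (111, 8, 74325610, 53217640), (127, 8, 54327610, 53217640),
     (21, 9, 61075342, 62157043), (87, 8, 75432610, 63217540), (19, 9, 61075342, 62175043)]),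
  ([4, 5, 12, 13, 25, 26, 30, 41, 42, 46, 52, 53, 57, 58, 62, 65, 66, 70, 73, 74, 78, 81, 82, 83,
    92, 93, 99, 100, 108, 113, 114, 124],
    [(54, 1, 76543210, 76543210), (109, 9, 74215360, 73205164), (125, 9, 54217360, 73205164),
     (40, 0, 76543210, 76543210), (64, 9, 74216350, 75324610), (72, 9, 74326510, 73215604),
     (112, 9, 42107653, 75432601), (24, 10, 75162430, 76521340), (32, 10, 75314260, 75460312),
     (97, 9, 62107543, 75436210), (2, 10, 75316420, 75460132)]),
  ([4, 5, 12, 13, 25, 26, 30, 41, 42, 46, 52, 53, 66, 70, 73, 74, 78, 81, 82, 83, 92, 93, 99, 100,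
    108, 113, 114, 124],
    [(57, 11, 65317420, 75061432), (58, 11, 65312470, 75061342), (62, 11, 65374210, 75064312),
     (1, 0, 76543210, 76543210), (109, 10, 74216530, 76304521), (118, 10, 74216530, 75304621),
     (22, 0, 70543261, 71543620), (84, 10, 75416230, 73205461), (85, 10, 75416230, 73204561),
     (3, 11, 76543210, 76034512), (11, 11, 75362410, 75061432), (34, 11, 75162340, 73061542),
     (38, 11, 76543210, 73064512), (51, 11, 75364210, 75063412), (91, 10, 75426130, 76205431),
     (101, 10, 75216430, 76403521), (107, 10, 76215430, 75403621),
     (123, 10, 65217430, 75403621), (0, 8, 176543021, 72546013), (88, 10, 76215430, 75431620),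
     (96, 10, 76215340, 75431620), (104, 10, 64217350, 75431620), (120, 10, 65213470, 75431260),
     (8, 11, 75462310, 75461302), (112, 4, 65021743, 75624301), (2, 11, 75463210, 75460312)]),
  ([4, 5, 7, 12, 13, 25, 26, 41, 52, 53, 55, 60, 65, 66, 73, 81, 82, 83, 88, 92, 99, 100, 113,
    114],
    [(0, 12, 75162430, 76521340), (8, 12, 76524310, 76523401), (120, 11, 54326710, 63217405),
     (125, 11, 54326710, 63217540), (127, 11, 54326710, 63215740), (57, 12, 65124370, 76523401),
     (58, 12, 65173420, 76520431), (104, 11, 64217350, 76534210), (109, 11, 64325710, 76325140),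
     (111, 11, 64325710, 65327140), (21, 12, 61075342, 62157043), (87, 11, 75432610, 63217540),
     (19, 12, 61075342, 62175043)]),
  ([7, 12, 21, 23, 52, 53, 65, 70, 73, 78, 82, 84, 91, 92, 114, 118],
    [(3, 13, 75432610, 75034261), (75, 12, 75432610, 62107543), (1, 13, 75462310, 75062431)]),
  ([0, 5, 7, 12, 13, 20, 21, 24, 30, 52, 53, 55, 61, 63, 65, 70, 73, 83, 114, 122, 126],
    [(72, 13, 75436210, 63217540), (80, 13, 75436120, 63217540), (86, 13, 75416230, 73215460),
     (112, 13, 54327160, 63217540), (3, 14, 54327610, 75436201), (75, 13, 75436210, 62107543),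
     (1, 14, 54376210, 75462031)]),
  ([4, 5, 7, 12, 13, 15, 24, 25, 26, 30, 41, 42, 46, 52, 53, 55, 60, 65, 66, 70, 73, 74, 78, 81,
    82, 83, 91, 92, 93, 95, 99, 100, 113, 114, 118],
    [(33, 15, 75162340, 75062341), (34, 15, 75164320, 75062431), (38, 15, 76543210, 75064321),
     (32, 2, 71534260, 76543210), (61, 12, 65120734, 63217540), (21, 12, 167021345, 62105437),
     (63, 12, 65120734, 63215740), (23, 12, 165021347, 62105437),
     (122, 11, 167201354, 75612430), (126, 11, 127601354, 75612430),
     (20, 1, 76543210, 76543210), (64, 0, 76543210, 76543210), (72, 11, 127061354, 15702436),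
     (3, 15, 54327610, 75432610), (75, 14, 75436210, 62107543), (0, 15, 54376210, 75462130)]),
  ([4, 5, 13, 24, 25, 27, 30, 41, 42, 60, 65, 66, 70, 73, 81, 82, 83, 92, 95, 99, 100, 114, 118,
    127],
    [(57, 16, 65124370, 65023471), (58, 16, 65173420, 65027431), (62, 16, 65173420, 52067431),
     (64, 15, 64217530, 76534210), (72, 15, 65421370, 76325014), (75, 15, 65421370, 76205314),
     (32, 16, 75362140, 75462130), (97, 15, 62107543, 75436210), (0, 16, 75362410, 75462310)]),
  ([4, 5, 7, 8, 12, 20, 21, 24, 27, 30, 53, 55, 61, 70, 73, 74, 81, 114],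
    [(64, 16, 75436210, 63217540), (80, 16, 75436210, 63217504), (115, 16, 75426310, 76215304),
     (123, 16, 65427310, 76215304), (126, 16, 65427310, 73215604), (0, 17, 54376120, 75463210)]),
  ([4, 5, 12, 13, 25, 26, 30, 41, 42, 46, 52, 53, 60, 65, 66, 70, 73, 74, 78, 81, 82, 83, 92, 93,
    95, 99, 100, 108, 113, 114, 118],
    [(7, 18, 76534210, 65074321), (15, 18, 76524310, 65023471), (55, 18, 75163420, 65027431),
     (24, 5, 76543210, 76543210), (27, 2, 76543210, 76543210), (63, 1, 76543210, 76543210),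
     (23, 15, 165021347, 62105437), (61, 1, 76543210, 56743210), (21, 15, 167021345, 62105437),
     (20, 4, 70534261, 76543120), (72, 0, 76543210, 76543210), (32, 18, 75362410, 75462301),
     (64, 0, 76543201, 76543210), (33, 18, 75362410, 75462310), (34, 18, 75364210, 75462310),
     (38, 18, 75364210, 75426310), (75, 14, 25170643, 37612540), (80, 14, 13270654, 7632541),
     (101, 1, 156734021, 36542107), (103, 1, 176534021, 36542107), (97, 11, 176534021, 76542103)]),
  ([4, 5, 12, 13, 24, 26, 30, 31, 39, 41, 46, 47, 52, 53, 60, 65, 66, 70, 71, 73, 74, 78, 81, 82,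
    83, 99, 113, 114, 118, 119, 126],
    [(33, 19, 75361240, 54076231), (34, 19, 75361420, 54076231), (38, 19, 75364210, 54076321),
     (59, 19, 54367210, 54076321), (121, 1, 107534216, 56341027), (3, 19, 54361720, 54072613),
     (11, 19, 54367210, 54076132), (51, 19, 54362710, 54073162), (64, 15, 65071243, 5761432),
     (8, 19, 54367210, 54376120), (120, 18, 54326710, 76215403), (0, 19, 54362170, 54371260)]),
  ([4, 5, 12, 13, 24, 25, 26, 30, 31, 39, 41, 46, 47, 52, 53, 60, 65, 66, 70, 71, 73, 74, 78, 81,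
    82, 83, 92, 93, 99, 100, 113, 114, 118, 126],
    [(61, 20, 65173420, 72065431), (55, 0, 76543210, 76543210), (64, 19, 74216530, 65324710),
     (72, 19, 75426310, 63215704), (122, 19, 54217360, 63105274), (3, 20, 54327610, 75432610),
     (11, 20, 54376210, 75462130), (127, 19, 54327610, 62105743), (0, 20, 54376210, 54376210)]),
  ([4, 5, 12, 13, 24, 25, 26, 30, 31, 41, 42, 46, 52, 53, 60, 65, 66, 70, 71, 73, 74, 78, 81, 82,
    83, 92, 93, 99, 100, 108, 113, 114, 118],
    [(39, 21, 75342610, 54073261), (47, 21, 76354210, 65074321), (62, 0, 76543210, 76543210),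
     (64, 20, 64217530, 75324610), (72, 20, 65421370, 73215064), (119, 20, 54216370, 32105764),
     (32, 21, 75361240, 75462130), (33, 21, 75362410, 75462310), (122, 20, 62107543, 75436210),
     (127, 20, 62107543, 54327610), (0, 21, 54367210, 54367210)]),
  ([4, 5, 12, 13, 25, 26, 30, 41, 42, 46, 52, 53, 60, 65, 66, 70, 73, 74, 78, 81, 82, 83, 92, 93,
    99, 100, 108, 113, 114, 118],
    [(31, 3, 76543210, 76543210), (24, 3, 76543210, 6543217), (7, 0, 76543210, 76543210),
     (72, 21, 75423160, 63217045), (112, 21, 75423610, 63217054), (120, 21, 65423710, 63217045),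
     (122, 21, 65423710, 63107245), (126, 21, 65423710, 32107645), (3, 22, 54327610, 75432601),
     (11, 22, 54376210, 75460231), (33, 22, 75361240, 75460231), (34, 22, 75361420, 75460231),
     (40, 22, 76324510, 76523401), (61, 22, 65173420, 76025431), (64, 21, 76213450, 65437120),
     (119, 21, 54326710, 62107543), (127, 21, 54327610, 62107543), (0, 22, 54376210, 54367210)]),
  ([4, 5, 12, 13, 25, 26, 30, 41, 42, 46, 52, 53, 60, 65, 66, 70, 73, 74, 78, 81, 82, 83, 92, 93,
    99, 100, 108, 113, 114],
    [(54, 0, 76543210, 76543210), (121, 22, 54216370, 73205614), (122, 22, 54216370, 73105624),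
     (61, 23, 65173420, 76025431), (62, 0, 67543210, 76543210), (21, 20, 176021345, 12765430),
     (24, 10, 17543206, 67543210), (72, 22, 75426310, 73215604), (80, 22, 75412360, 73215064),
     (112, 22, 54217360, 73215604), (3, 23, 54316720, 75460123), (75, 22, 54327610, 72105643),
     (2, 23, 54312670, 75463012)]),
  ([5, 13, 25, 26, 30, 41, 42, 46, 52, 53, 66, 70, 73, 74, 78, 81, 82, 83, 92, 93, 99, 100, 108,
    113, 114],
    [(4, 24, 75316240, 75061234), (12, 24, 75314260, 75064312), (60, 12, 76543210, 76543210),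
     (1, 0, 76543210, 76543210), (109, 23, 74216530, 76304521), (118, 23, 74216530, 75304621),
     (122, 23, 54216730, 76305421), (126, 23, 64217530, 75304621), (61, 24, 65173420, 71065432),
     (22, 0, 70543261, 71543620), (84, 23, 75416230, 73205461), (85, 23, 75416230, 73204561),
     (3, 24, 76543210, 76034512), (11, 24, 75362410, 75061432), (34, 24, 75162340, 73061542),
     (38, 24, 76543210, 73064512), (51, 24, 75364210, 75063412), (91, 23, 75426130, 76205431),
     (101, 23, 75216430, 76403521), (107, 23, 76215430, 75403621),
     (121, 23, 54321670, 76203451), (90, 15, 65170243, 75621430)]),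
  ([0, 5, 7, 8, 13, 15, 25, 26, 30, 41, 42, 49, 51, 52, 53, 55, 65, 66, 67, 70, 73, 74, 78, 82,
    83, 88, 92, 93, 95, 99, 100, 104, 108],
    [(16, 25, 76543210, 76534021), (21, 25, 76543210, 76034521), (23, 25, 76543210, 65034721),
     (68, 24, 75436210, 63214750), (75, 24, 75432610, 64217530), (84, 24, 75436210, 63217450),
     (86, 24, 75416320, 74325160), (27, 25, 76453210, 76540321), (32, 25, 76534210, 76540321),
     (37, 25, 76534210, 76045321), (39, 25, 76534210, 65047321), (43, 25, 76435210, 76540321),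
     (97, 24, 75326410, 64327150), (98, 24, 75216340, 76435120), (89, 16, 173540621, 74532106)]),
  ([5, 7, 13, 15, 25, 26, 30, 41, 42, 46, 49, 52, 53, 55, 65, 66, 70, 73, 74, 78, 81, 82, 83, 88,
    92, 93, 95, 99, 100, 108, 109, 114],
    [(0, 26, 76512430, 76512340), (8, 26, 76524310, 76523401), (48, 26, 75163420, 76520431),
     (104, 25, 74216350, 76435120), (51, 13, 115632470, 17064532), (3, 0, 76543210, 76543210),
     (91, 25, 75423610, 76423150), (107, 25, 74325610, 76423150), (4, 26, 76453210, 76540321),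
     (12, 26, 76425310, 76523041), (33, 26, 76123540, 76523041), (34, 26, 76145320, 76524031),
     (38, 26, 76543210, 75064321), (96, 25, 75216340, 76543120), (101, 25, 75324610, 76325140),
     (64, 7, 175612340, 65102437)]),
  ([5, 7, 13, 24, 25, 26, 30, 40, 41, 46, 49, 52, 53, 55, 64, 65, 66, 70, 72, 73, 81, 82, 83, 92,
    93, 95, 99, 100, 107, 108, 109, 111],
    [(4, 27, 76435210, 76245310), (12, 27, 76425310, 76213540), (32, 27, 76325410, 76523401),
     (33, 27, 76325410, 76523410), (34, 27, 76345210, 76524310), (38, 27, 76345210, 75264310),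
     (101, 26, 75326410, 63207154), (103, 26, 75324610, 63207154),
     (112, 26, 72105643, 75436102), (68, 20, 167120354, 73602541)]),
  ([5, 13, 25, 26, 30, 41, 42, 46, 49, 52, 53, 65, 66, 70, 73, 74, 78, 81, 82, 83, 92, 93, 95, 99,
    100, 108, 114],
    [(7, 28, 76534210, 65074321), (15, 28, 76524310, 65023471), (55, 28, 75163420, 65027431),
     (109, 27, 74216350, 64307125), (111, 27, 74215360, 64307215), (24, 1, 76543210, 76543210),
     (64, 27, 74216530, 76435120), (72, 27, 75426310, 64327105), (40, 28, 76324510, 76523401),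
     (43, 0, 76543210, 76543210), (67, 27, 74216350, 76425103), (75, 27, 74326510, 64207135),
     (21, 28, 76543210, 76234510), (23, 28, 76543210, 65234710), (80, 27, 75416320, 64327105),
     (88, 5, 162745310, 72534106)]),
  ([5, 13, 24, 25, 26, 30, 42, 46, 49, 52, 53, 64, 65, 66, 70, 71, 72, 73, 74, 78, 81, 82, 83, 92,
    99, 100, 108, 112, 114],
    [(4, 29, 75342610, 76543201), (12, 29, 75314260, 76514320), (32, 29, 75312460, 75461302),
     (33, 29, 75316240, 75460231), (34, 29, 75316420, 75460231), (38, 29, 75342610, 75463201),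
     (39, 29, 75342610, 65473201), (101, 28, 75214360, 76325014), (118, 28, 72105643, 75432610),
     (96, 10, 176534120, 56342107)]),
  ([24, 26, 30, 31, 40, 41, 46, 49, 52, 54, 55, 64, 65, 66, 70, 72, 73, 74, 81, 82, 83, 99, 100,
    120],
    [(60, 30, 65324710, 76523401), (122, 29, 42107653, 76532410), (126, 29, 42107653, 75326410),
     (32, 30, 65371240, 75462130), (97, 29, 72106543, 54327610), (0, 30, 65372410, 75462310)]),
  ([5, 13, 25, 26, 30, 41, 42, 46, 49, 52, 53, 65, 66, 70, 73, 74, 78, 81, 82, 83, 92, 93, 99,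
    100, 108, 114],
    [(31, 2, 76543210, 76543210), (71, 30, 74213560, 64307215), (79, 30, 74203561, 64307215),
     (24, 2, 76543210, 6543217), (64, 30, 74216530, 76435120), (72, 30, 74206531, 76435120),
     (40, 31, 76324510, 76523401), (48, 1, 76543210, 76543210), (54, 1, 76543210, 70543216),
     (55, 1, 76543210, 60543217), (56, 0, 76543210, 76543210), (122, 30, 42106753, 75436021),
     (124, 30, 42106753, 75326401), (0, 31, 65374210, 76524310)]),
  ([0, 1, 4, 5, 8, 13, 25, 26, 30, 41, 42, 46, 48, 49, 52, 53, 66, 70, 73, 74, 78, 81, 82, 83, 88,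
    92, 93, 95, 99, 100, 104, 108, 109, 114],
    [(7, 32, 76534210, 65074312), (15, 32, 76513420, 51067432), (3, 19, 115632470, 67104532),
     (91, 31, 75423610, 76423150), (107, 31, 74325610, 76423150), (12, 32, 76413520, 75164032),
     (33, 32, 76514320, 75061432), (34, 32, 76512340, 75061342), (38, 32, 76543210, 75064312),
     (96, 31, 75216340, 76534120), (101, 31, 75324610, 76325140), (72, 13, 175612340, 65012437)]),
  ([1, 4, 5, 13, 25, 26, 30, 41, 42, 46, 49, 52, 53, 66, 70, 73, 74, 78, 81, 82, 83, 88, 92, 93,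
    99, 100, 108, 109, 114, 118],
    [(0, 33, 75162430, 75162340), (8, 33, 76513420, 75160432), (48, 33, 75163420, 75160432),
     (104, 32, 74216350, 76534120), (31, 0, 76543210, 76543210), (71, 32, 75423610, 64327150),
     (79, 32, 75426310, 65324170), (119, 32, 75423610, 64321750), (12, 33, 75361420, 51076432),
     (33, 33, 75361420, 54076132), (34, 33, 75361240, 54076132), (96, 32, 75216340, 76534120),
     (94, 4, 151430276, 56342107)]),
  ([5, 13, 25, 26, 41, 42, 52, 53, 66, 70, 73, 74, 78, 81, 82, 83, 92, 93, 99, 100, 108, 114],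
    [(30, 34, 76534210, 75064312), (46, 34, 76354210, 75064312), (49, 9, 76543210, 76543210),
     (1, 2, 76543210, 76543210), (118, 33, 74216530, 74305621), (4, 34, 75361240, 75062134),
     (109, 33, 74216530, 76304521), (24, 0, 76543210, 76543210), (64, 33, 74216530, 76534120),
     (72, 33, 75426130, 76324501), (112, 33, 74216350, 76534021), (12, 34, 75362410, 75162340),
     (32, 34, 75361240, 75462130), (33, 34, 75362410, 75462310), (101, 33, 75216430, 76324501),
     (88, 5, 171534260, 56342107)]),
  ([5, 10, 13, 25, 26, 41, 42, 52, 53, 65, 66, 70, 73, 78, 81, 82, 83, 92, 93, 99, 100, 108, 114],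
    [(30, 35, 76524310, 75023461), (46, 35, 76324510, 75023461), (113, 34, 74206531, 74305162),
     (77, 10, 76543201, 76543120)]),
  ([5, 26, 42, 52, 53, 66, 70, 73, 78, 81, 82, 83, 92, 93, 99, 100, 108, 114],
    [(13, 36, 76513420, 71065432), (25, 36, 76513420, 75061432), (41, 36, 76315420, 75061432),
     (10, 1, 76543210, 76543210), (1, 0, 76543210, 76543210), (68, 35, 75426130, 76304521),
     (37, 36, 76512430, 72061354), (49, 36, 75316240, 75061234), (51, 36, 75312640, 75061234),
     (54, 36, 75342160, 75043162), (75, 35, 75426130, 76405321), (91, 35, 74216350, 76405321),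
     (102, 35, 75204631, 74305612), (2, 36, 76543120, 75064312)]),
  ([5, 18, 26, 30, 34, 38, 42, 46, 51, 52, 53, 59, 60, 61, 66, 70, 73, 74, 81, 83, 84, 91, 92, 93,
    99, 100, 108, 114, 118, 122],
    [(3, 37, 75461230, 75062143), (4, 37, 75461230, 75062134), (21, 2, 75610234, 73621450),
     (107, 36, 74316250, 76104523), (126, 36, 65412370, 74105263), (22, 0, 76543210, 72543610),
     (37, 26, 75610243, 75621430), (0, 34, 175413062, 51427063), (80, 36, 76514320, 74315620),
     (88, 36, 75416230, 76413520), (96, 36, 75316240, 76413520), (104, 36, 74316250, 76413520),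
     (13, 37, 76035421, 76254301), (48, 37, 75463210, 75460312), (56, 37, 65473210, 75460312),
     (72, 36, 54327610, 76214350), (75, 36, 54327160, 76214530), (76, 36, 54327160, 76213540),
     (1, 37, 75461320, 75462301), (45, 37, 76045321, 76243501), (49, 37, 75462310, 75461302),
     (57, 37, 65472310, 75461302), (89, 36, 75413260, 76431250), (97, 36, 53217460, 76423510),
     (105, 36, 43217560, 76423510), (82, 28, 74610532, 74623105)]),
  ([5, 18, 26, 30, 42, 46, 51, 52, 53, 59, 60, 61, 66, 70, 73, 74, 78, 81, 83, 84, 91, 92, 93, 99,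
    100, 108, 114, 122],
    [(34, 38, 76512340, 75061342), (38, 38, 76543210, 75064312), (54, 0, 76543210, 76543210),
     (101, 37, 52106743, 74106352), (107, 37, 42106753, 75106432),
     (109, 37, 42106753, 74106352), (3, 38, 76543210, 76035412), (68, 29, 75610243, 75621430),
     (2, 38, 76543210, 76045312)]),
  ([5, 18, 26, 42, 51, 52, 53, 59, 60, 61, 66, 70, 73, 74, 78, 81, 83, 84, 92, 93, 99, 100, 108,
    114, 122],
    [(30, 39, 76534210, 75064312), (46, 39, 76354210, 75064312), (27, 0, 76543210, 76543210),
     (85, 38, 54107632, 76105432), (118, 38, 42107653, 75103462), (3, 39, 76543210, 76034512),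
     (4, 39, 75461230, 73062154), (34, 39, 76512340, 73061542), (38, 39, 76543210, 73064512),
     (101, 38, 75216430, 76104523), (94, 4, 75610243, 75621430)]),
  ([5, 18, 26, 49, 51, 53, 64, 66, 70, 73, 76, 78, 81, 83, 84, 89, 91, 92, 93, 97, 99, 100, 114],
    [(16, 40, 76513420, 75261340), (88, 5, 175062413, 74601325), (0, 40, 76512430, 75261340)]),
  ([18, 26, 34, 42, 49, 51, 52, 57, 59, 60, 66, 70, 73, 75, 78, 81, 83, 84, 89, 91, 92, 97, 99,
    100, 114, 122, 127],
    [(23, 41, 65413270, 54061372), (31, 41, 65412370, 54061372), (103, 18, 54607132, 54726310),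
     (2, 41, 65312470, 54061372)]),
  ([0, 5, 10, 18, 26, 34, 42, 48, 49, 51, 52, 53, 57, 60, 66, 70, 73, 75, 76, 78, 81, 83, 84, 89,
    91, 92, 93, 97, 99, 100, 101, 105, 107, 108],
    [(1, 42, 76512340, 72063451), (3, 42, 76512340, 72061453), (22, 42, 76023451, 72061534),
     (30, 42, 76034521, 72065431), (77, 24, 104762351, 75602431), (85, 24, 104762351, 75604312),
     (109, 24, 104762351, 74603215), (54, 17, 73610524, 75264310), (72, 41, 75436210, 75431620),
     (80, 41, 75416320, 75431620), (8, 42, 76054321, 76254310)]),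
  ([5, 10, 18, 26, 34, 42, 49, 51, 52, 53, 57, 59, 60, 66, 70, 73, 75, 76, 78, 81, 83, 84, 89, 91,
    92, 93, 97, 99, 100, 105, 107, 108, 114, 122],
    [(0, 2, 76543210, 76543210), (7, 2, 76543210, 6543217), (48, 1, 67543210, 6743215),
     (55, 1, 67543210, 76543210), (37, 0, 76543210, 76543210), (72, 42, 75326410, 64317520),
     (79, 42, 75324160, 64315270), (80, 42, 75316420, 64317520), (111, 42, 73214560, 64315270),
     (8, 43, 76054321, 65274310)]),
  ([5, 10, 18, 26, 34, 42, 49, 51, 52, 53, 57, 59, 60, 61, 66, 70, 73, 75, 78, 81, 83, 84, 89, 91,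
    92, 93, 97, 99, 100, 105, 107, 108, 114, 122],
    [(12, 0, 76543210, 76543210), (85, 43, 54307621, 76304152), (101, 43, 53207641, 76304152),
     (109, 43, 43207651, 76304152), (1, 44, 76512340, 72063451), (3, 44, 76512340, 72061453),
     (4, 44, 76512340, 72061354), (22, 44, 76023451, 72061453), (30, 44, 76035421, 72065431),
     (38, 44, 76045321, 72065431), (118, 43, 75431260, 75304261), (126, 43, 65431270, 75304261),
     (86, 35, 74610532, 75261430)]),
  ([5, 10, 18, 26, 34, 42, 49, 51, 52, 53, 57, 59, 60, 61, 66, 70, 73, 75, 78, 81, 83, 84, 91, 92,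
    93, 97, 99, 100, 105, 107, 108, 114, 122],
    [(25, 0, 76543210, 76543210), (77, 44, 54207631, 76405312), (85, 44, 54107632, 76405312),
     (101, 44, 52104673, 76402531), (109, 44, 42105673, 76402531), (1, 45, 76512340, 72063451),
     (3, 45, 76512340, 72061453), (4, 45, 76512340, 72061354), (22, 45, 76024351, 72061345),
     (30, 45, 76035421, 72065431), (38, 45, 76045321, 72065431), (118, 44, 75416230, 75403621),
     (126, 44, 65417230, 75403621), (86, 36, 74610532, 75261430)]),
  ([5, 10, 18, 26, 34, 42, 49, 51, 52, 53, 57, 59, 60, 61, 66, 70, 73, 75, 78, 81, 83, 84, 91, 92,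
    93, 97, 99, 100, 105, 108, 114, 122],
    [(43, 0, 76543210, 76543210), (77, 45, 43207651, 76405132), (89, 45, 42105673, 76502341),
     (101, 45, 32107654, 76405132), (1, 46, 76512340, 72063451), (3, 46, 76512340, 72061453),
     (4, 46, 76512340, 72061354), (22, 46, 76025341, 72061435), (30, 46, 76034521, 72065413),
     (38, 46, 76043521, 72065413), (46, 46, 76054321, 72064531), (109, 45, 43217560, 76204531),
     (118, 45, 43217560, 75204361), (126, 45, 43217560, 75204631), (86, 37, 74610532, 73265410)]),
  ([5, 10, 18, 26, 34, 42, 49, 51, 52, 53, 57, 59, 60, 61, 66, 70, 73, 75, 78, 81, 83, 84, 91, 92,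
    93, 97, 99, 100, 108, 114, 122],
    [(41, 0, 76543210, 76543210), (77, 46, 43207651, 76405312), (85, 46, 43107652, 76405312),
     (101, 46, 32107654, 76405312), (1, 47, 76512340, 72063451), (3, 47, 76512340, 72061453),
     (4, 47, 76512340, 72061354), (46, 47, 76054321, 72064531), (107, 46, 43217650, 76205431),
     (109, 46, 43217650, 76204351), (118, 46, 43217650, 75204361),
     (126, 46, 43216750, 75204361), (22, 47, 76024351, 72061345), (94, 38, 75610432, 75261430),
     (9, 47, 76035421, 72065431)]),
  ([5, 10, 18, 26, 34, 42, 51, 52, 53, 59, 60, 61, 66, 70, 73, 75, 78, 81, 83, 84, 91, 92, 93, 99,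
    100, 108, 114, 122],
    [(49, 48, 75413260, 75063412), (57, 48, 65413270, 75063412), (33, 0, 76543210, 76543210),
     (85, 47, 53107642, 76405312), (107, 47, 32105674, 76502341), (109, 47, 32105674, 76402531),
     (1, 48, 76413520, 72063451), (3, 48, 76412350, 72061453), (4, 48, 76412350, 72061354),
     (30, 48, 76035421, 72065431), (38, 48, 76045321, 72064531), (46, 48, 76053421, 72065431),
     (101, 47, 53217640, 76204351), (118, 47, 75216340, 75403621),
     (126, 47, 65217340, 75403621), (94, 39, 75610243, 75261430)]),
  ([5, 10, 18, 26, 42, 51, 52, 53, 59, 60, 61, 66, 70, 73, 78, 81, 83, 84, 91, 92, 93, 99, 100,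
    108, 114, 122],
    [(34, 49, 76512340, 75061342), (11, 0, 76543210, 76543210), (85, 48, 54307621, 76103452),
     (101, 48, 53207641, 76103452), (109, 48, 43207651, 76103452), (3, 49, 76512340, 72061453),
     (4, 49, 76512340, 72061354), (30, 49, 76035421, 72065431), (38, 49, 76045321, 72065431),
     (46, 49, 76054321, 72065431), (118, 48, 75426310, 75104623), (126, 48, 65427310, 75104623),
     (94, 38, 75610243, 73261540)]),
  ([5, 18, 26, 42, 51, 52, 53, 66, 70, 73, 78, 81, 83, 84, 92, 93, 99, 100, 108, 114, 122],
    [(59, 50, 65312470, 75061432), (60, 50, 65312470, 75061342), (61, 50, 65412370, 73061452),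
     (10, 10, 76543210, 76543210), (27, 0, 76543210, 76543210), (76, 49, 54207631, 76104532),
     (77, 49, 54207631, 76105432), (85, 49, 54107632, 76105432), (109, 49, 42107653, 76103452),
     (1, 50, 76513420, 72065431), (3, 50, 76512340, 72061543), (30, 50, 76035421, 72065431),
     (34, 50, 76512340, 73061542), (49, 50, 75413260, 73064512), (57, 50, 65413270, 73064512),
     (89, 49, 54217630, 76205431), (97, 49, 75216340, 76405321), (105, 49, 74216350, 76405321),
     (118, 49, 54217360, 74205361), (126, 49, 54217360, 74205631), (4, 50, 75423160, 73041562),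
     (22, 50, 76024351, 72063145), (102, 39, 73610542, 73265410), (9, 50, 76042531, 72063541)]),
  ([5, 18, 26, 34, 42, 51, 52, 53, 58, 66, 70, 73, 78, 81, 83, 84, 91, 92, 93, 99, 100, 101, 108,
    114],
    [(3, 51, 76512340, 72061453), (4, 51, 76512340, 72061354), (46, 51, 76054321, 72064531),
     (54, 16, 75610234, 75261430), (85, 50, 74312560, 74105263), (124, 50, 43217560, 75104263),
     (125, 50, 43217560, 74105263), (30, 51, 65037421, 72065431), (38, 51, 65047321, 72065431),
     (107, 50, 74216350, 75104623), (109, 50, 74215360, 74105263), (10, 28, 75610243, 75621430),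
     (75, 50, 75426310, 75104623), (76, 50, 75421360, 75104263), (77, 50, 75421360, 74105263),
     (1, 51, 76513420, 72063451), (49, 51, 75413260, 75063412), (89, 50, 75216430, 75403621),
     (97, 50, 75216340, 75403621), (22, 51, 76023451, 72061345), (0, 10, 76542310, 76543210),
     (72, 50, 75436210, 75431620), (80, 50, 75416320, 75431620), (8, 51, 76054321, 76254310)]),
  ([5, 18, 26, 34, 37, 42, 51, 52, 53, 58, 64, 66, 70, 73, 78, 81, 83, 84, 91, 92, 93, 99, 100,
    108, 114],
    [(24, 52, 76512430, 75261340), (32, 52, 76512340, 75261340), (40, 52, 76412350, 75261340),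
     (107, 51, 72105643, 76412350), (124, 51, 52107643, 76312450), (56, 52, 65412370, 75261340),
     (25, 15, 175062143, 74601325), (113, 51, 72106453, 76431520), (11, 52, 75413260, 75063412),
     (12, 52, 75413260, 75064312), (13, 52, 75413260, 74065312), (30, 52, 75134260, 75063412),
     (38, 52, 75143260, 75063412), (46, 52, 74153260, 75063412), (62, 52, 54173260, 75064312),
     (72, 51, 75206431, 76413520), (85, 51, 76104532, 74315602), (97, 51, 62107543, 75436201),
     (109, 51, 62107543, 74316250), (112, 51, 75204361, 76415203), (3, 52, 76453210, 76235410),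
     (4, 52, 76453210, 76245310), (80, 33, 75160432, 65201437), (0, 52, 75164320, 76521430)]),
  ([0, 5, 7, 18, 21, 26, 51, 52, 53, 58, 66, 67, 70, 73, 78, 81, 83, 84, 91, 92, 112, 114],
    [(8, 53, 75432160, 76534102), (24, 53, 75412360, 75461302), (68, 52, 75416230, 76314520),
     (79, 52, 76541320, 64317025), (119, 52, 75416230, 64317520), (123, 52, 54216730, 76415320),
     (124, 52, 54216730, 76315420), (2, 53, 54372160, 65043172)]),
  ([0, 5, 7, 18, 26, 34, 51, 52, 53, 58, 66, 67, 70, 73, 78, 81, 83, 84, 91, 92, 93, 99, 100,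
    114],
    [(21, 54, 76512340, 72061543), (48, 0, 76543210, 76543210), (95, 53, 75413260, 64317250),
     (103, 53, 75314260, 64317250), (3, 54, 76512340, 52061473)]),
  ([5, 18, 26, 42, 51, 52, 53, 58, 66, 70, 73, 78, 81, 83, 84, 91, 92, 93, 99, 100, 108, 114],
    [(34, 55, 76512340, 75061342), (37, 3, 76543210, 76543210), (0, 2, 76543210, 76543210),
     (7, 2, 76543210, 6543217), (3, 0, 76543210, 76543210), (80, 54, 75316420, 76413520),
     (87, 54, 75312460, 64107253), (88, 54, 75216430, 76413520), (95, 54, 75213460, 64107253),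
     (104, 54, 73216450, 76413520), (111, 54, 73215460, 64107253),
     (124, 54, 53214760, 76105243), (127, 54, 53217460, 64107253), (21, 55, 61035742, 62150743),
     (25, 55, 61047532, 65234701), (33, 55, 61075342, 65274031), (38, 55, 76045321, 53264701),
     (45, 55, 61047532, 62134750), (110, 54, 76105432, 74305612), (9, 55, 76054321, 75264301)]),
  ([5, 18, 25, 26, 49, 53, 65, 70, 72, 73, 81, 83, 99, 100, 108, 110],
    [(0, 56, 76354210, 75264310), (80, 55, 75416320, 76435120), (1, 56, 76354210, 75264301)]),
  ([5, 18, 26, 27, 42, 51, 52, 53, 58, 66, 70, 73, 78, 81, 83, 84, 92, 93, 99, 100, 107, 108,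
    114],
    [(34, 57, 76312540, 75061342), (37, 1, 76354210, 76543210), (68, 56, 75214360, 76105234),
     (45, 57, 76412530, 72061354), (54, 57, 75342160, 75043162), (102, 56, 72106453, 74103652),
     (110, 56, 72106543, 74103652), (10, 57, 76354210, 75064312), (13, 57, 76542130, 72063154),
     (21, 57, 76054321, 72063451), (49, 57, 75324160, 75043612), (65, 56, 75421360, 76405231),
     (76, 56, 75402361, 76105234), (25, 1, 76513240, 76541230), (75, 56, 75403621, 76403152),
     (8, 0, 76543210, 76543210), (64, 56, 75426310, 76435120), (80, 56, 75406321, 76435120),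
     (0, 57, 76354120, 75264310)]),
  ([5, 18, 26, 27, 42, 43, 51, 52, 53, 58, 66, 67, 70, 73, 78, 81, 83, 84, 92, 93, 99, 100, 108,
    114],
    [(21, 58, 76512340, 72061543), (37, 58, 76512340, 72061453), (54, 58, 75342160, 75034162),
     (68, 57, 75412360, 76105234), (94, 57, 74106352, 74105632), (102, 57, 75104632, 74105632),
     (110, 57, 74106532, 74105632), (10, 58, 76534210, 75064312), (45, 58, 76453120, 72045613),
     (76, 57, 74306521, 76104352), (69, 2, 76543120, 73564210)]),
  ([3, 5, 26, 27, 42, 43, 53, 58, 59, 66, 70, 71, 73, 78, 81, 83, 92, 93, 99, 100, 108, 114, 124],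
    [(47, 59, 76354210, 52074316), (63, 59, 65374210, 52074316), (109, 58, 64215730, 64105723),
     (119, 58, 74216530, 64105723), (125, 58, 64217530, 64105723), (30, 59, 76035421, 72065431),
     (34, 59, 75364210, 54072316), (39, 59, 75312460, 54061372), (126, 58, 62107543, 54106372),
     (9, 59, 65073421, 72065431)]),
  ([5, 18, 26, 42, 52, 53, 66, 70, 73, 78, 81, 83, 84, 92, 93, 99, 100, 108, 114],
    [(51, 60, 75312460, 75061432), (58, 9, 76543210, 76543210), (27, 4, 76543210, 76543210),
     (43, 2, 76543210, 76543210), (3, 1, 76543210, 76543210), (124, 59, 54216730, 76105423),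
     (59, 2, 56743210, 76543210), (7, 0, 76543210, 76543210), (87, 59, 75412360, 64107235),
     (95, 59, 74213560, 64107235), (111, 59, 74215360, 64107235), (127, 59, 54217360, 64107235),
     (13, 60, 76035421, 62057431), (34, 60, 76512340, 53061742), (46, 60, 76053421, 52067431),
     (55, 60, 75412360, 53061472), (62, 60, 65073421, 52067431), (74, 59, 75426130, 64107523),
     (101, 59, 75216430, 64107523), (103, 59, 75216430, 64105723),
     (109, 59, 74216530, 64107523), (125, 59, 64217530, 74105623), (25, 60, 61047532, 62037541),
     (38, 60, 76543210, 73065412), (105, 59, 62107453, 75403621), (17, 60, 61043752, 62034571)]),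
  ([18, 20, 26, 46, 52, 66, 68, 70, 73, 78, 81, 83, 92, 93, 99, 100, 108, 109, 114],
    [(27, 61, 76412350, 72061354), (43, 61, 76412530, 72061354), (118, 60, 74106532, 75104632),
     (2, 61, 75342160, 75043162)]),
  ([4, 5, 18, 20, 21, 26, 30, 42, 46, 52, 53, 66, 70, 73, 78, 81, 83, 88, 92, 93, 99, 100, 108,
    109, 114, 118],
    [(0, 62, 76512430, 75261340), (8, 62, 76024531, 76213450), (48, 62, 75063421, 75260431),
     (74, 61, 75436210, 76315420), (104, 61, 74316250, 76315420), (13, 62, 76053421, 76250431),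
     (3, 25, 176540312, 71534026), (75, 61, 75432610, 76215403), (91, 61, 76543210, 76413250),
     (107, 61, 76435210, 76413250), (115, 61, 75436210, 76213450), (12, 62, 74265310, 75163042),
     (16, 62, 75463210, 75463012), (25, 62, 74265310, 75463012), (34, 62, 72165340, 75163042),
     (41, 62, 74263510, 75463012), (65, 61, 76543210, 76531240), (96, 61, 75316240, 76315420),
     (101, 61, 76534210, 76315240), (113, 61, 75416320, 76534120),
     (110, 37, 172450316, 70543612)]),
  ([5, 18, 20, 26, 42, 52, 53, 66, 70, 73, 78, 81, 83, 92, 93, 99, 100, 108, 109, 114],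
    [(30, 63, 76035421, 72065431), (46, 63, 76053421, 72065431), (4, 1, 76543210, 76543210),
     (118, 62, 75416320, 73105624), (21, 26, 75610243, 74261530), (22, 2, 75610243, 74261530),
     (24, 0, 76543210, 76543210), (64, 62, 75416230, 76315420), (32, 63, 75361240, 75426130),
     (101, 62, 76514320, 76315024), (94, 0, 75610243, 75261430)]),
  ([5, 18, 20, 26, 42, 45, 52, 53, 66, 68, 70, 73, 78, 81, 83, 92, 93, 99, 100, 114],
    [(37, 64, 76512430, 72061354), (54, 64, 75342160, 75043162), (102, 63, 73106452, 73104652),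
     (13, 64, 76542130, 72063154), (51, 64, 75341260, 75046132), (67, 63, 74315260, 76105243),
     (75, 63, 74305261, 76105243), (21, 64, 76543210, 72064513), (91, 63, 74105362, 76105234),
     (10, 64, 76543210, 75064312), (107, 63, 74305621, 76105342), (69, 3, 76523140, 74531260)]),
  ([4, 5, 18, 20, 26, 45, 70, 71, 73, 78, 81, 83, 92, 99, 100, 108],
    [(31, 65, 76534210, 52074316), (111, 64, 76415320, 63105724), (6, 65, 76354210, 52074316)]),
  ([42, 52, 66, 70, 73, 78, 81, 83, 92, 93, 99, 100, 108, 114],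
    [(5, 66, 76512430, 72061345), (26, 66, 76512430, 75061342), (53, 64, 76543210, 76543210),
     (18, 29, 76543210, 76543210), (20, 5, 76543210, 76543210), (45, 2, 76543210, 76543210),
     (4, 1, 76543210, 76543210), (7, 0, 76543210, 76543210), (95, 65, 75413260, 63107245),
     (111, 65, 74315260, 63107245), (119, 65, 74316520, 63107524), (1, 66, 75163420, 65027431),
     (10, 66, 75063421, 65027431), (11, 66, 75214360, 51063472), (25, 66, 74213560, 53061472),
     (107, 65, 76425130, 76405321), (2, 66, 74312560, 54061372)]),
  ([26, 28, 42, 52, 66, 70, 73, 78, 81, 83, 93, 99, 100, 108, 114, 124],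
    [(58, 67, 65312470, 75061342), (40, 0, 36745210, 76043215), (45, 0, 36745210, 76543210),
     (47, 0, 36745210, 56743210), (56, 0, 36547210, 76043215), (117, 66, 42106573, 76314502),
     (119, 66, 42106573, 65314702), (37, 67, 75312460, 74061352), (39, 67, 75312460, 54061372),
     (95, 66, 62104573, 64317502), (21, 67, 75412360, 43061572), (23, 67, 75412360, 43061752),
     (80, 66, 63104572, 64315720), (84, 66, 76104532, 63107524), (96, 66, 63105742, 64317205),
     (98, 66, 63105742, 64317025), (5, 67, 75312460, 74361025), (7, 67, 75364210, 54372016),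
     (24, 67, 75412360, 74361052), (127, 66, 64217350, 64317205), (2, 67, 54312760, 53061472)]),
  ([26, 28, 42, 52, 58, 60, 66, 70, 73, 78, 81, 83, 93, 99, 100, 108, 114, 117],
    [(27, 68, 75412360, 74061352), (37, 68, 75312460, 74061352), (43, 1, 73425106, 72431560),
     (45, 1, 74365012, 71452360), (98, 67, 62107453, 76104253), (5, 68, 75312460, 74061325),
     (30, 68, 75036421, 74065231), (67, 67, 64215730, 76105243), (68, 67, 64215370, 76105324),
     (118, 67, 42106753, 75106423), (3, 68, 75346120, 75042613)]),
  ([26, 28, 42, 45, 52, 53, 58, 60, 66, 70, 73, 78, 81, 83, 93, 99, 100, 108, 111, 114],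
    [(7, 69, 76354210, 52074316), (5, 2, 107562134, 74601523), (95, 68, 54213760, 63107245),
     (119, 68, 74216350, 63107425), (127, 68, 64217350, 63107425), (10, 69, 73065421, 65027431),
     (13, 69, 76035421, 62057431), (27, 69, 75412360, 54061372), (123, 68, 54206731, 76105432),
     (2, 69, 54312760, 54061372)]),
  ([66, 70, 73, 78, 81, 83, 93, 99, 100, 108, 114],
    [(42, 70, 76312450, 75061342), (52, 70, 75312460, 75061342), (28, 3, 76543210, 76543210),
     (26, 3, 75603124, 73526410), (60, 2, 76543210, 76543210), (58, 2, 75603124, 73526410),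
     (53, 1, 76543210, 76543210), (45, 1, 75603124, 73526410), (47, 0, 76543210, 76543210),
     (95, 69, 42105673, 63107542), (127, 69, 42106573, 63104572), (7, 3, 65703124, 23576410),
     (69, 69, 74215360, 63107245), (39, 70, 76512430, 42061375), (59, 70, 65412730, 42061375),
     (91, 69, 42107653, 76103452), (98, 69, 72106543, 63104572), (101, 69, 72106453, 63104572),
     (2, 70, 76512340, 74061352)]),
  ([9, 23, 40, 41, 42, 49, 52, 55, 63, 66, 70, 78, 79, 81, 82, 83, 93, 99, 100, 108, 114, 124],
    [(56, 0, 110765234, 64310725), (74, 70, 43205761, 65432071), (1, 0, 76543201, 76543210),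
     (68, 70, 43216750, 65324701), (25, 0, 105762431, 72610345), (90, 70, 42105763, 65432071),
     (92, 70, 42106753, 65324701), (5, 71, 76512430, 71062345), (85, 70, 64312750, 64325701),
     (4, 71, 76513240, 71062534)]),
  ([9, 23, 42, 47, 49, 52, 66, 70, 78, 79, 81, 82, 83, 93, 99, 100, 108, 114],
    [(40, 1, 110765234, 74310526), (41, 1, 103765214, 75310426), (55, 1, 76543201, 16543720),
     (63, 1, 67543201, 16543720), (60, 0, 76543210, 76543210), (72, 71, 43206751, 65321470),
     (80, 71, 43107652, 65327410), (2, 1, 76543210, 76543201)]),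
  ([18, 23, 34, 46, 62, 63, 80, 84, 91, 93, 96, 97, 105, 108, 121, 123],
    [(37, 73, 61057342, 76241350), (109, 72, 63107542, 43107652), (16, 73, 61053742, 76245310)]),
  ([1, 3, 4, 9, 11, 12, 18, 22, 23, 34, 38, 39, 42, 46, 47, 49, 51, 52, 58, 60, 66, 70, 71, 74,
    78, 79, 81, 83, 84, 93, 96, 97, 99, 100, 105, 107, 108, 114, 118, 119],
    [(0, 7, 154762031, 75610243), (80, 73, 54316720, 76531420), (120, 73, 54321670, 76521340),
     (8, 49, 153672014, 75601423), (121, 73, 54326710, 76523410), (123, 73, 54327610, 76524310),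
     (62, 49, 34160725, 53726104), (63, 49, 34160725, 53627104), (27, 0, 76543210, 76543210),
     (88, 73, 75426130, 76524130), (37, 74, 61057432, 76243150), (109, 73, 63107542, 43107652),
     (16, 74, 61047532, 76243150)]),
  ([1, 3, 4, 9, 11, 12, 18, 22, 23, 34, 38, 39, 42, 46, 47, 49, 51, 52, 58, 60, 66, 70, 71, 74,
    78, 79, 81, 83, 84, 93, 97, 99, 100, 108, 114],
    [(105, 74, 43216750, 76503421), (107, 74, 64327510, 76504231),
     (118, 74, 54317260, 75304261), (119, 74, 54317260, 65304271), (32, 0, 76543210, 76543210),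
     (64, 74, 53216740, 76531420), (86, 0, 75603142, 31527460)]),
  ([0, 1, 3, 4, 5, 8, 9, 11, 12, 13, 18, 22, 23, 34, 38, 39, 42, 46, 47, 48, 49, 51, 52, 58, 62,
    63, 81, 83, 84, 93, 97, 99, 100, 108, 124],
    [(80, 72, 51274306, 7345621), (96, 72, 51472306, 7345621), (104, 72, 41572306, 7345621),
     (105, 72, 41572306, 17405623), (107, 72, 41572306, 37415620), (120, 72, 41752306, 7345621),
     (21, 2, 117435062, 61372054), (109, 75, 63105742, 43105762), (123, 75, 65432710, 76415230),
     (125, 75, 63107542, 43105762), (25, 76, 61075342, 76243510), (91, 75, 75426310, 76524310),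
     (16, 76, 61073542, 76245310)]),
  ([0, 1, 3, 4, 5, 8, 9, 11, 12, 18, 22, 23, 34, 38, 39, 42, 46, 47, 48, 49, 51, 52, 58, 62, 63,
    66, 70, 74, 78, 81, 83, 84, 93, 97, 99, 100, 108, 114, 124],
    [(77, 0, 76543210, 76543210), (25, 10, 76542310, 76341250), (91, 76, 75426310, 76524310),
     (92, 76, 75426310, 76523410), (102, 42, 75610324, 71625430)]),
  ([0, 1, 3, 4, 8, 9, 11, 12, 18, 22, 23, 34, 38, 39, 42, 46, 47, 48, 49, 51, 52, 58, 62, 63, 66,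
    70, 74, 78, 81, 83, 84, 93, 97, 99, 100, 108, 114, 124],
    [(77, 0, 76543201, 76543210), (25, 11, 76542310, 76341250), (91, 77, 75426310, 76524310),
     (92, 77, 75426310, 76523410), (102, 43, 75610324, 71625430)]),
  ([0, 1, 3, 4, 8, 9, 11, 12, 18, 22, 23, 34, 38, 39, 42, 46, 47, 49, 51, 52, 58, 62, 63, 66, 70,
    71, 74, 78, 81, 83, 84, 93, 97, 99, 100, 108, 114, 124],
    [(112, 0, 76543210, 76543210), (16, 12, 157314026, 71542063), (107, 78, 76315420, 75413620),
     (120, 78, 63104572, 54312670), (121, 78, 65317420, 75431620),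
     (123, 78, 65317420, 75413620), (110, 54, 34160725, 74620315)]),
  ([0, 1, 3, 4, 9, 11, 12, 18, 22, 23, 34, 38, 39, 42, 46, 47, 49, 51, 52, 58, 62, 63, 66, 70, 71,
    74, 78, 81, 83, 84, 93, 97, 99, 100, 108, 114, 124],
    [(72, 0, 76543210, 76543210), (16, 9, 76543210, 76541203), (107, 79, 76315420, 75413620),
     (120, 79, 63104572, 54312670), (121, 79, 65317420, 75431620),
     (123, 79, 65317420, 75413620), (110, 55, 34610725, 74620315)]),
  ([1, 3, 4, 9, 11, 12, 18, 22, 23, 34, 38, 39, 42, 46, 47, 49, 51, 52, 58, 66, 70, 71, 74, 78,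
    79, 81, 83, 84, 93, 97, 99, 100, 108, 114],
    [(124, 5, 76543210, 76543210), (62, 10, 56423710, 37514260), (63, 10, 56423710, 36514270),
     (64, 0, 76543210, 76543210), (72, 0, 76543201, 76543210), (16, 10, 76543210, 76541203),
     (96, 80, 63107542, 54317620), (104, 80, 63107452, 54317620), (113, 46, 153672041, 72610453)]),
  ([1, 4, 9, 12, 18, 22, 23, 38, 39, 42, 46, 47, 49, 51, 52, 66, 70, 71, 74, 78, 79, 81, 83, 84,
    93, 97, 99, 100, 108, 114],
    [(3, 11, 76543201, 76541230), (11, 11, 76543210, 76541230), (34, 9, 76523401, 76543210),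
     (122, 0, 76543210, 76543210), (57, 11, 61543270, 72543610), (41, 0, 75613042, 43527160),
     (118, 81, 74316250, 75403621), (119, 81, 74316250, 65403721), (124, 0, 75613042, 31576420),
     (6, 11, 56423710, 37514620)]),
  ([1, 9, 12, 18, 23, 39, 42, 46, 47, 49, 51, 52, 66, 70, 71, 74, 78, 79, 81, 83, 84, 93, 99, 100,
    108, 114],
    [(4, 10, 75613024, 13526470), (22, 12, 76543210, 17543260), (38, 12, 76523410, 17543260),
     (33, 0, 76543210, 76543210), (107, 82, 73216540, 75204361), (118, 82, 75316240, 53204671),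
     (67, 0, 107135462, 60324157), (10, 12, 107145362, 76324105)]),
  ([9, 12, 18, 23, 39, 42, 47, 49, 51, 52, 66, 70, 74, 78, 79, 81, 83, 84, 93, 99, 100, 108, 114],
    [(1, 13, 76543201, 76543210), (46, 13, 107135462, 70324156), (7, 0, 76543210, 76543210),
     (118, 83, 74325610, 53207641), (110, 0, 107135426, 60324157)]),
  ([9, 10, 11, 18, 23, 34, 42, 47, 49, 51, 52, 66, 70, 78, 79, 81, 83, 84, 93, 97, 99, 100, 105,
    107, 114, 117],
    [(1, 14, 75361042, 74652310), (71, 84, 75432160, 65407231), (3, 14, 75361042, 74652130),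
     (119, 84, 75436210, 65403721), (65, 0, 76543201, 26534710)]),
  ([9, 12, 18, 23, 42, 47, 49, 52, 66, 70, 78, 79, 81, 83, 84, 93, 99, 100, 108, 114],
    [(39, 15, 76523410, 16543270), (51, 15, 101765234, 74310265), (10, 1, 76543210, 76543210),
     (97, 85, 75306421, 65304172), (105, 85, 74306521, 65304172), (107, 85, 74302561, 65402731),
     (11, 15, 76543210, 76541230), (34, 15, 104765231, 75310246), (53, 0, 76543210, 76543210),
     (109, 85, 74302561, 64302751), (1, 15, 76351420, 71654230), (71, 85, 75432160, 65407231),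
     (3, 15, 76351420, 73654210), (119, 85, 75436210, 65403721), (65, 1, 76543201, 26534710)]),
  ([9, 49, 66, 70, 78, 79, 81, 83, 93, 99, 100, 108, 114],
    [(23, 16, 76543210, 16543270), (42, 16, 101765243, 74310256), (47, 16, 76243510, 16534270),
     (52, 16, 101765243, 74310265), (18, 14, 76543210, 76543210), (12, 14, 75603124, 13526470),
     (20, 0, 76543210, 76543210), (74, 86, 74305261, 65302741), (87, 0, 75603124, 13526470)]),
  ([8, 9, 11, 12, 15, 33, 34, 38, 42, 46, 48, 49, 51, 52, 55, 58, 62, 66, 70, 78, 81, 83, 93, 99,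
    100, 108, 114, 121, 124],
    [(74, 87, 53207461, 75432610), (104, 87, 73206451, 76543120), (107, 87, 73204561, 76541230),
     (111, 87, 73204561, 65431270), (120, 87, 63204571, 75431260),
     (123, 87, 53207461, 76543210), (127, 87, 53207461, 65437210), (0, 51, 35601724, 73620415),
     (1, 53, 150612347, 67102543), (103, 87, 75324610, 65421730), (3, 21, 36574201, 56741230),
     (96, 87, 75326140, 76523410), (4, 53, 150642731, 62105743), (5, 0, 36745201, 56403217),
     (101, 87, 75324610, 76425130), (25, 88, 61075432, 76234051), (91, 87, 75426310, 76524310),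
     (17, 88, 61034572, 76235041)]),
  ([8, 9, 11, 12, 15, 18, 22, 34, 38, 41, 42, 46, 48, 49, 51, 52, 55, 58, 62, 66, 70, 78, 81, 83,
    93, 97, 99, 100, 108, 114, 121, 123, 124],
    [(74, 88, 43207561, 75432610), (80, 88, 76305421, 75431620), (84, 88, 74305261, 76531240),
     (120, 88, 64305271, 75431260), (0, 57, 35601742, 73620415), (1, 54, 35601724, 73621405),
     (107, 88, 74325610, 76521340), (72, 0, 26453710, 76543210)]),
  ([8, 9, 12, 18, 34, 49, 55, 66, 70, 78, 83, 84, 90, 93, 100, 105, 107, 121],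
    [(16, 2, 170524613, 75430216), (103, 89, 75306421, 65431720), (73, 2, 104527613, 75430216)]),
  ([8, 9, 11, 15, 18, 22, 26, 30, 34, 38, 40, 42, 49, 51, 55, 62, 81, 93, 97, 99, 100, 107, 108,
    123, 124],
    [(87, 90, 74306251, 65431720), (89, 90, 74206351, 76543120), (103, 90, 73206451, 65431720),
     (127, 90, 64307251, 54317620), (21, 91, 61075432, 62074315), (37, 91, 61075432, 62074351),
     (45, 91, 61074532, 62074351), (61, 91, 61045732, 62074351), (80, 90, 64107352, 74315620),
     (88, 90, 76104532, 74316502), (16, 91, 61075432, 65274310)]),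
  ([8, 9, 12, 15, 42, 46, 48, 49, 52, 55, 58, 62, 66, 70, 78, 81, 83, 93, 99, 100, 108, 114, 121,
    124],
    [(11, 21, 56473210, 76541230), (34, 21, 61573240, 72541630), (38, 21, 16573240, 76541230),
     (51, 21, 51473260, 72541630), (97, 3, 76543210, 76543210), (18, 21, 61573420, 72541630),
     (22, 21, 16573420, 76541230), (123, 3, 46573210, 76541230), (105, 2, 76543210, 76543210),
     (84, 3, 46523710, 76513240), (107, 3, 26453710, 76541230), (26, 1, 76543210, 76543210),
     (30, 1, 71543260, 72543610), (104, 0, 76543210, 76543210), (0, 21, 36741250, 70643215),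
     (13, 4, 36745210, 56043217), (80, 0, 76243510, 76543210), (1, 21, 36741520, 71643205),
     (3, 21, 36741520, 73641205), (21, 18, 107435162, 61372054), (87, 91, 75436210, 64321750),
     (88, 91, 76541230, 76431520), (89, 91, 76543210, 76431250), (127, 91, 65407321, 43107625),
     (16, 92, 61075432, 65274310)]),
  ([8, 9, 15, 48, 49, 55, 66, 70, 78, 81, 83, 93, 99, 100, 108, 114, 121],
    [(12, 22, 56723410, 76513240), (42, 22, 61723450, 72513640), (46, 22, 16723450, 76513240),
     (52, 22, 51723460, 72513640), (58, 22, 61543270, 72543610), (62, 22, 16543270, 76543210),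
     (60, 0, 76543210, 76543210), (105, 92, 43207561, 76534210), (72, 0, 56723410, 76513240)]),
  ([8, 9, 15, 48, 49, 55, 57, 66, 70, 78, 81, 83, 89, 93, 99, 100, 108, 114],
    [(5, 23, 76541230, 75643210), (13, 23, 76425310, 76431250), (53, 23, 71425360, 72431650),
     (56, 0, 36547210, 76043215), (64, 93, 54321670, 64325710), (65, 93, 54321670, 64325701),
     (10, 23, 76543201, 76543210), (12, 23, 175062431, 72601345), (68, 93, 54326710, 76325104),
     (16, 6, 170512643, 54630217), (82, 93, 54306721, 76435102), (84, 93, 54306721, 76325104),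
     (85, 93, 54306721, 64327105), (11, 94, 76514230, 72063451), (40, 94, 76132450, 76215340),
     (42, 94, 76154230, 76024351), (115, 93, 43206751, 76543102), (1, 94, 75146230, 76043251)]),
  ([8, 9, 15, 25, 48, 49, 55, 57, 66, 70, 78, 81, 83, 88, 93, 99, 100, 108, 114],
    [(0, 7, 71546230, 50243617), (5, 7, 71546230, 5243617), (125, 94, 54327610, 64325170),
     (13, 7, 76543210, 56043217), (95, 94, 75421360, 64325170), (120, 94, 54321670, 64325710),
     (127, 94, 54321760, 64325170), (7, 7, 71546230, 7243615), (16, 1, 76543210, 76543201),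
     (85, 94, 75436120, 64327150), (87, 94, 75432610, 64327015), (45, 95, 61073542, 62170543),
     (111, 94, 74325610, 64325710), (19, 95, 61073542, 62150743)]),
  ([8, 24, 25, 31, 49, 55, 57, 66, 70, 78, 81, 83, 93, 99, 100, 108, 114, 117],
    [(1, 25, 75361024, 73652410), (0, 8, 73541206, 2643517), (7, 8, 73541206, 72643510),
     (11, 25, 75362014, 73152460), (67, 95, 75426310, 65427103), (91, 95, 75426310, 65427130),
     (123, 95, 65423710, 65427130), (12, 96, 75214360, 71064352), (46, 96, 72154360, 71064352),
     (68, 95, 75426310, 65327104), (92, 95, 75426310, 65327140), (116, 95, 75423610, 65327140),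
     (124, 95, 65423710, 65327140), (10, 96, 75216340, 71062534), (13, 96, 75213460, 71065342),
     (22, 96, 75124360, 71063452), (33, 96, 75124360, 76031452), (38, 96, 52147360, 71063452),
     (41, 96, 74125360, 76031452), (69, 95, 75426310, 64327105), (80, 95, 76513420, 54327160),
     (82, 95, 76534210, 75431620), (96, 95, 73216540, 54327160), (109, 95, 76423510, 64327150),
     (2, 96, 76153420, 76154302)]),
  ([66, 70, 78, 81, 83, 93, 99, 100, 108, 114],
    [(9, 26, 76543210, 76543210), (49, 26, 71543260, 72543610), (15, 9, 76543210, 76543210),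
     (8, 9, 76543210, 6543217), (48, 9, 71543260, 2543617), (55, 9, 71543260, 72543610),
     (57, 3, 76543210, 76543210), (25, 2, 76543210, 76543210), (24, 1, 76543210, 76543210),
     (31, 1, 76543210, 6543217), (53, 0, 76543210, 76543210), (125, 96, 54206731, 64327510),
     (13, 0, 71543260, 72543610), (120, 96, 54206371, 64325701), (72, 1, 36547210, 76543210)]),
  ([20, 21, 23, 25, 27, 36, 37, 39, 43, 66, 70, 78, 80, 81, 83, 93, 97, 99, 108, 109, 111, 114],
    [(4, 0, 163745201, 72350461), (5, 0, 173456201, 72150463), (7, 0, 163475201, 72350461),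
     (12, 0, 173465201, 72310465), (13, 0, 173564201, 72510463), (15, 0, 153764201, 72510463),
     (24, 0, 76534210, 76350214), (26, 0, 173456201, 72153406), (30, 0, 173564201, 72530461),
     (40, 0, 76354210, 76350214), (42, 0, 173425601, 72350416), (46, 0, 173465201, 72350461),
     (52, 0, 163745201, 72356401), (53, 0, 173456201, 72156403), (64, 80, 46753102, 53471260),
     (82, 80, 64753021, 76453102), (28, 0, 167312054, 73642501), (72, 97, 76524130, 63217504),
     (73, 97, 76524130, 63207514), (98, 97, 76214530, 76315204), (115, 97, 74216530, 76215304),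
     (118, 97, 74216530, 73215604), (0, 98, 75364210, 75463210)]),
  ([16, 21, 37, 39, 66, 70, 78, 81, 83, 93, 97, 108, 109, 111, 114, 123],
    [(4, 1, 67351042, 71654320), (7, 1, 67351042, 41657320), (8, 1, 57603142, 71526304),
     (76, 98, 76534210, 63217504), (19, 1, 67513042, 71546320)]),
  ([16, 21, 25, 27, 32, 37, 39, 66, 70, 78, 81, 83, 93, 97, 99, 108, 109, 111, 114, 115],
    [(4, 29, 74351062, 73654120), (7, 29, 74351062, 43657120), (12, 33, 73462015, 74132560),
     (77, 99, 76534210, 63217054), (89, 33, 74315062, 73456120)]),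
  ([9, 13, 16, 20, 21, 25, 27, 32, 36, 37, 39, 43, 51, 59, 66, 70, 78, 93, 108, 109, 111, 114],
    [(88, 100, 76504231, 76325401), (92, 100, 76504231, 76325041),
     (104, 100, 76204531, 76425031), (112, 100, 75204631, 76425031),
     (119, 100, 75204631, 64205731), (124, 100, 65204731, 76205431),
     (127, 100, 65204731, 64205731), (0, 101, 42167530, 63127450), (7, 101, 42175360, 63174502),
     (8, 101, 74213560, 53160472), (76, 100, 76534210, 63217540), (2, 101, 74213560, 53164072)]),
  ([9, 11, 16, 18, 20, 22, 23, 24, 25, 34, 36, 51, 59, 66, 70, 108, 109, 117],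
    [(74, 101, 76504231, 76532401), (76, 101, 76504231, 76534201),
     (119, 101, 75406231, 65423701), (126, 101, 65407231, 75423601),
     (127, 101, 65407231, 65423701), (2, 102, 43276510, 31067542)]),
  ([20, 21, 25, 27, 36, 37, 43, 66, 70, 78, 81, 83, 93, 97, 99, 108, 109, 111, 114],
    [(23, 5, 76354210, 46357210), (39, 5, 76543210, 46573210), (16, 4, 76543210, 76543210),
     (32, 4, 76523410, 76543210), (59, 3, 76543210, 76543210), (51, 2, 76543210, 76543210),
     (9, 2, 71523460, 72541630), (11, 2, 71523460, 72543610), (49, 2, 76523410, 76541230),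
     (77, 1, 76543210, 76543210), (18, 5, 73625401, 76423510), (34, 5, 73645201, 76423510),
     (117, 1, 71523460, 72543610), (22, 5, 73125406, 72463510), (88, 0, 76543210, 76543210),
     (1, 5, 176314205, 73520164), (64, 0, 73640215, 67523410), (4, 5, 136741025, 76250134),
     (72, 102, 76534210, 76534201), (74, 102, 76534210, 76534021),
     (90, 102, 76542310, 76504231), (118, 102, 75432610, 75204631),
     (119, 102, 75432610, 65204731), (0, 103, 74265310, 43167520)]),
  ([21, 25, 27, 36, 37, 41, 43, 47, 66, 70, 78, 80, 81, 83, 93, 97, 99, 108, 109, 114],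
    [(4, 6, 173546201, 72150463), (5, 6, 173456201, 72150463), (13, 6, 173564201, 72510463),
     (15, 6, 153764201, 72510463), (92, 103, 76421530, 63205714), (89, 0, 76254310, 6315247)]),
  ([20, 21, 25, 27, 36, 37, 41, 43, 66, 70, 78, 81, 83, 93, 97, 99, 108, 109, 114],
    [(47, 1, 76543210, 76543210), (40, 1, 76543210, 6543217), (16, 0, 76543210, 76543210),
     (92, 104, 76104352, 76325410), (23, 1, 76254310, 76315240), (24, 1, 76345210, 6543217),
     (96, 104, 76105342, 65327104), (88, 1, 76452310, 36105247)]),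
  ([20, 21, 25, 27, 28, 36, 37, 41, 43, 45, 66, 70, 78, 81, 83, 87, 93, 97, 99, 108, 114],
    [(8, 8, 157064231, 74510263), (12, 8, 107465231, 74310265), (73, 105, 76204531, 76204531),
     (75, 105, 76204531, 76204513), (80, 105, 76403521, 76324150),
     (96, 105, 76203541, 76324150), (48, 106, 75312460, 75461302),
     (113, 105, 74302561, 76324510), (2, 106, 75312460, 75463012)]),
  ([25, 36, 37, 41, 66, 70, 78, 81, 83, 93, 97, 99, 108, 114],
    [(20, 9, 76523410, 76543210), (21, 9, 76325410, 76453210), (27, 9, 76425310, 76413250),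
     (43, 9, 76423510, 76513240), (45, 1, 76543210, 76543210), (28, 1, 76345210, 76453210),
     (23, 0, 76543210, 76543210), (103, 106, 76104532, 63207514),
     (111, 106, 76105342, 63207145), (2, 9, 76543210, 46573210)]),
  ([20, 25, 28, 33, 36, 41, 66, 70, 78, 81, 93, 99, 107, 109, 114],
    [(8, 10, 74602135, 75126304), (15, 10, 74602135, 45126370), (24, 10, 76452310, 76135204),
     (87, 107, 76502431, 65327410), (111, 107, 76205431, 65327140), (2, 10, 76453210, 46537210)]),
  ([25, 33, 36, 37, 41, 66, 70, 78, 81, 83, 93, 99, 108, 109, 114],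
    [(20, 11, 76354210, 76354210), (27, 11, 76432510, 76135240), (28, 1, 76432510, 76135240),
     (43, 0, 76543210, 76543210), (85, 108, 76104532, 76205134), (105, 0, 76243510, 76513240)]),
  ([25, 28, 33, 37, 41, 45, 66, 70, 78, 81, 83, 93, 95, 99, 108, 114],
    [(21, 12, 76425310, 16435270), (20, 1, 76254310, 76314250), (23, 12, 76425310, 16437250),
     (103, 109, 76104532, 63207514), (111, 109, 76105432, 63207514), (2, 12, 76543210, 46573210)]),
  ([24, 28, 31, 32, 33, 41, 45, 47, 61, 66, 70, 78, 81, 83, 93, 108, 114],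
    [(121, 110, 62105743, 64327510), (124, 110, 62107543, 76324510), (2, 13, 46573210, 76541230)]),
  ([24, 25, 28, 31, 32, 33, 36, 37, 41, 45, 47, 66, 70, 78, 81, 83, 93, 99, 108, 114],
    [(125, 0, 76543210, 76543210), (8, 1, 172415306, 71352046), (79, 111, 76205431, 64327510),
     (101, 1, 107415326, 70352146)]),
  ([66, 70, 78, 81, 83, 93, 99, 108, 114],
    [(36, 15, 76543210, 76543210), (25, 15, 76425310, 76431250), (37, 15, 76345210, 76453210),
     (41, 15, 76423510, 76531240), (33, 5, 76543210, 76543210), (45, 3, 76543210, 76543210),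
     (28, 3, 76345210, 76453210), (31, 2, 76543210, 76543210), (24, 2, 76543210, 6543217),
     (40, 2, 76345210, 6453217), (47, 2, 76345210, 76453210), (96, 0, 76543210, 76543210),
     (12, 15, 171465203, 74310265), (72, 112, 76204531, 76324510),
     (73, 112, 76204531, 76324501), (48, 113, 75312460, 75461302),
     (113, 112, 72105643, 65327014), (2, 113, 75314260, 75460312)]),
  ([5, 6, 52, 54, 66, 78, 81, 83, 93, 99, 108, 126],
    [(10, 0, 67543201, 72543610), (13, 0, 67540231, 75243610), (58, 0, 61543207, 72543610),
     (124, 113, 54326710, 73106425), (60, 0, 65340217, 76253410)]),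
  ([1, 3, 4, 5, 32, 36, 40, 49, 51, 52, 53, 59, 60, 61, 62, 76, 78, 81, 83, 93, 99, 108],
    [(97, 114, 53217640, 76205341), (102, 114, 53217460, 75203641),
     (109, 114, 73214560, 76324051), (25, 115, 76042351, 72063154),
     (91, 114, 54217630, 76205431), (12, 115, 76042351, 72061354)]),
  ([4, 5, 52, 53, 54, 60, 61, 62, 66, 76, 78, 81, 83, 93, 99, 108, 114],
    [(1, 2, 76453120, 71534260), (3, 2, 76352140, 73154260), (32, 2, 171562403, 74031256),
     (39, 2, 107562413, 72031456), (40, 2, 176512304, 75032146), (47, 2, 107512364, 71032546),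
     (49, 2, 76350142, 73254160), (51, 2, 74352106, 72154360), (59, 1, 76352140, 73154260),
     (100, 0, 76543210, 76543210), (0, 2, 75361024, 73652401), (97, 115, 53217640, 76524310),
     (109, 115, 73216540, 64321570), (110, 115, 73216540, 54321670),
     (25, 116, 76053241, 72065134), (91, 115, 54217630, 76205431), (12, 116, 76053241, 72065314)]),
  ([4, 6, 12, 13, 45, 46, 53, 54, 55, 66, 81, 83, 93, 99, 108, 114],
    [(71, 116, 74326510, 32107654), (79, 116, 74325610, 32106574), (2, 3, 76543210, 67543210)]),
  ([66, 78, 81, 83, 93, 99, 108, 114],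
    [(6, 4, 76543210, 76543210), (4, 4, 76341250, 74653210), (5, 4, 76541230, 75643210),
     (52, 4, 75341206, 72653410), (53, 4, 73541206, 72643510), (54, 4, 71543206, 72543610),
     (62, 3, 76543210, 76543210), (60, 3, 76341250, 74653210), (61, 3, 76541230, 75643210),
     (12, 1, 76543210, 76543210), (13, 1, 70345216, 76453210), (28, 1, 70541236, 75643210),
     (30, 1, 70145236, 75463210), (45, 1, 70341256, 74653210), (46, 1, 70143256, 74563210),
     (119, 0, 76543210, 76543210), (64, 0, 70145236, 5463217), (50, 4, 167514302, 70532641)]),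
  ([66, 78, 81, 93, 99, 108, 114],
    [(19, 0, 76543210, 76543210), (11, 0, 76543120, 71543260), (13, 0, 76534120, 71345260),
     (20, 0, 76453210, 76534210), (25, 0, 76524310, 76341250), (28, 0, 76452310, 76134250),
     (33, 0, 76523410, 76541230), (101, 118, 76504321, 76205143), (2, 0, 76532410, 76145230)]),
  ([1, 2, 3, 5, 6, 8, 15, 16, 24, 32, 40, 41, 55, 58, 59, 60, 61, 78],
    [(74, 119, 64327150, 76543201), (82, 119, 64317250, 76543201),
     (83, 119, 64317250, 76542301), (91, 119, 64217350, 76542301),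
     (92, 119, 64217350, 76532401), (100, 119, 63217450, 76532401),
     (101, 119, 63217450, 76432501), (117, 119, 74326150, 64325701),
     (118, 119, 74326150, 54326701), (10, 120, 75064321, 71065432)]),
  ([78, 81, 93, 99, 108, 114],
    [(2, 1, 76543210, 76543210), (1, 1, 72654310, 76324150), (3, 1, 74653210, 76524310),
     (5, 1, 73654210, 76324510), (6, 1, 71654320, 71324650), (8, 1, 176543210, 72435160),
     (15, 1, 107543216, 72435160), (16, 1, 171654320, 76513240), (23, 1, 107654321, 76513240),
     (24, 1, 175643210, 72415360), (31, 1, 107643215, 72415360), (32, 1, 173654210, 72513460),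
     (39, 1, 107654213, 72513460), (40, 1, 174653210, 72413560), (47, 1, 107653214, 72413560),
     (55, 1, 107654312, 72513640), (57, 1, 7654312, 76324150), (58, 1, 7543216, 76543210),
     (59, 1, 7653214, 76524310), (60, 1, 7643215, 76523410), (61, 1, 7654213, 76324510),
     (105, 0, 76543210, 76543210), (0, 1, 75643102, 70523164), (73, 120, 65437120, 65432170),
     (77, 120, 65437120, 64321570), (82, 120, 65437210, 65431270),
     (90, 120, 65427310, 65431270), (91, 120, 65427310, 65421370),
     (100, 120, 65327410, 65321470), (109, 120, 64327510, 64321570),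
     (9, 121, 76054321, 76054321)]),
  ([0, 1, 7, 8, 9, 15, 16, 17, 25, 31, 68, 69, 70, 76, 78, 84, 85, 86, 93, 94, 114, 115],
    [(2, 48, 7326154, 71362054), (74, 121, 76543210, 65437102), (19, 122, 75432610, 71065324),
     (91, 121, 76543210, 65427310), (4, 122, 75423610, 71065324)]),
  ([0, 1, 7, 8, 9, 15, 16, 17, 23, 24, 25, 31, 49, 52, 53, 54, 55, 56, 57, 63, 69, 70, 78, 85, 86,
    93, 94, 99, 108, 114],
    [(68, 122, 75436210, 65324710), (76, 122, 75432610, 65327140),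
     (84, 122, 75436210, 65327410), (92, 122, 75426310, 65327410), (40, 9, 73624510, 76324501),
     (109, 122, 43217650, 64327150), (110, 122, 43217650, 54327160),
     (41, 9, 73624510, 76325410), (47, 9, 73624510, 16325470), (51, 0, 76543210, 76543210),
     (67, 122, 75436210, 65423710), (75, 122, 75432610, 65427130),
     (83, 122, 75436210, 65427310), (91, 122, 75426310, 65427310),
     (107, 122, 74326510, 65427310), (2, 92, 161720543, 75460321),
     (74, 122, 76543210, 65437102), (82, 122, 76542310, 65432710), (3, 123, 76453210, 71065423)]),
  ([0, 1, 7, 8, 9, 10, 15, 16, 17, 23, 25, 31, 69, 70, 77, 78, 85, 86, 94, 115, 116],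
    [(66, 123, 76543210, 65437102), (82, 123, 76543210, 65437120),
     (90, 123, 76542310, 65437120), (64, 1, 76543210, 76254310)]),
  ([0, 1, 7, 8, 9, 15, 16, 17, 23, 49, 53, 54, 55, 56, 57, 63, 70, 78, 86, 93, 99, 108, 114],
    [(69, 124, 75436210, 64325710), (77, 124, 75432610, 64327150),
     (85, 124, 75436210, 64327510), (24, 6, 72615340, 73425601), (94, 124, 54217630, 54327160),
     (25, 6, 72615340, 73426510), (31, 6, 72615340, 13426570), (116, 1, 76543210, 76543210),
     (115, 1, 76452130, 76534210), (74, 0, 76543210, 76543210), (66, 0, 76543201, 76543210),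
     (67, 0, 76543201, 76542310), (20, 125, 75462310, 71034652), (92, 124, 76543210, 65327410),
     (2, 125, 75463210, 71034652)]),
  ([0, 1, 2, 7, 8, 9, 15, 16, 17, 23, 48, 49, 55, 56, 57, 63, 70, 78, 86, 93, 99, 108, 114, 116,
    117, 126],
    [(74, 125, 75436210, 65437102), (82, 125, 75432610, 65432710),
     (122, 125, 65437210, 65432710), (67, 0, 70534621, 72345610), (68, 0, 70435621, 72435610),
     (69, 0, 70543621, 72543610), (75, 1, 56430712, 76254310), (20, 126, 54362710, 71054623),
     (26, 126, 75463210, 71045263), (92, 125, 76543210, 76532410), (3, 126, 75436210, 71054263)]),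
  ([0, 1, 7, 16, 17, 23, 48, 49, 54, 55, 56, 57, 63, 78, 93, 99, 108, 114],
    [(70, 126, 54316720, 54326710), (86, 126, 54317620, 54327160),
     (126, 126, 54317620, 54327610), (8, 7, 72654310, 70324651), (9, 7, 72654310, 71324650),
     (15, 7, 72654310, 17324650), (117, 1, 76543210, 76543210), (115, 1, 76534210, 76345210),
     (116, 1, 76435210, 76435210), (66, 0, 76543210, 76543210), (74, 0, 76543201, 76543210),
     (82, 0, 76543102, 76543210), (67, 2, 56437201, 76254310), (68, 2, 56437201, 76253410),
     (69, 2, 56437201, 76243510), (75, 2, 56437210, 76254310), (28, 127, 75436120, 71054362),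
     (30, 127, 75463210, 71045623), (124, 126, 54217360, 75321460), (3, 127, 54367210, 71054623)]),
  ([0, 1, 7, 16, 17, 23, 48, 49, 55, 56, 57, 58, 63, 78, 93, 99, 108, 115, 116, 117, 118],
    [(66, 127, 54317620, 65432710), (82, 127, 54316720, 65437120), (67, 0, 70531642, 73645210),
     (68, 0, 70431652, 74635210), (69, 0, 70541632, 75643210), (70, 0, 70543612, 76543210),
     (8, 30, 75463120, 72536401), (74, 127, 65432710, 65437120), (9, 30, 75463120, 72536410),
     (15, 30, 75463120, 12536470), (75, 0, 71653240, 73564210), (76, 0, 71643250, 74563210),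
     (77, 0, 71654230, 75364210), (83, 0, 72653140, 73564210), (26, 128, 75461320, 71064523),
     (28, 128, 75463120, 71065432), (42, 128, 74361520, 71065423),
     (84, 127, 65417320, 76531240), (88, 127, 54216730, 65437120),
     (104, 127, 43216750, 65437120), (2, 128, 76435210, 76150432)]),
  ([0, 1, 7, 16, 17, 23, 48, 49, 55, 56, 57, 63, 78, 93, 99, 108, 114],
    [(118, 1, 76543210, 76543210), (115, 1, 76531240, 73645210), (116, 1, 76431250, 74635210),
     (117, 1, 76541230, 75643210), (122, 0, 76543210, 76543210), (66, 0, 6543712, 76543210),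
     (67, 1, 70531642, 73645210), (68, 1, 70431652, 74635210), (69, 1, 70541632, 75643210),
     (70, 1, 70543612, 76543210), (8, 31, 27564130, 75346201), (9, 31, 27564130, 75346210),
     (15, 31, 27564130, 15346270), (75, 1, 61753240, 73524610), (76, 1, 61743250, 74523610),
     (77, 1, 61754230, 75324610), (82, 0, 20654731, 75364210), (83, 1, 72653140, 73564210),
     (26, 129, 75461320, 71064523), (30, 129, 75436120, 71065432),
     (36, 129, 75361420, 71065432), (37, 129, 75361420, 71064532),
     (42, 129, 74361520, 71065423), (45, 129, 74365120, 71065432),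
     (60, 129, 54361720, 71065423), (126, 128, 62107453, 73106452), (3, 129, 54361720, 71054623)]),
  ([0, 1, 7, 16, 17, 23, 49, 55, 56, 57, 63, 78, 93, 99, 108, 114],
    [(112, 0, 76543210, 76543210), (2, 8, 76543102, 72543061), (82, 129, 54316720, 65437102),
     (122, 129, 54317620, 65432710), (18, 10, 7654312, 76304251)]),
  ([0, 1, 7, 16, 17, 23, 55, 56, 57, 63, 78, 93, 99, 108, 114],
    [(113, 0, 76543210, 76543210), (2, 9, 76543102, 72543160), (82, 0, 172654130, 24513607),
     (14, 9, 76543210, 76543120)]),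
  ([78, 93, 99, 108, 114],
    [(17, 10, 76543210, 76543210), (0, 10, 76543102, 70543261), (1, 10, 76543102, 71543260),
     (7, 10, 76543102, 17543260), (16, 10, 76543210, 76543201), (23, 10, 76543210, 16543270),
     (56, 10, 27654310, 76324051), (57, 10, 27654310, 76324150), (63, 10, 27654310, 16324750),
     (119, 0, 76543210, 76543210), (66, 0, 172654130, 4513672), (2, 10, 76543102, 12543760)]),
  ([78, 93, 108, 114],
    [(35, 0, 76543210, 76543210), (0, 0, 76531402, 70645231), (1, 0, 76531402, 71645230),
     (3, 0, 76531402, 73645210), (7, 0, 76531402, 37645210), (16, 0, 76532410, 76045231),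
     (17, 0, 76532410, 76145230), (19, 0, 76532410, 76345210), (23, 0, 76532410, 36745210),
     (32, 0, 76543210, 76540231), (33, 0, 76543210, 76541230), (39, 0, 76543210, 36547210),
     (56, 3, 170654321, 46513720), (121, 132, 65314720, 65427103), (64, 3, 171654320, 46513720)]),
  ([78, 93, 114],
    [(44, 0, 76543210, 76543210), (3, 0, 76351402, 73654210), (4, 0, 76351402, 74653210),
     (17, 0, 76352410, 76154230), (19, 0, 76352410, 76354210), (32, 0, 76453210, 76504231),
     (33, 0, 76453210, 76514230), (104, 133, 76315420, 76524013), (14, 0, 76543210, 76504231)]),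
  ([93, 114],
    [(3, 0, 76543201, 73564210), (4, 0, 76543201, 74563210), (8, 0, 76543210, 70564231),
     (11, 0, 76543210, 73564210), (17, 0, 76543120, 71564230), (20, 0, 76543120, 74563210),
     (32, 0, 76524130, 75064231), (97, 134, 76532410, 76524103), (29, 0, 76524130, 75164230)]),
  ([93],
    [(50, 0, 76543210, 76543210), (2, 0, 73650421, 76243510), (3, 0, 73650421, 76342510),
     (9, 0, 73651420, 76143520), (11, 0, 73651420, 76342510), (16, 0, 73652410, 76043521),
     (17, 0, 73652410, 76143520), (112, 135, 75431260, 76543102), (29, 0, 76543210, 76543021)]),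
  ([],
    [(29, 0, 76543210, 76543210), (2, 0, 76540321, 76254310), (5, 0, 76540321, 76543210),
     (9, 0, 76541320, 76154320), (10, 0, 76541320, 76254310), (16, 0, 76542310, 76054321),
     (17, 0, 76542310, 76154320), (88, 136, 76543210, 76435012), (24, 0, 76543210, 76054321)])]

theorem checkRefutations_certificate :
    checkRefutations [falseCycle, trueCycle] certificate = true := by
  decide +kernel

theorem not_avoiding (f : Colouring) : ¬ Avoiding f := fun hf =>
  checkRefutations_sound (by simp [impossible_trueCycle, impossible_falseCycle])
    checkRefutations_certificate f hf (by simp)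

theorem hasCycleLen_ten {V : Type*} {G : SimpleGraph V} {x y : Fin 5 → V}
    (hx : Function.Injective x) (hy : Function.Injective y) (hxy : ∀ i j, x i ≠ y j)
    (h : ∀ i, G.Adj (x i) (y i)) (h' : ∀ i, G.Adj (x (i + 1)) (y i)) : HasCycleLen G 10 := by
  refine ⟨x 0, .cons (h 0) <| .cons (h' 0).symm <| .cons (h 1) <| .cons (h' 1).symm <|
    .cons (h 2) <| .cons (h' 2).symm <| .cons (h 3) <| .cons (h' 3).symm <| .cons (h 4) <|
    .cons (h' 4).symm .nil, ?_, rfl⟩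
  simp [Walk.cons_isCycle_iff, Walk.cons_isPath_iff, hx.eq_iff, hy.eq_iff, hxy,
    fun i j => (hxy i j).symm]

theorem hasCycleLen_eight_s13 {V : Type*} {G : SimpleGraph V} {x y : Fin 4 → V}
    (hx : Function.Injective x) (hy : Function.Injective y) (hxy : ∀ i j, x i ≠ y j)
    (h : ∀ i, G.Adj (x i) (y i)) (h' : ∀ i, G.Adj (x (i + 1)) (y i)) : HasCycleLen G 8 := by
  refine ⟨x 0, .cons (h 0) <| .cons (h' 0).symm <| .cons (h 1) <| .cons (h' 1).symm <|
    .cons (h 2) <| .cons (h' 2).symm <| .cons (h 3) <| .cons (h' 3).symm .nil, ?_, rfl⟩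
  simp [Walk.cons_isCycle_iff, Walk.cons_isPath_iff, hx.eq_iff, hy.eq_iff, hxy,
    fun i j => (hxy i j).symm]

theorem bRprop_ten_eight : BRprop 10 8 8 := by
  classical
  intro G _
  by_contra! hG
  let f : Colouring := fun i j =>
    decide (∃ (hi : i < 8) (hj : j < 8), G.Adj (inl ⟨i, hi⟩) (inr ⟨j, hj⟩))
  have hinl {k : ℕ} {a : Fin k → ℕ} (ha : ∀ i, a i < 8) (hinj : Function.Injective a) :
      Function.Injective fun i => (inl ⟨a i, ha i⟩ : Fin 8 ⊕ Fin 8) := fun i j hij => by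
    simpa [hinj.eq_iff] using hij
  have hinr {k : ℕ} {a : Fin k → ℕ} (ha : ∀ i, a i < 8) (hinj : Function.Injective a) :
      Function.Injective fun i => (inr ⟨a i, ha i⟩ : Fin 8 ⊕ Fin 8) := fun i j hij => by
    simpa [hinj.eq_iff] using hij
  refine not_avoiding f ⟨fun a b h => hG.1 ?_, fun a b h => hG.2 ?_⟩
  · refine hasCycleLen_ten (hinl h.left_lt h.left_inj) (hinr h.right_lt h.right_inj) (by simp)
      (fun i => ?_) (fun i => ?_)
    · simpa [f, h.left_lt, h.right_lt] using h.adj i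
    · simpa [f, h.left_lt, h.right_lt] using h.adj_succ i
  · refine hasCycleLen_eight_s13 (hinl h.left_lt h.left_inj) (hinr h.right_lt h.right_inj) (by simp)
      (fun i => ?_) (fun i => ?_)
    · simpa [f, h.left_lt, h.right_lt] using h.adj i
    · simpa [f, h.left_lt, h.right_lt] using h.adj_succ i

/-- A cycle of length `2 * k` meets every vertex cover in at least `k` vertices. -/
theorem le_card_of_hasCycleLen {V : Type*} {G : SimpleGraph V} {k : ℕ} (s : Finset V)
    (hs : ∀ u v, G.Adj u v → u ∈ s ∨ v ∈ s) (h : HasCycleLen G (2 * k)) : k ≤ s.card := by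
  obtain ⟨v, w, hw, hlen⟩ := h
  have hpos (i : Fin k) : ∃ n, (n = 2 * i.val + 1 ∨ n = 2 * i.val + 2) ∧ w.getVert n ∈ s := by
    rcases hs _ _ (w.adj_getVert_succ (i := 2 * i.val + 1) (by omega)) with h | h
    · exact ⟨_, .inl rfl, h⟩
    · exact ⟨_, .inr rfl, h⟩
  choose n hn hmem using hpos
  have hinj : Function.Injective fun i => w.getVert (n i) := fun i j hij => by
    have := hn i
    have := hn j
    have := hw.getVert_injOn (by simp; omega) (by simp; omega) hij
    omega
  simpa using Finset.card_le_card_of_injOn (s := Finset.univ) _ (fun i _ => hmem i) hinj.injOn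

theorem not_bRprop_ten_eight {b : ℕ} (hb : b < 8) : ¬ BRprop 10 8 b := by
  intro h
  let G : SimpleGraph (Fin b ⊕ Fin b) :=
    Kbb b ⊓ SimpleGraph.fromRel fun u _ => ∃ i : Fin b, u = inl i ∧ i.val < 4
  rcases h G inf_le_left with h | h
  · have := le_card_of_hasCycleLen (k := 5)
      ((Finset.univ.filter fun i : Fin b => i.val < 4).map .inl) ?_ h
    · have : (Finset.univ.filter fun i : Fin b => i.val < 4).card ≤ 4 := by
        interval_cases b <;> decide
      rw [Finset.card_map] at *
      omega
    · rintro (u | u) (v | v) <;> simp [G]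
  · have := le_card_of_hasCycleLen (k := 4)
      ((Finset.univ.filter fun i : Fin b => ¬ i.val < 4).map .inl) ?_ h
    · have : (Finset.univ.filter fun i : Fin b => ¬ i.val < 4).card ≤ 3 := by
        interval_cases b <;> decide
      rw [Finset.card_map] at *
      omega
    · rintro (u | u) (v | v) <;> simp [G]

/-- Theorem 6: `BR(C_{10}, C_8) = 8`; in particular every subgraph `G` of `K_{8,8}`
contains `C_{10}` or its bipartite complement contains `C_8`. -/
theorem stmt13 :
    IsLeast {b : ℕ | 0 < b ∧ BRprop 10 8 b} 8 ∧
    ∀ G : SimpleGraph (Fin 8 ⊕ Fin 8), G ≤ Kbb 8 →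
      HasCycleLen G 10 ∨ HasCycleLen (Kbb 8 \ G) 8 := by
  refine ⟨⟨⟨by norm_num, bRprop_ten_eight⟩, fun b hb => ?_⟩, bRprop_ten_eight⟩
  by_contra! hlt
  exact not_bRprop_ten_eight hlt hb.2
end
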